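/- Let s > 3/4 and let ε > 0 be sufficiently small. Then for every null form Q ∈ {Q_{0i}, Q_{ij} : i,j ∈ {1,2,3}} and all Schwartz functions u, v on ℝ^{1+3} one has ‖Λ_+^{−1} Λ_−^{ε−1} Q(u,v)‖_{H^{s,3/4+ε}} ≲ ‖Λ_+ u‖_{H^{s,3/4+ε}} ‖Λ_+ v‖_{H^{s,3/4+ε}}. In particular, for g-valued potentials A, A' the commutator null form estimates ‖Λ_+^{−1} Λ_−^{ε−1} Q[Λ^{−1} A, A']‖_{F^s} ≲ ‖A‖_{F^s} ‖A'‖_{F^s} and ‖Λ_+^{−1} Λ_−^{ε−1} Q_{ij}[Λ^{−1} A, Λ^{−1} ∂A']‖_{F^s} ≲ ‖A‖_{F^s} ‖A'‖_{F^s} hold. -/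

import Mathlib

noncomputable section

open MeasureTheory Complex
open scoped FourierTransform RealInnerProductSpace BigOperators

/-! ## Basic setup: space-time `ℝ^{1+3}` and Fourier analytic toolbox -/

/-- Space-time `ℝ^{1+3}` (used both for physical points `(t,x)` and
Fourier variables `(τ,ξ)`); coordinate `0` is time. -/
abbrev SpaceTime : Type := EuclideanSpace ℝ (Fin 4)

/-- Space `ℝ³`. -/
abbrev Space : Type := EuclideanSpace ℝ (Fin 3)

/-- The spatial part of a space-time point / frequency. -/
def spt (z : SpaceTime) : Space := (WithLp.equiv 2 (Fin 3 → ℝ)).symm fun i => z i.succ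

/-- The space-time point `(t, x)`. -/
def stpt (t : ℝ) (x : Space) : SpaceTime :=
  (WithLp.equiv 2 (Fin 4 → ℝ)).symm fun μ => Fin.cases t (fun i => x i) μ

/-- Japanese bracket `⟨x⟩ = (1+x²)^{1/2}`. -/
def jap (x : ℝ) : ℝ := Real.sqrt (1 + x ^ 2)

/-- The sign `±1` encoded by a boolean (`true ↦ +1`). -/
def sgnv (sg : Bool) : ℝ := if sg then 1 else -1

/-- Minkowski metric coefficient `η^{μμ}`, used to raise indices. -/
def mink (μ : Fin 4) : ℝ := if μ = 0 then -1 else 1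

section Ops

variable {E : Type*} [NormedAddCommGroup E] [NormedSpace ℂ E]

/-- Space-time Fourier transform. -/
def FT (u : SpaceTime → E) : SpaceTime → E := fun ζ => 𝓕 u ζ

/-- Inverse space-time Fourier transform. -/
def FTinv (u : SpaceTime → E) : SpaceTime → E := fun x => 𝓕⁻ u x

/-- Spatial Fourier transform. -/
def FT3 (u : Space → E) : Space → E := fun ξ => 𝓕 u ξ

/-- Inverse spatial Fourier transform. -/
def FT3inv (u : Space → E) : Space → E := fun x => 𝓕⁻ u x

/-- Weighted `L²`-norm (on the Fourier side). -/
def wnorm (w : SpaceTime → ℝ) (f : SpaceTime → E) : ℝ := (∫ ζ, (w ζ * ‖f ζ‖) ^ 2) ^ ((1:ℝ)/2)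

/-- Finiteness of the weighted `L²`-norm. -/
def wfin (w : SpaceTime → ℝ) (f : SpaceTime → E) : Prop :=
  MeasureTheory.HasFiniteIntegral (fun ζ => (w ζ * ‖f ζ‖) ^ 2) volume

/-- The weight of the wave-Sobolev space `H^{s,b}`. -/
def hWt (s b : ℝ) (ζ : SpaceTime) : ℝ := jap ‖spt ζ‖ ^ s * jap (|ζ 0| - ‖spt ζ‖) ^ b

/-- The weight of the space `X^{s,b}_±`. -/
def xWt (sg : Bool) (s b : ℝ) (ζ : SpaceTime) : ℝ :=
  jap ‖spt ζ‖ ^ s * jap (-(ζ 0) + sgnv sg * ‖spt ζ‖) ^ b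

/-- The norm of the wave-Sobolev space `H^{s,b}`:
`‖u‖ = ‖⟨ξ⟩^s ⟨|τ|-|ξ|⟩^b ũ(τ,ξ)‖_{L²}`. -/
def HsbNorm (s b : ℝ) (u : SpaceTime → E) : ℝ := wnorm (hWt s b) (FT u)

/-- Membership (finiteness of the norm) for `H^{s,b}`. -/
def HsbFin (s b : ℝ) (u : SpaceTime → E) : Prop := wfin (hWt s b) (FT u)

/-- The norm of `X^{s,b}_±` : `‖u‖ = ‖⟨ξ⟩^s ⟨-τ ± |ξ|⟩^b ũ(τ,ξ)‖_{L²}`. -/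
def XsbNorm (sg : Bool) (s b : ℝ) (u : SpaceTime → E) : ℝ := wnorm (xWt sg s b) (FT u)

/-- Membership (finiteness of the norm) for `X^{s,b}_±`. -/
def XsbFin (sg : Bool) (s b : ℝ) (u : SpaceTime → E) : Prop := wfin (xWt sg s b) (FT u)

/-- Fourier multiplier with (complex) symbol `m`. -/
def mult (m : SpaceTime → ℂ) (u : SpaceTime → E) : SpaceTime → E := FTinv fun ζ => m ζ • FT u ζ

/-- Fourier multiplier with real symbol `m`. -/
def rmult (m : SpaceTime → ℝ) (u : SpaceTime → E) : SpaceTime → E := mult (fun ζ => (m ζ : ℂ)) u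

/-- `Λ^α`, the multiplier with symbol `⟨ξ⟩^α`. -/
def Lam (α : ℝ) (u : SpaceTime → E) : SpaceTime → E := rmult (fun ζ => jap ‖spt ζ‖ ^ α) u

/-- `Λ₊^α`, the multiplier with symbol `⟨|τ|+|ξ|⟩^α`. -/
def LamPlus (α : ℝ) (u : SpaceTime → E) : SpaceTime → E := rmult (fun ζ => jap (|ζ 0| + ‖spt ζ‖) ^ α) u

/-- `Λ₋^α`, the multiplier with symbol `⟨|τ|-|ξ|⟩^α`. -/
def LamMinus (α : ℝ) (u : SpaceTime → E) : SpaceTime → E := rmult (fun ζ => jap (|ζ 0| - ‖spt ζ‖) ^ α) u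

/-- `D^α`, the multiplier with symbol `|ξ|^α`. -/
def Dop (α : ℝ) (u : SpaceTime → E) : SpaceTime → E := rmult (fun ζ => ‖spt ζ‖ ^ α) u

/-- `D₊^α`, the multiplier with symbol `(|τ|+|ξ|)^α`. -/
def DPlus (α : ℝ) (u : SpaceTime → E) : SpaceTime → E := rmult (fun ζ => (|ζ 0| + ‖spt ζ‖) ^ α) u

/-- `D₋^α`, the multiplier with symbol `||τ|-|ξ||^α`. -/
def DMinus (α : ℝ) (u : SpaceTime → E) : SpaceTime → E := rmult (fun ζ => |(|ζ 0| - ‖spt ζ‖)| ^ α) u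

/-- `|∇|`, the multiplier with symbol `|ξ|`. -/
def absNabla (u : SpaceTime → E) : SpaceTime → E := Dop 1 u

/-- The partial derivative `∂_μ` on space-time. -/
def pd (μ : Fin 4) (u : SpaceTime → E) : SpaceTime → E := fun x => fderiv ℝ u x (EuclideanSpace.single μ 1)

/-- The spatial partial derivative `∂_i` on `ℝ³`. -/
def pd3 (i : Fin 3) (u : Space → E) : Space → E := fun x => fderiv ℝ u x (EuclideanSpace.single i 1)

/-- The (inhomogeneous) Riesz transform `R_j = Λ^{-1} ∂_j`. -/
def Riesz (j : Fin 3) (u : SpaceTime → E) : SpaceTime → E := Lam (-1) (pd j.succ u)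

/-- The d'Alembertian `□ = ∂_t² - Δ`. -/
def box (u : SpaceTime → E) : SpaceTime → E :=
  fun x => pd 0 (pd 0 u) x - ∑ j : Fin 3, pd j.succ (pd j.succ u) x

/-- The `F^s` norm, `‖u‖_{F^s} = ‖Λ₊ u‖_{H^{s-1,3/4+ε}}`. -/
def FsNorm (ε s : ℝ) (u : SpaceTime → E) : ℝ := HsbNorm (s - 1) (3/4 + ε) (LamPlus 1 u)

/-- Membership in `F^s`. -/
def FsFin (ε s : ℝ) (u : SpaceTime → E) : Prop := HsbFin (s - 1) (3/4 + ε) (LamPlus 1 u)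

/-- The `G^r` norm, `‖v‖_{G^r} = ‖Λ₊ v‖_{H^{r-1,1/2+ε}}`. -/
def GrNorm (ε r : ℝ) (v : SpaceTime → E) : ℝ := HsbNorm (r - 1) (1/2 + ε) (LamPlus 1 v)

/-- Membership in `G^r`. -/
def GrFin (ε r : ℝ) (v : SpaceTime → E) : Prop := HsbFin (r - 1) (1/2 + ε) (LamPlus 1 v)

/-- The time slab `[0,T] × ℝ³`. -/
def slab (T : ℝ) : Set SpaceTime := {x | x 0 ∈ Set.Icc 0 T}

/-- `u` belongs to the restriction to `[0,T]` of the space with defining predicate `P`: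
it has an extension lying in that space. -/
def MemRestrict (P : (SpaceTime → E) → Prop) (T : ℝ) (u : SpaceTime → E) : Prop :=
  ∃ U : SpaceTime → E, P U ∧ Set.EqOn U u (slab T)

/-- The spatial Sobolev `H^s(ℝ³)` norm. -/
def HNorm (s : ℝ) (f : Space → E) : ℝ :=
  (∫ ξ, (jap ‖ξ‖ ^ s * ‖FT3 f ξ‖) ^ 2) ^ ((1:ℝ)/2)

/-- Membership in the spatial Sobolev space `H^s(ℝ³)`. -/
def MemHs (s : ℝ) (f : Space → E) : Prop :=
  MeasureTheory.HasFiniteIntegral (fun ξ => (jap ‖ξ‖ ^ s * ‖FT3 f ξ‖) ^ 2) volume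

/-- Continuity with values in `H^s` on the time interval `[0,T]` (for a space-time function). -/
def ContHsOn (s T : ℝ) (u : SpaceTime → E) : Prop :=
  (∀ t ∈ Set.Icc (0:ℝ) T, MemHs s fun ξ => u (stpt t ξ)) ∧
  ∀ t ∈ Set.Icc (0:ℝ) T,
    Filter.Tendsto (fun t' => HNorm s fun ξ => u (stpt t' ξ) - u (stpt t ξ))
      (nhdsWithin t (Set.Icc 0 T)) (nhds 0)

end Ops

/-- The angle weight `|∠(±₁ξ₁, ±₂ξ₂)|`. -/
def angleWt (sg1 sg2 : Bool) (η θ : SpaceTime) : ℝ :=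
  |InnerProductGeometry.angle (sgnv sg1 • spt η) (sgnv sg2 • spt θ)|

/-- The bilinear null-form operator `B_{±₁,±₂}`, defined by its space-time Fourier transform
`𝓕(B(u,v))(ζ) = ∫ |∠(±₁ξ₁, ±₂ξ₂)| ũ(ζ₁) ṽ(ζ-ζ₁) dζ₁`. -/
def Bop (sg1 sg2 : Bool) (u v : SpaceTime → ℂ) : SpaceTime → ℂ :=
  FTinv fun ζ => ∫ η, (angleWt sg1 sg2 η (ζ - η) : ℂ) * FT u η * FT v (ζ - η)

/-! ## Null forms -/

/-- The null form `Q₀(u,v) = ∂_α u ∂^α v`. -/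
def Q0f (u v : SpaceTime → ℂ) : SpaceTime → ℂ := fun x => ∑ μ : Fin 4, mink μ • (pd μ u x * pd μ v x)

/-- The null form `Q_{αβ}(u,v) = ∂_α u ∂_β v - ∂_β u ∂_α v`. -/
def Qf (α β : Fin 4) (u v : SpaceTime → ℂ) : SpaceTime → ℂ :=
  fun x => pd α u x * pd β v x - pd β u x * pd α v x

/-! ## Matrix-valued (Lie algebra) objects -/

/-- `n×n` complex matrices, the ambient space of `su(n,ℂ)`. -/
abbrev G (n : ℕ) : Type := Matrix (Fin n) (Fin n) ℂ

attribute [local instance] Matrix.frobeniusNormedAddCommGroup Matrix.frobeniusNormedSpace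

/-- Membership in the Lie algebra `su(n,ℂ)` (trace-free skew-hermitian matrices). -/
def IsSu {n : ℕ} (X : G n) : Prop := X.conjTranspose = -X ∧ X.trace = 0

/-- The matrix commutator `[X,Y] = XY - YX`. -/
def mcomm {n : ℕ} (X Y : G n) : G n := X * Y - Y * X

/-- The commutator null form `Q_{αβ}[u,v] = [∂_α u, ∂_β v] - [∂_β u, ∂_α v]`. -/
def Qc {n : ℕ} (α β : Fin 4) (u v : SpaceTime → G n) : SpaceTime → G n :=
  fun x => mcomm (pd α u x) (pd β v x) - mcomm (pd β u x) (pd α v x)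

/-- The commutator null form `Q₀[u,v] = [∂_α u, ∂^α v]`. -/
def Q0c {n : ℕ} (u v : SpaceTime → G n) : SpaceTime → G n :=
  fun x => ∑ μ : Fin 4, mink μ • mcomm (pd μ u x) (pd μ v x)

/-! ## Dirac operators -/

/-- The spinor space `ℂ⁴`. -/
abbrev C4 : Type := EuclideanSpace ℂ (Fin 4)

/-- A `4×4` matrix acting on `ℂ⁴`. -/
def matAct (M : Matrix (Fin 4) (Fin 4) ℂ) (v : C4) : C4 :=
  (WithLp.equiv 2 (Fin 4 → ℂ)).symm (M.mulVec ((WithLp.equiv 2 (Fin 4 → ℂ)) v))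

/-- The Dirac matrices `α^0 = I`, `α^j = ((0,σ^j),(σ^j,0))`. -/
def alphaMat : Fin 4 → Matrix (Fin 4) (Fin 4) ℂ
  | 0 => 1
  | 1 => !![0,0,0,1; 0,0,1,0; 0,1,0,0; 1,0,0,0]
  | 2 => !![0,0,0,-I; 0,0,I,0; 0,-I,0,0; I,0,0,0]
  | 3 => !![0,0,1,0; 0,0,0,-1; 1,0,0,0; 0,-1,0,0]

/-- Matrix-symbol Fourier multiplier on spinor fields (space-time). -/
def multM (m : SpaceTime → Matrix (Fin 4) (Fin 4) ℂ) (u : SpaceTime → C4) : SpaceTime → C4 :=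
  FTinv fun ζ => matAct (m ζ) (FT u ζ)

/-- Matrix-symbol Fourier multiplier on spinor fields (space). -/
def multM3 (m : Space → Matrix (Fin 4) (Fin 4) ℂ) (u : Space → C4) : Space → C4 :=
  FT3inv fun ξ => matAct (m ξ) (FT3 u ξ)

/-- The symbol `Π(±ξ) = ½(I ± ξ_j α^j / |ξ|)` of the Dirac projections. -/
def PiSymb (sg : Bool) (ξ : Space) : Matrix (Fin 4) (Fin 4) ℂ :=
  (2⁻¹ : ℂ) • (1 + ∑ j : Fin 3, ((sgnv sg * ξ j / ‖ξ‖ : ℝ) : ℂ) • alphaMat j.succ)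

/-- The Dirac projection `Π_± = Π_±(∇/i)` (space-time version). -/
def PiProj (sg : Bool) (u : SpaceTime → C4) : SpaceTime → C4 := multM (fun ζ => PiSymb sg (spt ζ)) u

/-- The Dirac projection `Π_± = Π_±(∇/i)` acting on functions of the space variable. -/
def PiProj3 (sg : Bool) (u : Space → C4) : Space → C4 := multM3 (fun ξ => PiSymb sg ξ) u

namespace NullForm

open scoped ENNReal

/-- The `L²` norm of an `ℝ≥0∞`-valued function. -/
def nl2 {α : Type*} [MeasureSpace α] (f : α → ℝ≥0∞) : ℝ≥0∞ := (∫⁻ x, f x ^ 2) ^ ((1 : ℝ) / 2)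

lemma nl2_sq {α : Type*} [MeasureSpace α] (f : α → ℝ≥0∞) : nl2 f ^ 2 = ∫⁻ x, f x ^ 2 := by
  unfold nl2
  rw [← ENNReal.rpow_natCast, ← ENNReal.rpow_mul]
  norm_num

lemma lintegral_mul_le_nl2 {α : Type*} [MeasureSpace α] {f g : α → ℝ≥0∞}
    (hf : Measurable f) (hg : Measurable g) : ∫⁻ x, f x * g x ≤ nl2 f * nl2 g := by
  have := ENNReal.lintegral_mul_le_Lp_mul_Lq (volume : Measure α)
    (Real.HolderConjugate.two_two) hf.aemeasurable hg.aemeasurable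
  simpa [nl2] using this

lemma nl2_mul_le_of_le {α : Type*} [MeasureSpace α] {f g : α → ℝ≥0∞} (h : ∀ x, f x ≤ g x) :
    nl2 f ≤ nl2 g := by
  unfold nl2
  gcongr
  exact h _

lemma nl2_const_mul {α : Type*} [MeasureSpace α] {f : α → ℝ≥0∞} (hf : Measurable f) (c : ℝ≥0∞) :
    nl2 (fun x => c * f x) = c * nl2 f := by
  unfold nl2
  simp_rw [mul_pow]
  rw [lintegral_const_mul _ (by fun_prop), ENNReal.mul_rpow_of_nonneg _ _ (by norm_num),
    ← ENNReal.rpow_natCast, ← ENNReal.rpow_mul]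
  norm_num

/-- Fubini for the `L²` norm. -/
lemma nl2_prod {α β : Type*} [MeasureSpace α] [MeasureSpace β] [SFinite (volume : Measure β)]
    {f : α × β → ℝ≥0∞} (hf : Measurable f) :
    nl2 f = nl2 fun a => nl2 fun b => f (a, b) := by
  rw [nl2, nl2]
  congr 1
  simp_rw [nl2_sq]
  rw [Measure.volume_eq_prod, lintegral_prod _ (by fun_prop)]

lemma nl2_prod_symm {α β : Type*} [MeasureSpace α] [MeasureSpace β] [SFinite (volume : Measure α)]
    [SFinite (volume : Measure β)] {f : α × β → ℝ≥0∞} (hf : Measurable f) :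
    nl2 f = nl2 fun b => nl2 fun a => f (a, b) := by
  rw [nl2, nl2]
  congr 1
  simp_rw [nl2_sq]
  rw [Measure.volume_eq_prod, lintegral_prod_symm _ (by fun_prop)]

lemma measurable_nl2 {α β : Type*} [MeasurableSpace α] [MeasureSpace β]
    [SFinite (volume : Measure β)] {f : α → β → ℝ≥0∞} (hf : Measurable (Function.uncurry f)) :
    Measurable fun a => nl2 (f a) := by
  unfold nl2
  refine Measurable.pow_const ?_ _
  exact Measurable.lintegral_prod_right' (f := fun p : α × β => f p.1 p.2 ^ 2)
    (by exact hf.pow_const 2)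

instance measurableAdd₂_prod {α β : Type*} [Add α] [Add β] [MeasurableSpace α] [MeasurableSpace β]
    [MeasurableAdd₂ α] [MeasurableAdd₂ β] : MeasurableAdd₂ (α × β) :=
  ⟨(measurable_fst.fst.add measurable_snd.fst).prodMk (measurable_fst.snd.add measurable_snd.snd)⟩

lemma nl2_add_left {α : Type*} [AddCommGroup α] [MeasureSpace α] [MeasurableAdd₂ α]
    [(volume : Measure α).IsAddLeftInvariant] (f : α → ℝ≥0∞) (a : α) :
    nl2 (fun x => f (a + x)) = nl2 f := by
  unfold nl2
  rw [lintegral_add_left_eq_self (fun x => f x ^ 2) a]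

lemma nl2_sub_left {α : Type*} [AddCommGroup α] [MeasureSpace α] [MeasurableAdd₂ α]
    [MeasurableNeg α] [(volume : Measure α).IsAddLeftInvariant]
    [(volume : Measure α).IsNegInvariant] (f : α → ℝ≥0∞) (a : α) : nl2 (fun x => f (a - x)) = nl2 f := by
  unfold nl2
  rw [lintegral_sub_left_eq_self (fun x => f x ^ 2) a]

lemma lintegral_lintegral_add_eq {α : Type*} [AddCommGroup α] [MeasureSpace α]
    [MeasurableAdd₂ α] [MeasurableNeg α] [SFinite (volume : Measure α)]
    [(volume : Measure α).IsAddLeftInvariant] {f : α → α → ℝ≥0∞}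
    (hf : Measurable (Function.uncurry f)) :
    ∫⁻ x, ∫⁻ y, f x y = ∫⁻ z, ∫⁻ x, f x (z - x) := by
  rw [lintegral_lintegral_swap (f := fun z x => f x (z - x))]
  · congr 1; ext x
    rw [← lintegral_add_left_eq_self (fun z => f x (z - x)) x]
    simp
  · have : Measurable fun p : α × α => (p.2, p.1 - p.2) := by fun_prop
    exact (hf.comp this).aemeasurable

/-- The frequency of the three waves in a bilinear interaction: output, first, second. -/
def pick {α : Type*} [Add α] (i : Fin 3) (x y : α) : α := ![x + y, x, y] i

lemma measurable_pick {α : Type*} [AddCommGroup α] [MeasurableSpace α] [MeasurableAdd₂ α]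
    (i : Fin 3) : Measurable fun p : α × α => pick i p.1 p.2 := by
  fin_cases i <;> simp [pick] <;> fun_prop

/-- A trilinear convolution estimate in which an `L²` weight sits on one of the three factors. -/
lemma trilinear_weight_le {α : Type*} [AddCommGroup α] [MeasureSpace α] [MeasurableAdd₂ α]
    [MeasurableNeg α] [SFinite (volume : Measure α)] [(volume : Measure α).IsAddLeftInvariant]
    [(volume : Measure α).IsNegInvariant] {A₀ A₁ A₂ w : α → ℝ≥0∞} (h₀ : Measurable A₀)
    (h₁ : Measurable A₁) (h₂ : Measurable A₂) (hw : Measurable w) (i : Fin 3) :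
    ∫⁻ x, ∫⁻ y, A₀ (x + y) * A₁ x * A₂ y * w (pick i x y) ≤ nl2 w * nl2 A₀ * nl2 A₁ * nl2 A₂ := by
  have key : ∀ {B₀ B₁ B₂ : α → ℝ≥0∞} {g : α → α → α}, Measurable B₀ → Measurable B₁ →
      Measurable B₂ → (∀ x, Measurable (g x)) → (∀ x, nl2 (fun y => B₂ (g x y)) = nl2 B₂) →
      ∫⁻ x, ∫⁻ y, w x * B₀ x * (B₁ y * B₂ (g x y)) ≤ nl2 w * nl2 B₀ * nl2 B₁ * nl2 B₂ := by
    intro B₀ B₁ B₂ g m₀ m₁ m₂ mg hg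
    calc ∫⁻ x, ∫⁻ y, w x * B₀ x * (B₁ y * B₂ (g x y))
        = ∫⁻ x, w x * B₀ x * ∫⁻ y, (B₁ y * B₂ (g x y)) := by
          congr 1; ext x
          exact lintegral_const_mul (w x * B₀ x) (m₁.mul (m₂.comp (mg x)))
      _ ≤ ∫⁻ x, w x * B₀ x * (nl2 B₁ * nl2 B₂) := by
          refine lintegral_mono fun x => ?_
          dsimp only
          rw [← hg x]
          gcongr
          exact lintegral_mul_le_nl2 m₁ (m₂.comp (mg x))
      _ = (∫⁻ x, w x * B₀ x) * (nl2 B₁ * nl2 B₂) := lintegral_mul_const _ (hw.mul m₀)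
      _ ≤ nl2 w * nl2 B₀ * (nl2 B₁ * nl2 B₂) := by
          gcongr; exact lintegral_mul_le_nl2 hw m₀
      _ = _ := by ring
  have hm : Measurable (Function.uncurry fun x y => A₀ (x + y) * A₁ x * A₂ y * w (pick i x y)) := by
    have := measurable_pick (α := α) i
    simp only [Function.uncurry_def]
    fun_prop
  fin_cases i
  · rw [lintegral_lintegral_add_eq hm]
    refine le_trans (le_of_eq ?_) (key (B₀ := A₀) (B₁ := A₁) (B₂ := A₂) (g := fun z x => z - x)
      h₀ h₁ h₂ (fun x => by fun_prop) (fun x => nl2_sub_left _ _))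
    refine lintegral_congr fun x => lintegral_congr fun y => ?_
    simp [pick]; ring
  · refine le_trans (le_of_eq ?_) (le_trans (key (B₀ := A₁) (B₁ := A₂) (B₂ := A₀)
      (g := fun z x => z + x) h₁ h₂ h₀ (fun x => by fun_prop) (fun x => nl2_add_left _ _))
      (le_of_eq ?_))
    · refine lintegral_congr fun x => lintegral_congr fun y => ?_
      simp [pick]; ring
    · ring
  · rw [lintegral_lintegral_swap hm.aemeasurable]
    refine le_trans (le_of_eq ?_) (le_trans (key (B₀ := A₂) (B₁ := A₁) (B₂ := A₀)
      (g := fun z x => z + x) h₂ h₁ h₀ (fun x => by fun_prop) (fun x => nl2_add_left _ _))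
      (le_of_eq ?_))
    · refine lintegral_congr fun x => lintegral_congr fun y => ?_
      simp [pick, add_comm y x]; ring
    · ring

/-- The length of a vector with first coordinate `x` and remaining part of length `b`. -/
def hyp (b x : ℝ) : ℝ := Real.sqrt (x ^ 2 + b ^ 2)

lemma div_hyp {b : ℝ} (hb : 0 < b) (x : ℝ) : x / hyp b x = Real.sin (Real.arctan (x / b)) := by
  have : hyp b x = b * Real.sqrt (1 + (x / b) ^ 2) := by
    rw [hyp, show x ^ 2 + b ^ 2 = b ^ 2 * (1 + (x / b) ^ 2) by field_simp; ring,
      Real.sqrt_mul (by positivity), Real.sqrt_sq hb.le]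
  rw [Real.sin_arctan, this, div_div]

/-- The difference of the first coordinates of two signed unit directions. -/
def dirDiff (e₁ e₂ b₁ b₂ x₁ x₂ : ℝ) : ℝ := e₁ * (x₁ / hyp b₁ x₁) - e₂ * (x₂ / hyp b₂ x₂)

lemma sign_mul_div_hyp {e b : ℝ} (he : e = 1 ∨ e = -1) (hb : 0 < b) (x : ℝ) :
    e * (x / hyp b x) = Real.sin (Real.arctan (e * x / b)) := by
  rw [div_hyp hb]
  rcases he with rfl | rfl
  · simp
  · rw [neg_one_mul, neg_one_mul, neg_div, Real.arctan_neg, Real.sin_neg]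

lemma dirDiff_pos_iff {e₁ e₂ b₁ b₂ : ℝ} (h₁ : e₁ = 1 ∨ e₁ = -1) (h₂ : e₂ = 1 ∨ e₂ = -1)
    (hb₁ : 0 < b₁) (hb₂ : 0 < b₂) (x₁ x₂ : ℝ) :
    0 < dirDiff e₁ e₂ b₁ b₂ x₁ x₂ ↔ e₂ * x₂ * b₁ < e₁ * x₁ * b₂ := by
  rw [dirDiff, sub_pos, sign_mul_div_hyp h₁ hb₁, sign_mul_div_hyp h₂ hb₂,
    ← div_lt_div_iff₀ hb₂ hb₁]
  exact Real.sin_arctan_strictMono.lt_iff_lt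

lemma dirDiff_swap (e₁ e₂ b₁ b₂ x₁ x₂ : ℝ) :
    dirDiff e₂ e₁ b₂ b₁ x₂ x₁ = -dirDiff e₁ e₂ b₁ b₂ x₁ x₂ := by
  simp [dirDiff]

lemma hasDerivAt_hyp {b : ℝ} (hb : 0 < b) (x : ℝ) : HasDerivAt (hyp b) (x / hyp b x) x := by
  have h : HasDerivAt (fun x : ℝ => x ^ 2 + b ^ 2) (2 * x) x := by
    simpa using (hasDerivAt_pow 2 x).add_const (b ^ 2)
  have := h.sqrt (by positivity)
  rw [mul_div_mul_left _ _ two_ne_zero] at this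
  exact this

/-- Change of variables for the phase of two interacting waves along a line. -/
lemma lintegral_phase_le {e₁ e₂ b₁ b₂ : ℝ} (h₁ : e₁ = 1 ∨ e₁ = -1) (h₂ : e₂ = 1 ∨ e₂ = -1)
    (hb₁ : 0 < b₁) (hb₂ : 0 < b₂) (x₀ c : ℝ) (g : ℝ → ℝ≥0∞) :
    ∫⁻ x, ENNReal.ofReal |dirDiff e₁ e₂ b₁ b₂ x (x₀ - x)| *
      g (e₁ * hyp b₁ x + e₂ * hyp b₂ (x₀ - x) + c) ≤ 2 * ∫⁻ x, g x := by
  set q : ℝ → ℝ := fun x => e₁ * hyp b₁ x + e₂ * hyp b₂ (x₀ - x) + c with hq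
  set q' : ℝ → ℝ := fun x => dirDiff e₁ e₂ b₁ b₂ x (x₀ - x) with hq'
  have hd : ∀ x, HasDerivAt q (q' x) x := by
    intro x
    have a := (hasDerivAt_hyp hb₁ x).const_mul e₁
    have b := ((hasDerivAt_hyp hb₂ (x₀ - x)).comp x ((hasDerivAt_id x).const_sub x₀)).const_mul e₂
    refine ((a.add b).add_const c).congr_deriv ?_
    simp only [q', dirDiff]; ring
  have hcont : Continuous q := continuous_iff_continuousAt.mpr fun x => (hd x).continuousAt
  have hderiv : ∀ x, deriv q x = q' x := fun x => (hd x).deriv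
  have hlin : ∀ m : ℝ, IsLinearMap ℝ fun x : ℝ => m * x := fun m =>
    ⟨fun x y => mul_add _ _ _, fun a x => by simp; ring⟩
  have hP : {x | 0 < q' x} = {x | e₂ * x₀ * b₁ < (e₁ * b₂ + e₂ * b₁) * x} := by
    ext x
    simp only [hq', Set.mem_ofPred_eq, dirDiff_pos_iff h₁ h₂ hb₁ hb₂]
    constructor <;> intro h <;> linarith
  have hN : {x | q' x < 0} = {x | (e₁ * b₂ + e₂ * b₁) * x < e₂ * x₀ * b₁} := by
    ext x
    have : q' x < 0 ↔ 0 < dirDiff e₂ e₁ b₂ b₁ (x₀ - x) x := by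
      rw [dirDiff_swap, neg_pos]
    rw [Set.mem_ofPred_eq, this, dirDiff_pos_iff h₂ h₁ hb₂ hb₁, Set.mem_ofPred_eq]
    constructor <;> intro h <;> linarith
  have hPm : MeasurableSet {x | 0 < q' x} := by
    rw [hP]; exact measurableSet_lt measurable_const (by fun_prop)
  have hNm : MeasurableSet {x | q' x < 0} := by
    rw [hN]; exact measurableSet_lt (by fun_prop) measurable_const
  have iP : Set.InjOn q {x | 0 < q' x} := by
    refine (strictMonoOn_of_deriv_pos ?_ hcont.continuousOn ?_).injOn
    · rw [hP]; exact convex_halfSpace_gt (hlin _) _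
    · intro x hx
      rw [hderiv]
      exact (interior_subset hx :)
  have iN : Set.InjOn q {x | q' x < 0} := by
    refine (strictAntiOn_of_deriv_neg ?_ hcont.continuousOn ?_).injOn
    · rw [hN]; exact convex_halfSpace_lt (hlin _) _
    · intro x hx
      rw [hderiv]
      exact (interior_subset hx :)
  have hsplit : ∫⁻ x, ENNReal.ofReal |q' x| * g (q x) ≤
      ∫⁻ x in {x | 0 < q' x} ∪ {x | q' x < 0}, ENNReal.ofReal |q' x| * g (q x) := by
    rw [← lintegral_indicator (hPm.union hNm)]
    refine lintegral_mono fun x => ?_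
    by_cases hx : q' x = 0
    · simp [hx]
    · rw [Set.indicator_of_mem]
      rcases lt_or_gt_of_ne hx with h | h
      · exact Or.inr h
      · exact Or.inl h
  calc _ ≤ _ := hsplit
    _ ≤ (∫⁻ x in {x | 0 < q' x}, ENNReal.ofReal |q' x| * g (q x)) +
        ∫⁻ x in {x | q' x < 0}, ENNReal.ofReal |q' x| * g (q x) := lintegral_union_le _ _ _
    _ = (∫⁻ x in q '' {x | 0 < q' x}, g x) + ∫⁻ x in q '' {x | q' x < 0}, g x := by
        rw [lintegral_image_eq_lintegral_abs_deriv_mul hPm (fun x _ => (hd x).hasDerivWithinAt) iP,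
          lintegral_image_eq_lintegral_abs_deriv_mul hNm (fun x _ => (hd x).hasDerivWithinAt) iN]
    _ ≤ (∫⁻ x, g x) + ∫⁻ x, g x := by
        gcongr <;> exact Measure.restrict_le_self
    _ = _ := (two_mul _).symm

@[fun_prop]
lemma measurable_hyp {α : Type*} [MeasurableSpace α] {f g : α → ℝ} (hf : Measurable f)
    (hg : Measurable g) : Measurable fun a => hyp (f a) (g a) := by
  unfold hyp; fun_prop

lemma measurable_dirDiff (e₁ e₂ : ℝ) {α : Type*} [MeasurableSpace α] {f g h k : α → ℝ}
    (hf : Measurable f) (hg : Measurable g) (hh : Measurable h) (hk : Measurable k) :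
    Measurable fun a => dirDiff e₁ e₂ (f a) (g a) (h a) (k a) := by
  unfold dirDiff; fun_prop

/-- The bilinear estimate for two free waves along one line of frequencies. -/
lemma free_line_le {e₁ e₂ b₁ b₂ : ℝ} (h₁ : e₁ = 1 ∨ e₁ = -1) (h₂ : e₂ = 1 ∨ e₂ = -1)
    (hb₁ : 0 < b₁) (hb₂ : 0 < b₂) (c : ℝ) {G : ℝ × ℝ → ℝ≥0∞} {f₁ f₂ : ℝ → ℝ≥0∞}
    (hG : Measurable G) (hf₁ : Measurable f₁) (hf₂ : Measurable f₂) :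
    ∫⁻ x₁, ∫⁻ x₂, G (e₁ * hyp b₁ x₁ + e₂ * hyp b₂ x₂ + c, x₁ + x₂) * f₁ x₁ * f₂ x₂ *
      ENNReal.ofReal |dirDiff e₁ e₂ b₁ b₂ x₁ x₂| ^ ((1 : ℝ) / 2) ≤
    2 * (nl2 (fun x => nl2 fun t => G (t, x)) * nl2 f₁ * nl2 f₂) := by
  have hD : Measurable fun p : ℝ × ℝ => dirDiff e₁ e₂ b₁ b₂ p.1 p.2 :=
    measurable_dirDiff _ _ (by fun_prop) (by fun_prop) (by fun_prop) (by fun_prop)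
  rw [lintegral_lintegral_add_eq (by simp only [Function.uncurry_def]; fun_prop)]
  have hD' : ∀ x₀, Measurable fun x : ℝ => dirDiff e₁ e₂ b₁ b₂ x (x₀ - x) := fun x₀ =>
    hD.comp (g := fun p : ℝ × ℝ => dirDiff e₁ e₂ b₁ b₂ p.1 p.2)
      (f := fun x : ℝ => (x, x₀ - x)) (by fun_prop)
  have step : ∀ x₀ : ℝ, ∫⁻ x, G (e₁ * hyp b₁ x + e₂ * hyp b₂ (x₀ - x) + c, x + (x₀ - x)) * f₁ x *
      f₂ (x₀ - x) * ENNReal.ofReal |dirDiff e₁ e₂ b₁ b₂ x (x₀ - x)| ^ ((1 : ℝ) / 2) ≤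
      2 * (nl2 (fun t => G (t, x₀)) * nl2 fun x => f₁ x * f₂ (x₀ - x)) := by
    intro x₀
    have hD₀ := hD' x₀
    calc _ = ∫⁻ x, (G (e₁ * hyp b₁ x + e₂ * hyp b₂ (x₀ - x) + c, x₀) *
          ENNReal.ofReal |dirDiff e₁ e₂ b₁ b₂ x (x₀ - x)| ^ ((1 : ℝ) / 2)) *
          (f₁ x * f₂ (x₀ - x)) := by
          refine lintegral_congr fun x => ?_
          rw [add_sub_cancel]; ring
      _ ≤ _ := lintegral_mul_le_nl2 (by fun_prop) (by fun_prop)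
      _ ≤ (2 * nl2 (fun t => G (t, x₀))) * nl2 fun x => f₁ x * f₂ (x₀ - x) := by
          gcongr
          rw [nl2, nl2]
          calc _ ≤ (2 * ∫⁻ t, G (t, x₀) ^ 2) ^ ((1 : ℝ) / 2) := by
                gcongr
                refine le_trans (le_of_eq ?_)
                  (lintegral_phase_le h₁ h₂ hb₁ hb₂ x₀ c fun t => G (t, x₀) ^ 2)
                refine lintegral_congr fun x => ?_
                rw [mul_pow, ← ENNReal.rpow_natCast (_ ^ ((1 : ℝ) / 2)), ← ENNReal.rpow_mul]
                norm_num [mul_comm]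
            _ ≤ _ := by
                rw [ENNReal.mul_rpow_of_nonneg _ _ (by norm_num)]
                gcongr
                calc (2 : ℝ≥0∞) ^ ((1 : ℝ) / 2) ≤ 2 ^ (1 : ℝ) :=
                      ENNReal.rpow_le_rpow_of_exponent_le (by norm_num) (by norm_num)
                  _ = 2 := ENNReal.rpow_one _
      _ = _ := by ring
  have hfin : nl2 (fun x₀ => nl2 fun x => f₁ x * f₂ (x₀ - x)) = nl2 f₁ * nl2 f₂ := by
    rw [← nl2_prod_symm (f := fun p : ℝ × ℝ => f₁ p.1 * f₂ (p.2 - p.1)) (by fun_prop),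
      nl2_prod (by fun_prop)]
    have : ∀ a, (nl2 fun b => f₁ a * f₂ (b - a)) = nl2 f₂ * f₁ a := by
      intro a
      rw [nl2_const_mul (by fun_prop), mul_comm]
      congr 1
      simpa [sub_eq_add_neg, add_comm] using nl2_add_left f₂ (-a)
    simp only [this]
    rw [nl2_const_mul hf₁, mul_comm]
  calc _ ≤ ∫⁻ x₀, 2 * (nl2 (fun t => G (t, x₀)) * nl2 fun x => f₁ x * f₂ (x₀ - x)) :=
        lintegral_mono step
    _ = 2 * ∫⁻ x₀, (nl2 (fun t => G (t, x₀)) * nl2 fun x => f₁ x * f₂ (x₀ - x)) :=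
        lintegral_const_mul' _ _ (by norm_num)
    _ ≤ 2 * (nl2 (fun x => nl2 fun t => G (t, x)) *
          nl2 fun x₀ => nl2 fun x => f₁ x * f₂ (x₀ - x)) := by
        gcongr
        refine lintegral_mul_le_nl2 (measurable_nl2 ?_) (measurable_nl2 ?_)
        · simp only [Function.uncurry_def]; fun_prop
        · simp only [Function.uncurry_def]; fun_prop
    _ = _ := by rw [hfin]; ring

/-- The plane of frequencies transversal to a coordinate direction. -/
abbrev Plane : Type := Fin 2 → ℝ

lemma lintegral_prod_pairs_swap {α β : Type*} [MeasureSpace α] [MeasureSpace β]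
    [SFinite (volume : Measure α)] [SFinite (volume : Measure β)] {H : α × β → α × β → ℝ≥0∞}
    (hH : Measurable (Function.uncurry H)) :
    ∫⁻ p, ∫⁻ q, H p q = ∫⁻ y₁, ∫⁻ y₂, ∫⁻ x₁, ∫⁻ x₂, H (x₁, y₁) (x₂, y₂) := by
  have m₁ : ∀ ξ, Measurable (H ξ) := fun ξ => hH.comp (by fun_prop : Measurable fun η => (ξ, η))
  calc ∫⁻ ξ, ∫⁻ η, H ξ η = ∫⁻ ξ, ∫⁻ y₂, ∫⁻ x₂, H ξ (x₂, y₂) := by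
        refine lintegral_congr fun ξ => ?_
        rw [Measure.volume_eq_prod, lintegral_prod_symm _ (m₁ ξ).aemeasurable]
    _ = ∫⁻ y₁, ∫⁻ x₁, ∫⁻ y₂, ∫⁻ x₂, H (x₁, y₁) (x₂, y₂) := by
        rw [Measure.volume_eq_prod, lintegral_prod_symm _]
        refine Measurable.aemeasurable ?_
        refine Measurable.lintegral_prod_right'
          (f := fun p : (α × β) × β => ∫⁻ x₂, H p.1 (x₂, p.2)) ?_
        refine Measurable.lintegral_prod_right'
          (f := fun p : ((α × β) × β) × α => H p.1.1 (p.2, p.1.2)) ?_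
        exact hH.comp (by fun_prop :
          Measurable fun p : ((α × β) × β) × α => (p.1.1, (p.2, p.1.2)))
    _ = _ := by
        refine lintegral_congr fun y₁ => ?_
        rw [lintegral_lintegral_swap]
        refine Measurable.aemeasurable ?_
        refine Measurable.lintegral_prod_right'
          (f := fun p : (α × β) × α => H (p.1.1, y₁) (p.2, p.1.2)) ?_
        exact hH.comp (by fun_prop :
          Measurable fun p : (α × β) × α => ((p.1.1, y₁), (p.2, p.1.2)))

/-- The bilinear estimate for two free waves with the square root of the null symbol. -/
lemma free_wave_le {e₁ e₂ : ℝ} (h₁ : e₁ = 1 ∨ e₁ = -1) (h₂ : e₂ = 1 ∨ e₂ = -1)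
    {b : Plane → ℝ} (hb : Measurable b) (hb₀ : ∀ᵐ y, 0 < b y) (c : ℝ)
    {G : ℝ × ℝ × Plane → ℝ≥0∞} {f₁ f₂ : ℝ × Plane → ℝ≥0∞} {w : Plane → ℝ≥0∞}
    (hG : Measurable G) (hf₁ : Measurable f₁) (hf₂ : Measurable f₂) (hw : Measurable w)
    (i : Fin 3) :
    ∫⁻ ξ, ∫⁻ η, G (e₁ * hyp (b ξ.2) ξ.1 + e₂ * hyp (b η.2) η.1 + c, ξ + η) * f₁ ξ * f₂ η *
      ENNReal.ofReal |dirDiff e₁ e₂ (b ξ.2) (b η.2) ξ.1 η.1| ^ ((1 : ℝ) / 2) *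
      w (pick i ξ.2 η.2) ≤
    2 * (nl2 w * nl2 G * nl2 f₁ * nl2 f₂) := by
  have hD : Measurable fun p : (ℝ × Plane) × ℝ × Plane =>
      dirDiff e₁ e₂ (b p.1.2) (b p.2.2) p.1.1 p.2.1 :=
    measurable_dirDiff _ _ (by fun_prop) (by fun_prop) (by fun_prop) (by fun_prop)
  have hp : Measurable fun p : (ℝ × Plane) × ℝ × Plane => pick i p.1.2 p.2.2 :=
    (measurable_pick (α := Plane) i).comp (by fun_prop :
      Measurable fun p : (ℝ × Plane) × ℝ × Plane => (p.1.2, p.2.2))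
  rw [lintegral_prod_pairs_swap (by simp only [Function.uncurry_def]; fun_prop)]
  set γ : Plane → ℝ≥0∞ := fun y => nl2 fun x => nl2 fun t => G (t, x, y) with hγ
  set A₁ : Plane → ℝ≥0∞ := fun y => nl2 fun x => f₁ (x, y)
  set A₂ : Plane → ℝ≥0∞ := fun y => nl2 fun x => f₂ (x, y)
  have mγ : Measurable γ := by
    refine measurable_nl2 (f := fun y x => nl2 fun t => G (t, x, y)) ?_
    refine measurable_nl2 (f := fun (p : Plane × ℝ) t => G (t, p.2, p.1)) ?_
    simp only [Function.uncurry_def]; fun_prop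
  have mA₁ : Measurable A₁ := by
    refine measurable_nl2 (f := fun y x => f₁ (x, y)) ?_
    simp only [Function.uncurry_def]; fun_prop
  have mA₂ : Measurable A₂ := by
    refine measurable_nl2 (f := fun y x => f₂ (x, y)) ?_
    simp only [Function.uncurry_def]; fun_prop
  have eγ : nl2 γ = nl2 G := by
    rw [nl2_prod_symm hG, nl2_prod_symm]
    refine measurable_nl2 (f := fun (ξ : ℝ × Plane) t => G (t, ξ)) ?_
    simp only [Function.uncurry_def]; fun_prop
  calc _ ≤ ∫⁻ y₁, ∫⁻ y₂, 2 * (γ (y₁ + y₂) * A₁ y₁ * A₂ y₂ * w (pick i y₁ y₂)) := by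
        refine lintegral_mono_ae ?_
        filter_upwards [hb₀] with y₁ p₁
        refine lintegral_mono_ae ?_
        filter_upwards [hb₀] with y₂ p₂
        simp only [Prod.mk_add_mk]
        have := free_line_le h₁ h₂ p₁ p₂ c (G := fun p => G (p.1, p.2, y₁ + y₂))
          (f₁ := fun x => f₁ (x, y₁)) (f₂ := fun x => f₂ (x, y₂))
          (by fun_prop) (by fun_prop) (by fun_prop)
        have hd : ∀ x₁, Measurable fun x₂ => dirDiff e₁ e₂ (b y₁) (b y₂) x₁ x₂ := fun x₁ =>
          measurable_dirDiff _ _ (by fun_prop) (by fun_prop) (by fun_prop) (by fun_prop)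
        have hd' : Measurable fun p : ℝ × ℝ => dirDiff e₁ e₂ (b y₁) (b y₂) p.1 p.2 :=
          measurable_dirDiff _ _ (by fun_prop) (by fun_prop) (by fun_prop) (by fun_prop)
        calc _ = (∫⁻ x₁, ∫⁻ x₂, G (e₁ * hyp (b y₁) x₁ + e₂ * hyp (b y₂) x₂ + c, x₁ + x₂, y₁ + y₂) *
              f₁ (x₁, y₁) * f₂ (x₂, y₂) *
              ENNReal.ofReal |dirDiff e₁ e₂ (b y₁) (b y₂) x₁ x₂| ^ ((1 : ℝ) / 2)) *
              w (pick i y₁ y₂) := by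
              rw [← lintegral_mul_const]
              · refine lintegral_congr fun x₁ => ?_
                have := hd x₁
                rw [← lintegral_mul_const _ (by fun_prop)]
              · refine Measurable.lintegral_prod_right' (f := fun p : ℝ × ℝ =>
                  G (e₁ * hyp (b y₁) p.1 + e₂ * hyp (b y₂) p.2 + c, p.1 + p.2, y₁ + y₂) *
                  f₁ (p.1, y₁) * f₂ (p.2, y₂) *
                  ENNReal.ofReal |dirDiff e₁ e₂ (b y₁) (b y₂) p.1 p.2| ^ ((1 : ℝ) / 2)) ?_
                fun_prop
          _ ≤ (2 * (γ (y₁ + y₂) * A₁ y₁ * A₂ y₂)) * w (pick i y₁ y₂) := by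
              gcongr
          _ = _ := by ring
    _ = 2 * ∫⁻ y₁, ∫⁻ y₂, (γ (y₁ + y₂) * A₁ y₁ * A₂ y₂ * w (pick i y₁ y₂)) := by
        rw [← lintegral_const_mul' _ _ (by norm_num)]
        refine lintegral_congr fun y₁ => ?_
        rw [lintegral_const_mul' _ _ (by norm_num)]
    _ ≤ 2 * (nl2 w * nl2 γ * nl2 A₁ * nl2 A₂) := by
        gcongr
        exact trilinear_weight_le mγ mA₁ mA₂ hw i
    _ = _ := by rw [eγ, ← nl2_prod_symm hf₁, ← nl2_prod_symm hf₂]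

lemma lintegral_pairs_swap {α β : Type*} [MeasureSpace α] [MeasureSpace β]
    [SFinite (volume : Measure α)] [SFinite (volume : Measure β)] {H : α → α → β → β → ℝ≥0∞}
    (hH : Measurable fun p : (α × α) × β × β => H p.1.1 p.1.2 p.2.1 p.2.2) :
    ∫⁻ a₁, ∫⁻ a₂, ∫⁻ b₁, ∫⁻ b₂, H a₁ a₂ b₁ b₂ = ∫⁻ b₁, ∫⁻ b₂, ∫⁻ a₁, ∫⁻ a₂, H a₁ a₂ b₁ b₂ := by
  have e₁ : ∀ a₁ a₂, ∫⁻ b₁, ∫⁻ b₂, H a₁ a₂ b₁ b₂ = ∫⁻ b : β × β, H a₁ a₂ b.1 b.2 := by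
    intro a₁ a₂
    rw [Measure.volume_eq_prod, lintegral_prod]
    exact (hH.comp (by fun_prop : Measurable fun b : β × β => ((a₁, a₂), b))).aemeasurable
  have e₂ : ∀ b₁ b₂, ∫⁻ a₁, ∫⁻ a₂, H a₁ a₂ b₁ b₂ = ∫⁻ a : α × α, H a.1 a.2 b₁ b₂ := by
    intro b₁ b₂
    rw [Measure.volume_eq_prod, lintegral_prod]
    exact (hH.comp (by fun_prop : Measurable fun a : α × α => (a, (b₁, b₂)))).aemeasurable
  simp_rw [e₁, e₂]
  have m₁ : Measurable fun a : α × α => ∫⁻ b : β × β, H a.1 a.2 b.1 b.2 :=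
    Measurable.lintegral_prod_right' hH
  have m₂ : Measurable fun b : β × β => ∫⁻ a : α × α, H a.1 a.2 b.1 b.2 :=
    Measurable.lintegral_prod_left' hH
  have := lintegral_lintegral_swap (μ := (volume : Measure (α × α)))
    (ν := (volume : Measure (β × β))) (f := fun a b => H a.1 a.2 b.1 b.2) hH.aemeasurable
  simp only [Measure.volume_eq_prod] at this m₁ m₂ ⊢
  rwa [lintegral_prod _ m₁.aemeasurable, lintegral_prod _ m₂.aemeasurable] at this

/-- Trilinear estimate with a time-frequency weight and a space-frequency weight. -/
lemma trilinear_split_weight_le {V : Type*} [AddCommGroup V] [MeasureSpace V] [MeasurableAdd₂ V]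
    [MeasurableNeg V] [SFinite (volume : Measure V)] [(volume : Measure V).IsAddLeftInvariant]
    [(volume : Measure V).IsNegInvariant] {F₀ F₁ F₂ : ℝ × V → ℝ≥0∞} {W : V → ℝ≥0∞} {β : ℝ → ℝ≥0∞}
    {h : V × V → ℝ} (hF₀ : Measurable F₀) (hF₁ : Measurable F₁) (hF₂ : Measurable F₂)
    (hW : Measurable W) (hβ : Measurable β) (hh : Measurable h) (i j : Fin 3) :
    ∫⁻ p, ∫⁻ q, F₀ (p + q) * F₁ p * F₂ q * β (pick j p.1 q.1 - h (p.2, q.2)) * W (pick i p.2 q.2) ≤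
      nl2 W * nl2 β * nl2 F₀ * nl2 F₁ * nl2 F₂ := by
  have hpi : Measurable fun p : (ℝ × V) × ℝ × V => pick i p.1.2 p.2.2 :=
    (measurable_pick (α := V) i).comp (by fun_prop :
      Measurable fun p : (ℝ × V) × ℝ × V => (p.1.2, p.2.2))
  have hpj : Measurable fun p : (ℝ × V) × ℝ × V => pick j p.1.1 p.2.1 :=
    (measurable_pick (α := ℝ) j).comp (by fun_prop :
      Measurable fun p : (ℝ × V) × ℝ × V => (p.1.1, p.2.1))
  rw [lintegral_prod_pairs_swap (by simp only [Function.uncurry_def]; fun_prop)]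
  set γ : V → ℝ≥0∞ := fun y => nl2 fun t => F₀ (t, y)
  set A₁ : V → ℝ≥0∞ := fun y => nl2 fun t => F₁ (t, y)
  set A₂ : V → ℝ≥0∞ := fun y => nl2 fun t => F₂ (t, y)
  have mγ : Measurable γ := by
    refine measurable_nl2 (f := fun y x => F₀ (x, y)) ?_
    simp only [Function.uncurry_def]; fun_prop
  have mA₁ : Measurable A₁ := by
    refine measurable_nl2 (f := fun y x => F₁ (x, y)) ?_
    simp only [Function.uncurry_def]; fun_prop
  have mA₂ : Measurable A₂ := by
    refine measurable_nl2 (f := fun y x => F₂ (x, y)) ?_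
    simp only [Function.uncurry_def]; fun_prop
  have hβs : ∀ a : ℝ, nl2 (fun t => β (t - a)) = nl2 β := fun a => by
    simpa [sub_eq_add_neg, add_comm] using nl2_add_left β (-a)
  have step : ∀ y₁ y₂, ∫⁻ x₁, ∫⁻ x₂, F₀ ((x₁, y₁) + (x₂, y₂)) * F₁ (x₁, y₁) * F₂ (x₂, y₂) *
      β (pick j x₁ x₂ - h (y₁, y₂)) * W (pick i y₁ y₂) ≤
      nl2 β * (γ (y₁ + y₂) * A₁ y₁ * A₂ y₂ * W (pick i y₁ y₂)) := by
    intro y₁ y₂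
    have hp := measurable_pick (α := ℝ) j
    have hp' : ∀ x₁, Measurable fun x₂ : ℝ => pick j x₁ x₂ := fun x₁ =>
      hp.comp (by fun_prop : Measurable fun x₂ : ℝ => (x₁, x₂))
    calc _ = (∫⁻ x₁, ∫⁻ x₂, F₀ (x₁ + x₂, y₁ + y₂) * F₁ (x₁, y₁) * F₂ (x₂, y₂) *
          β (pick j x₁ x₂ - h (y₁, y₂))) * W (pick i y₁ y₂) := by
          rw [← lintegral_mul_const]
          · refine lintegral_congr fun x₁ => ?_
            have := hp' x₁
            rw [← lintegral_mul_const _ (by fun_prop)]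
            rfl
          · refine Measurable.lintegral_prod_right' (f := fun p : ℝ × ℝ =>
              F₀ (p.1 + p.2, y₁ + y₂) * F₁ (p.1, y₁) * F₂ (p.2, y₂) *
              β (pick j p.1 p.2 - h (y₁, y₂))) ?_
            fun_prop
      _ ≤ (nl2 β * γ (y₁ + y₂) * A₁ y₁ * A₂ y₂) * W (pick i y₁ y₂) := by
          gcongr
          have := trilinear_weight_le (A₀ := fun t => F₀ (t, y₁ + y₂)) (A₁ := fun t => F₁ (t, y₁))
            (A₂ := fun t => F₂ (t, y₂)) (w := fun t => β (t - h (y₁, y₂))) (by fun_prop)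
            (by fun_prop) (by fun_prop) (by fun_prop) j
          rwa [hβs] at this
      _ = _ := by ring
  have hpi' := measurable_pick (α := V) i
  calc _ ≤ ∫⁻ y₁, ∫⁻ y₂, nl2 β * (γ (y₁ + y₂) * A₁ y₁ * A₂ y₂ * W (pick i y₁ y₂)) :=
        lintegral_mono fun y₁ => lintegral_mono fun y₂ => step y₁ y₂
    _ = nl2 β * ∫⁻ y₁, ∫⁻ y₂, (γ (y₁ + y₂) * A₁ y₁ * A₂ y₂ * W (pick i y₁ y₂)) := by
        rw [← lintegral_const_mul]
        · refine lintegral_congr fun y₁ => ?_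
          have : Measurable fun y₂ => pick i y₁ y₂ :=
            hpi'.comp (by fun_prop : Measurable fun y₂ : V => (y₁, y₂))
          rw [lintegral_const_mul _ (by fun_prop)]
        · refine Measurable.lintegral_prod_right' (f := fun p : V × V =>
              γ (p.1 + p.2) * A₁ p.1 * A₂ p.2 * W (pick i p.1 p.2)) ?_
          fun_prop
    _ ≤ nl2 β * (nl2 W * nl2 γ * nl2 A₁ * nl2 A₂) := by
        gcongr
        exact trilinear_weight_le mγ mA₁ mA₂ hW i
    _ = _ := by rw [← nl2_prod_symm hF₀, ← nl2_prod_symm hF₁, ← nl2_prod_symm hF₂]; ring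

lemma nl2_shear {V : Type*} [MeasureSpace V] [SFinite (volume : Measure V)] {F : ℝ × V → ℝ≥0∞}
    (hF : Measurable F) {g : V → ℝ} (hg : Measurable g) :
    nl2 (fun k => nl2 fun ξ => F (g ξ + k, ξ)) = nl2 F := by
  rw [← nl2_prod (f := fun p : ℝ × V => F (g p.2 + p.1, p.2)) (by fun_prop),
    nl2_prod_symm (by fun_prop), nl2_prod_symm hF]
  congr 1; ext ξ
  exact nl2_add_left (fun t => F (t, ξ)) (g ξ)

/-- The trilinear estimate with the null symbol and modulation weights on both inputs. -/
lemma trilinear_null_le {e₁ e₂ : ℝ} (h₁ : e₁ = 1 ∨ e₁ = -1) (h₂ : e₂ = 1 ∨ e₂ = -1)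
    {b : Plane → ℝ} (hb : Measurable b) (hb₀ : ∀ᵐ y, 0 < b y)
    {F₀ F₁ F₂ : ℝ × ℝ × Plane → ℝ≥0∞} {w : Plane → ℝ≥0∞} {β : ℝ → ℝ≥0∞}
    (hF₀ : Measurable F₀) (hF₁ : Measurable F₁) (hF₂ : Measurable F₂) (hw : Measurable w)
    (hβ : Measurable β) (i : Fin 3) :
    ∫⁻ p, ∫⁻ q, F₀ (p + q) * F₁ p * F₂ q *
      (ENNReal.ofReal |dirDiff e₁ e₂ (b p.2.2) (b q.2.2) p.2.1 q.2.1| ^ ((1 : ℝ) / 2) *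
      w (pick i p.2.2 q.2.2) * β (p.1 - e₁ * hyp (b p.2.2) p.2.1) *
      β (q.1 - e₂ * hyp (b q.2.2) q.2.1)) ≤
    2 * (nl2 w * nl2 β ^ 2 * nl2 F₀ * nl2 F₁ * nl2 F₂) := by
  have hD : ∀ {γ : Type} [MeasurableSpace γ] {f g : γ → ℝ × Plane}, Measurable f → Measurable g →
      Measurable fun p => dirDiff e₁ e₂ (b (f p).2) (b (g p).2) (f p).1 (g p).1 :=
    fun hf hg => measurable_dirDiff _ _ (by fun_prop) (by fun_prop) (by fun_prop) (by fun_prop)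
  have hP : ∀ {γ : Type} [MeasurableSpace γ] {f g : γ → ℝ × Plane}, Measurable f → Measurable g →
      Measurable fun p => pick i (f p).2 (g p).2 :=
    fun {γ} _ {f g} hf hg => (measurable_pick (α := Plane) i).comp (by fun_prop :
      Measurable fun p : γ => ((f p).2, (g p).2))
  have d₁ := hD (γ := (ℝ × ℝ × Plane) × (ℝ × ℝ × Plane)) (f := fun p => p.1.2) (g := fun p => p.2.2)
    (by fun_prop) (by fun_prop)
  have p₁ := hP (γ := (ℝ × ℝ × Plane) × (ℝ × ℝ × Plane)) (f := fun p => p.1.2) (g := fun p => p.2.2)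
    (by fun_prop) (by fun_prop)
  have d₂ := hD (γ := ((ℝ × Plane) × (ℝ × Plane)) × ℝ × ℝ) (f := fun p => p.1.1)
    (g := fun p => p.1.2) (by fun_prop) (by fun_prop)
  have p₂ := hP (γ := ((ℝ × Plane) × (ℝ × Plane)) × ℝ × ℝ) (f := fun p => p.1.1)
    (g := fun p => p.1.2) (by fun_prop) (by fun_prop)
  rw [lintegral_prod_pairs_swap (by simp only [Function.uncurry_def]; fun_prop)]
  obtain ⟨n, hn⟩ : ∃ n : ℝ × Plane → ℝ, n = fun ξ => hyp (b ξ.2) ξ.1 := ⟨_, rfl⟩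
  have mn : Measurable n := by rw [hn]; fun_prop
  obtain ⟨K, hK⟩ : ∃ K : ℝ × Plane → ℝ × Plane → ℝ≥0∞, K = fun ξ η =>
    ENNReal.ofReal |dirDiff e₁ e₂ (b ξ.2) (b η.2) ξ.1 η.1| ^ ((1 : ℝ) / 2) *
      w (pick i ξ.2 η.2) := ⟨_, rfl⟩
  have mK : Measurable fun p : ((ℝ × Plane) × (ℝ × Plane)) × ℝ × ℝ => K p.1.1 p.1.2 := by
    simp only [hK]; fun_prop
  have mK' : Measurable fun p : (ℝ × Plane) × (ℝ × Plane) => K p.1 p.2 :=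
    mK.comp (by fun_prop : Measurable fun p : (ℝ × Plane) × (ℝ × Plane) => (p, ((0 : ℝ), (0 : ℝ))))
  calc _ = ∫⁻ ξ, ∫⁻ η, ∫⁻ k₁, ∫⁻ k₂, F₀ (e₁ * n ξ + e₂ * n η + (k₁ + k₂), ξ + η) *
        F₁ (e₁ * n ξ + k₁, ξ) * F₂ (e₂ * n η + k₂, η) * K ξ η * (β k₁ * β k₂) := by
        refine lintegral_congr fun ξ => lintegral_congr fun η => ?_
        rw [← lintegral_add_left_eq_self _ (e₁ * n ξ)]
        refine lintegral_congr fun k₁ => ?_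
        rw [← lintegral_add_left_eq_self _ (e₂ * n η)]
        refine lintegral_congr fun k₂ => ?_
        simp only [Prod.mk_add_mk, hn, hK, add_sub_cancel_left]
        rw [show e₁ * hyp (b ξ.2) ξ.1 + k₁ + (e₂ * hyp (b η.2) η.1 + k₂) =
          e₁ * hyp (b ξ.2) ξ.1 + e₂ * hyp (b η.2) η.1 + (k₁ + k₂) by ring]
        ring
    _ = ∫⁻ k₁, ∫⁻ k₂, ∫⁻ ξ, ∫⁻ η, F₀ (e₁ * n ξ + e₂ * n η + (k₁ + k₂), ξ + η) *
        F₁ (e₁ * n ξ + k₁, ξ) * F₂ (e₂ * n η + k₂, η) * K ξ η * (β k₁ * β k₂) :=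
        lintegral_pairs_swap (by fun_prop)
    _ ≤ ∫⁻ k₁, ∫⁻ k₂, (2 * nl2 w * nl2 F₀) * ((β k₁ * nl2 fun ξ => F₁ (e₁ * n ξ + k₁, ξ)) *
          (β k₂ * nl2 fun ξ => F₂ (e₂ * n ξ + k₂, ξ))) := by
        refine lintegral_mono fun k₁ => lintegral_mono fun k₂ => ?_
        calc _ = (∫⁻ ξ, ∫⁻ η, F₀ (e₁ * n ξ + e₂ * n η + (k₁ + k₂), ξ + η) *
              F₁ (e₁ * n ξ + k₁, ξ) * F₂ (e₂ * n η + k₂, η) * K ξ η) * (β k₁ * β k₂) := by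
              rw [← lintegral_mul_const]
              · refine lintegral_congr fun ξ => ?_
                have : Measurable fun η => K ξ η :=
                  mK'.comp (by fun_prop : Measurable fun η : ℝ × Plane => (ξ, η))
                rw [← lintegral_mul_const _ (by fun_prop)]
              · refine Measurable.lintegral_prod_right' (f := fun p : (ℝ × Plane) × (ℝ × Plane) =>
                  F₀ (e₁ * n p.1 + e₂ * n p.2 + (k₁ + k₂), p.1 + p.2) *
                  F₁ (e₁ * n p.1 + k₁, p.1) * F₂ (e₂ * n p.2 + k₂, p.2) * K p.1 p.2) ?_
                fun_prop
          _ ≤ (2 * (nl2 w * nl2 F₀ * (nl2 fun ξ => F₁ (e₁ * n ξ + k₁, ξ)) *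
              nl2 fun ξ => F₂ (e₂ * n ξ + k₂, ξ))) * (β k₁ * β k₂) := by
              gcongr
              refine le_trans (le_of_eq ?_) (free_wave_le h₁ h₂ hb hb₀ (k₁ + k₂) (G := F₀)
                (f₁ := fun ξ => F₁ (e₁ * n ξ + k₁, ξ)) (f₂ := fun ξ => F₂ (e₂ * n ξ + k₂, ξ))
                hF₀ (by fun_prop) (by fun_prop) hw i)
              refine lintegral_congr fun ξ => lintegral_congr fun η => ?_
              simp only [hK, hn]; ring
          _ = _ := by ring
    _ = (2 * nl2 w * nl2 F₀) * ((∫⁻ k₁, β k₁ * nl2 fun ξ => F₁ (e₁ * n ξ + k₁, ξ)) *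
          ∫⁻ k₂, (β k₂ * nl2 fun ξ => F₂ (e₂ * n ξ + k₂, ξ))) := by
        have m₁ : Measurable fun k₁ => nl2 fun ξ => F₁ (e₁ * n ξ + k₁, ξ) :=
          measurable_nl2 (by simp only [Function.uncurry_def]; fun_prop)
        have m₂ : Measurable fun k₁ => nl2 fun ξ => F₂ (e₂ * n ξ + k₁, ξ) :=
          measurable_nl2 (by simp only [Function.uncurry_def]; fun_prop)
        rw [← lintegral_mul_const _ (by fun_prop), ← lintegral_const_mul _ (by fun_prop)]
        refine lintegral_congr fun k₁ => ?_
        rw [lintegral_const_mul _ (by fun_prop), lintegral_const_mul _ (by fun_prop)]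
    _ ≤ (2 * nl2 w * nl2 F₀) * ((nl2 β * nl2 F₁) * (nl2 β * nl2 F₂)) := by
        rw [← nl2_shear hF₁ (g := fun ξ => e₁ * n ξ) (by fun_prop),
          ← nl2_shear hF₂ (g := fun ξ => e₂ * n ξ) (by fun_prop)]
        gcongr
        · refine lintegral_mul_le_nl2 hβ (measurable_nl2 ?_)
          simp only [Function.uncurry_def]; fun_prop
        · refine lintegral_mul_le_nl2 hβ (measurable_nl2 ?_)
          simp only [Function.uncurry_def]; fun_prop
    _ = _ := by ring

lemma rpow_neg_le_of_comparable {X Y B : ℝ} (hX : 0 < X) (hY : 0 < Y) (h₁ : X ≤ 2 * Y)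
    (h₂ : Y ≤ 2 * X) : Y ^ (-B) ≤ 2 ^ |B| * X ^ (-B) := by
  rcases le_total 0 B with hB | hB
  · rw [abs_of_nonneg hB]
    calc Y ^ (-B) ≤ (X / 2) ^ (-B) :=
          Real.rpow_le_rpow_of_nonpos (by positivity) (by linarith) (by linarith)
      _ = _ := by
          rw [Real.div_rpow hX.le (by norm_num), Real.rpow_neg (by norm_num : (0 : ℝ) ≤ 2)]
          field_simp
  · rw [abs_of_nonpos hB, ← Real.mul_rpow (by norm_num) hX.le]
    exact Real.rpow_le_rpow hY.le h₂ (by linarith)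

lemma monomial_le_of_min {X Y Z A B C : ℝ} (hX : 0 < X) (hY : 0 < Y) (hZ : 0 < Z)
    (h₁ : X ≤ Y + Z) (h₂ : Y ≤ X + Z) (hZX : Z ≤ X) (hZY : Z ≤ Y) (hAB : 0 ≤ A + B) :
    X ^ (-A) * Y ^ (-B) * Z ^ (-C) ≤ 2 ^ |B| * Z ^ (-(A + B + C)) := by
  calc X ^ (-A) * Y ^ (-B) * Z ^ (-C)
      ≤ X ^ (-A) * (2 ^ |B| * X ^ (-B)) * Z ^ (-C) := by
        gcongr
        exact rpow_neg_le_of_comparable hX hY (by linarith) (by linarith)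
    _ = 2 ^ |B| * X ^ (-(A + B)) * Z ^ (-C) := by
        rw [neg_add, Real.rpow_add hX]; ring
    _ ≤ 2 ^ |B| * Z ^ (-(A + B)) * Z ^ (-C) := by
        gcongr 2 ^ |B| * ?_ * Z ^ (-C)
        exact Real.rpow_le_rpow_of_nonpos hZ hZX (neg_nonpos.mpr hAB)
    _ = _ := by rw [mul_assoc, ← Real.rpow_add hZ]; congr 2; ring

/-- A monomial in the sides of a triangle is controlled by pure powers. -/
lemma monomial_le {X Y Z A B C n : ℝ} (hX : 0 < X) (hY : 0 < Y) (hZ : 0 < Z)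
    (h₁ : X ≤ Y + Z) (h₂ : Y ≤ X + Z) (h₃ : Z ≤ X + Y) (hAB : 0 ≤ A + B) (hAC : 0 ≤ A + C)
    (hBC : 0 ≤ B + C) (hn : n = A + B + C) :
    X ^ (-A) * Y ^ (-B) * Z ^ (-C) ≤
      2 ^ (|B| + |C|) * (X ^ (-n) + Y ^ (-n) + Z ^ (-n)) := by
  have hB : (2 : ℝ) ^ |B| ≤ 2 ^ (|B| + |C|) :=
    Real.rpow_le_rpow_of_exponent_le (by norm_num) (by linarith [abs_nonneg C])
  have hC : (2 : ℝ) ^ |C| ≤ 2 ^ (|B| + |C|) :=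
    Real.rpow_le_rpow_of_exponent_le (by norm_num) (by linarith [abs_nonneg B])
  have pX : 0 ≤ X ^ (-n) := by positivity
  have pY : 0 ≤ Y ^ (-n) := by positivity
  have pZ : 0 ≤ Z ^ (-n) := by positivity
  by_cases c₁ : Z ≤ X ∧ Z ≤ Y
  · refine (monomial_le_of_min hX hY hZ h₁ h₂ c₁.1 c₁.2 hAB).trans ?_
    rw [← hn]
    exact mul_le_mul hB (by linarith) pZ (by positivity)
  by_cases c₂ : Y ≤ X
  · have c₃ : Y ≤ Z := by
      by_contra h
      exact c₁ ⟨by linarith, by linarith⟩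
    have := monomial_le_of_min (A := A) (B := C) (C := B) hX hZ hY (by linarith) (by linarith)
      c₂ c₃ hAC
    rw [show A + C + B = n by linarith] at this
    calc _ = X ^ (-A) * Z ^ (-C) * Y ^ (-B) := by ring
      _ ≤ _ := this
      _ ≤ _ := mul_le_mul hC (by linarith) pY (by positivity)
  · have c₃ : X ≤ Z := by
      by_contra h
      exact c₁ ⟨by linarith, by linarith⟩
    have := monomial_le_of_min (A := B) (B := C) (C := A) hY hZ hX (by linarith) (by linarith)
      (by linarith) c₃ hBC
    rw [show B + C + A = n by linarith] at this
    calc _ = Y ^ (-B) * Z ^ (-C) * X ^ (-A) := by ring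
      _ ≤ _ := this
      _ ≤ _ := mul_le_mul hC (by linarith) pX (by positivity)

lemma add_rpow_le_two_mul {X Y θ : ℝ} (hX : 0 < X) (hY : 0 < Y) (h₀ : 0 ≤ θ) (h₁ : θ ≤ 1) :
    (X + Y) ^ θ ≤ 2 * (X ^ θ + Y ^ θ) := by
  have h2 : (2 : ℝ) ^ θ ≤ 2 := by
    simpa using Real.rpow_le_rpow_of_exponent_le (by norm_num : (1 : ℝ) ≤ 2) h₁
  have pX : 0 ≤ X ^ θ := by positivity
  have pY : 0 ≤ Y ^ θ := by positivity
  rcases le_total X Y with h | h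
  · calc (X + Y) ^ θ ≤ (2 * Y) ^ θ := Real.rpow_le_rpow (by positivity) (by linarith) h₀
      _ = 2 ^ θ * Y ^ θ := Real.mul_rpow (by norm_num) hY.le
      _ ≤ _ := mul_le_mul h2 (by linarith) pY (by norm_num)
  · calc (X + Y) ^ θ ≤ (2 * X) ^ θ := Real.rpow_le_rpow (by positivity) (by linarith) h₀
      _ = 2 ^ θ * X ^ θ := Real.mul_rpow (by norm_num) hX.le
      _ ≤ _ := mul_le_mul h2 (by linarith) pX (by norm_num)

lemma sobolev_weight_le {s a X Y Z : ℝ} (hX : 1 ≤ X) (hY : 1 ≤ Y) (hZ : 1 ≤ Z)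
    (h₃ : Z ≤ X + Y) (has : 1 - s ≤ a) :
    Z ^ (s - 1) * (X ^ (s - 1) * Y ^ (s - 1))⁻¹ ≤
      2 ^ (s - 1 + a) * (Z ^ (-a) * X ^ a * Y ^ a) := by
  have pX : 0 < X := by linarith
  have pY : 0 < Y := by linarith
  have pZ : 0 < Z := by linarith
  have hM : 1 ≤ 2 * X * Y / Z := by
    rw [le_div_iff₀ pZ]
    nlinarith [mul_nonneg (sub_nonneg.mpr hX) (sub_nonneg.mpr hY)]
  have key := Real.rpow_le_rpow_of_exponent_le hM has
  have e : ∀ t : ℝ, (2 * X * Y / Z) ^ t = 2 ^ t * (Z ^ (-t) * X ^ t * Y ^ t) := by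
    intro t
    rw [Real.div_rpow (by positivity) pZ.le, Real.mul_rpow (by positivity) pY.le,
      Real.mul_rpow (by norm_num) pX.le, Real.rpow_neg pZ.le]
    field_simp
  rw [e, e] at key
  have h2 : (0 : ℝ) < 2 ^ (s - 1) := by positivity
  have := mul_le_mul_of_nonneg_left key h2.le
  calc _ = 2 ^ (s - 1 + (1 - s)) * (Z ^ (-(1 - s)) * X ^ (1 - s) * Y ^ (1 - s)) := by
        rw [show s - 1 + (1 - s) = 0 by ring, Real.rpow_zero, neg_sub, one_mul, mul_inv,
          ← Real.rpow_neg pX.le, ← Real.rpow_neg pY.le, neg_sub]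
        ring
    _ = 2 ^ (s - 1) * (2 ^ (1 - s) * (Z ^ (-(1 - s)) * X ^ (1 - s) * Y ^ (1 - s))) := by
        rw [Real.rpow_add (by norm_num)]; ring
    _ ≤ _ := this
    _ = _ := by rw [Real.rpow_add (by norm_num)]; ring

lemma null_symbol_le {θ r ρ S X Y P : ℝ} (hθ : 0 < θ) (hθ' : θ ≤ 1 / 4) (hr : 0 ≤ r) (hrX : r ≤ X)
    (hρ : 0 ≤ ρ) (hρY : ρ ≤ Y) (hX : 0 < X) (hY : 0 < Y) (hP : 0 < P) (hS : 0 ≤ S) (hS6 : S ≤ 6)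
    (h : r * ρ * S ^ 2 ≤ 18 * (X + Y) * P) :
    r * ρ * S ≤ 108 * ((X * Y) ^ (1 - θ) * (X + Y) ^ θ * P ^ θ * S ^ ((1 : ℝ) / 2)) := by
  have hrρ : 0 ≤ r * ρ := mul_nonneg hr hρ
  have split : r * ρ * S = (r * ρ * S ^ 2) ^ θ * (r * ρ) ^ (1 - θ) * S ^ (1 - 2 * θ) := by
    rw [Real.mul_rpow hrρ (by positivity), ← Real.rpow_natCast_mul hS]
    calc r * ρ * S = (r * ρ) ^ (θ + (1 - θ)) * S ^ ((2 : ℕ) * θ + (1 - 2 * θ)) := by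
          norm_num
      _ = _ := by
          rw [Real.rpow_add_of_nonneg hrρ hθ.le (by linarith),
            Real.rpow_add_of_nonneg hS (by positivity) (by linarith)]
          ring
  have b₁ : (r * ρ * S ^ 2) ^ θ ≤ 18 * ((X + Y) ^ θ * P ^ θ) := by
    calc _ ≤ (18 * (X + Y) * P) ^ θ := Real.rpow_le_rpow (by positivity) h hθ.le
      _ = 18 ^ θ * ((X + Y) ^ θ * P ^ θ) := by
          rw [Real.mul_rpow (by positivity) hP.le, Real.mul_rpow (by norm_num) (by positivity)]
          ring
      _ ≤ _ := by
          gcongr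
          simpa using Real.rpow_le_rpow_of_exponent_le (by norm_num : (1 : ℝ) ≤ 18)
            (by linarith : θ ≤ 1)
  have b₂ : (r * ρ) ^ (1 - θ) ≤ (X * Y) ^ (1 - θ) :=
    Real.rpow_le_rpow hrρ (by gcongr) (by linarith)
  have b₃ : S ^ (1 - 2 * θ) ≤ 6 * S ^ ((1 : ℝ) / 2) := by
    rw [show 1 - 2 * θ = (1 / 2 - 2 * θ) + 1 / 2 by ring,
      Real.rpow_add_of_nonneg hS (by linarith) (by norm_num)]
    gcongr
    calc S ^ (1 / 2 - 2 * θ) ≤ 6 ^ (1 / 2 - 2 * θ) := Real.rpow_le_rpow hS hS6 (by linarith)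
      _ ≤ 6 ^ (1 : ℝ) := Real.rpow_le_rpow_of_exponent_le (by norm_num) (by linarith)
      _ = 6 := Real.rpow_one 6
  calc r * ρ * S = _ := split
    _ ≤ (18 * ((X + Y) ^ θ * P ^ θ)) * (X * Y) ^ (1 - θ) * (6 * S ^ ((1 : ℝ) / 2)) := by
        gcongr
    _ = _ := by ring

lemma exists_exp {x : ℝ} (hx : 1 ≤ x) : ∃ t, 0 ≤ t ∧ x = Real.exp t :=
  ⟨Real.log x, Real.log_nonneg hx, (Real.exp_log (by linarith)).symm⟩

set_option maxHeartbeats 1000000 in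
/-- The pointwise bound of the trilinear kernel by elementary building blocks. -/
lemma kernel_le {s a ε : ℝ} (ha : 0 ≤ a) (has : 1 - s ≤ a) (hε : 0 < ε) (haε : a + 2 * ε ≤ 1 / 4)
    (hε' : 2 * ε < 1 / 4) :
    ∃ C > 0, ∀ X Y Z H₀ H₁ H₂ r ρ S σ : ℝ, 1 ≤ X → 1 ≤ Y → 1 ≤ Z → 1 ≤ H₀ → 1 ≤ H₁ → 1 ≤ H₂ →
      X ≤ Y + Z → Y ≤ X + Z → Z ≤ X + Y → 0 ≤ r → r ≤ X → 0 ≤ ρ → ρ ≤ Y → 0 ≤ S → S ≤ 6 →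
      r * ρ * S ^ 2 ≤ 18 * (X + Y) * (H₀ * H₁ * H₂) →
      σ ≤ r * ρ * S * (X ^ (-2 : ℝ) * Y ^ (-1 : ℝ)) + H₁ ^ (3 / 4 : ℝ) * X ^ (-(7 / 4) : ℝ) +
        H₂ ^ (3 / 4 : ℝ) * (X ^ (-1 : ℝ) * Y ^ (-(3 / 4) : ℝ)) →
      Z ^ (s - 1) * (X ^ (s - 1) * Y ^ (s - 1))⁻¹ *
        (H₀ ^ (-(1 / 4 - 2 * ε)) * H₁ ^ (-(3 / 4 + ε)) * H₂ ^ (-(3 / 4 + ε))) * σ ≤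
      C * ((X ^ (-(5 / 4 - 2 * ε - a)) + Y ^ (-(5 / 4 - 2 * ε - a)) + Z ^ (-(5 / 4 - 2 * ε - a))) *
        (S ^ ((1 : ℝ) / 2) * (H₁ ^ (-(1 / 2 + 3 * ε)) * H₂ ^ (-(1 / 2 + 3 * ε)))) +
        (X ^ (-(7 / 4 - a)) + Y ^ (-(7 / 4 - a)) + Z ^ (-(7 / 4 - a))) *
          (H₁ ^ (-(1 / 2 + 3 * ε)) + H₂ ^ (-(1 / 2 + 3 * ε)))) := by
  set θ : ℝ := 1 / 4 - 2 * ε with hθ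
  set K : ℝ := 2 ^ (2 : ℝ) with hK
  have hK0 : 0 < K := by positivity
  refine ⟨2 ^ (s - 1 + a) * (432 * K), by positivity, ?_⟩
  intro X Y Z H₀ H₁ H₂ r ρ S σ hX hY hZ hH₀ hH₁ hH₂ tX tY tZ hr hrX hρ hρY hS hS6 hn hσ
  have pX : 0 < X := by linarith
  have pY : 0 < Y := by linarith
  have pZ : 0 < Z := by linarith
  have pH₀ : 0 < H₀ := by linarith
  have pH₁ : 0 < H₁ := by linarith
  have pH₂ : 0 < H₂ := by linarith
  set Tp := X ^ (-(5 / 4 - 2 * ε - a)) + Y ^ (-(5 / 4 - 2 * ε - a)) + Z ^ (-(5 / 4 - 2 * ε - a))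
    with hTp
  set Tm := X ^ (-(7 / 4 - a)) + Y ^ (-(7 / 4 - a)) + Z ^ (-(7 / 4 - a)) with hTm
  have pTp : 0 < Tp := by positivity
  have pTm : 0 < Tm := by positivity
  set b : ℝ := 3 / 4 + ε with hb
  set b' : ℝ := 1 / 2 + 3 * ε with hb'
  have hbθ : b - θ = b' := by rw [hb, hb', hθ]; ring
  have mono : ∀ {A B C n : ℝ}, 0 ≤ A + B → 0 ≤ A + C → 0 ≤ B + C → |B| + |C| ≤ 2 →
      n = A + B + C → X ^ (-A) * Y ^ (-B) * Z ^ (-C) ≤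
        K * (X ^ (-n) + Y ^ (-n) + Z ^ (-n)) := by
    intro A B C n h₁ h₂ h₃ h₄ h₅
    refine (monomial_le pX pY pZ tX tY tZ h₁ h₂ h₃ h₅).trans ?_
    gcongr
    exact Real.rpow_le_rpow_of_exponent_le (by norm_num) h₄
  have abs_a : |a| = a := abs_of_nonneg ha
  have abs_na : |-a| = a := by rw [abs_neg, abs_a]
  have m₁ := mono (A := 1 - a) (B := θ - a) (C := a) (n := 5 / 4 - 2 * ε - a)
    (by linarith) (by linarith) (by linarith)
    (by rw [abs_a, abs_of_nonneg (by linarith)]; linarith) (by linarith)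
  have m₂ := mono (A := 1 + θ - a) (B := -a) (C := a) (n := 5 / 4 - 2 * ε - a)
    (by linarith) (by linarith) (by linarith) (by rw [abs_a, abs_na]; linarith) (by linarith)
  have m₃ := mono (A := 7 / 4 - a) (B := -a) (C := a) (n := 7 / 4 - a)
    (by linarith) (by linarith) (by linarith) (by rw [abs_a, abs_na]; linarith) (by linarith)
  have m₄ := mono (A := 1 - a) (B := 3 / 4 - a) (C := a) (n := 7 / 4 - a)
    (by linarith) (by linarith) (by linarith)
    (by rw [abs_a, abs_of_nonneg (by linarith)]; linarith) (by linarith)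
  set W := Z ^ (-a) * X ^ a * Y ^ a with hW
  set M := H₀ ^ (-θ) * H₁ ^ (-b) * H₂ ^ (-b) with hM
  have pW : 0 < W := by positivity
  have pM : 0 < M := by positivity
  have pS : 0 ≤ S ^ ((1 : ℝ) / 2) := by positivity
  have le_one : ∀ {x t : ℝ}, 1 ≤ x → t ≤ 0 → x ^ t ≤ 1 := fun hx ht =>
    Real.rpow_le_one_of_one_le_of_nonpos hx ht
  have t₁ : W * M * (r * ρ * S * (X ^ (-2 : ℝ) * Y ^ (-1 : ℝ))) ≤
      432 * K * (Tp * (S ^ ((1 : ℝ) / 2) * (H₁ ^ (-b') * H₂ ^ (-b')))) := by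
    have q := null_symbol_le (θ := θ) (by linarith) (by linarith) hr hrX hρ hρY pX pY
      (by positivity : 0 < H₀ * H₁ * H₂) hS hS6 hn
    calc W * M * (r * ρ * S * (X ^ (-2 : ℝ) * Y ^ (-1 : ℝ)))
        ≤ W * M * (108 * ((X * Y) ^ (1 - θ) * (2 * (X ^ θ + Y ^ θ)) * (H₀ * H₁ * H₂) ^ θ *
          S ^ ((1 : ℝ) / 2)) * (X ^ (-2 : ℝ) * Y ^ (-1 : ℝ))) := by
          refine mul_le_mul_of_nonneg_left (mul_le_mul_of_nonneg_right (q.trans ?_)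
            (by positivity)) (by positivity)
          gcongr
          exact add_rpow_le_two_mul pX pY (by linarith) (by linarith)
      _ = 216 * ((X ^ (-(1 - a)) * Y ^ (-(θ - a)) * Z ^ (-a) +
            X ^ (-(1 + θ - a)) * Y ^ (-(-a)) * Z ^ (-a)) *
            (S ^ ((1 : ℝ) / 2) * (H₁ ^ (-b') * H₂ ^ (-b')))) := by
          have key : W * M * ((X * Y) ^ (1 - θ) * (X ^ θ + Y ^ θ) * (H₀ * H₁ * H₂) ^ θ *
              (X ^ (-2 : ℝ) * Y ^ (-1 : ℝ))) = (X ^ (-(1 - a)) * Y ^ (-(θ - a)) * Z ^ (-a) +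
              X ^ (-(1 + θ - a)) * Y ^ (-(-a)) * Z ^ (-a)) * (H₁ ^ (-b') * H₂ ^ (-b')) := by
            rw [hW, hM, ← hbθ]
            obtain ⟨x, -, rfl⟩ := exists_exp hX
            obtain ⟨y, -, rfl⟩ := exists_exp hY
            obtain ⟨z, -, rfl⟩ := exists_exp hZ
            obtain ⟨h₀, -, rfl⟩ := exists_exp hH₀
            obtain ⟨h₁, -, rfl⟩ := exists_exp hH₁
            obtain ⟨h₂, -, rfl⟩ := exists_exp hH₂
            simp only [← Real.exp_mul, ← Real.exp_add, mul_add, add_mul]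
            congr 1 <;> congr 1 <;> ring
          linear_combination (216 * S ^ ((1 : ℝ) / 2)) * key
      _ ≤ 216 * ((K * Tp + K * Tp) * (S ^ ((1 : ℝ) / 2) * (H₁ ^ (-b') * H₂ ^ (-b')))) := by
          gcongr
      _ = _ := by ring
  have t₂ : W * M * (H₁ ^ (3 / 4 : ℝ) * X ^ (-(7 / 4) : ℝ)) ≤ K * (Tm * H₂ ^ (-b')) := by
    have e : W * M * (H₁ ^ (3 / 4 : ℝ) * X ^ (-(7 / 4) : ℝ)) =
        (X ^ (-(7 / 4 - a)) * Y ^ (-(-a)) * Z ^ (-a)) * H₂ ^ (-b') *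
          (H₀ ^ (-θ) * H₁ ^ (-ε) * H₂ ^ (-θ)) := by
      rw [hW, hM, show -b' = -b + θ by rw [← hbθ]; ring, hb]
      obtain ⟨x, -, rfl⟩ := exists_exp hX
      obtain ⟨y, -, rfl⟩ := exists_exp hY
      obtain ⟨z, -, rfl⟩ := exists_exp hZ
      obtain ⟨h₀, -, rfl⟩ := exists_exp hH₀
      obtain ⟨h₁, -, rfl⟩ := exists_exp hH₁
      obtain ⟨h₂, -, rfl⟩ := exists_exp hH₂
      simp only [← Real.exp_mul, ← Real.exp_add]
      congr 1; ring
    rw [e]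
    refine (mul_le_of_le_one_right (by positivity) ?_).trans
      ((mul_le_mul_of_nonneg_right m₃ (by positivity)).trans_eq (mul_assoc _ _ _))
    exact mul_le_one₀ (mul_le_one₀ (le_one hH₀ (by linarith)) (by positivity)
      (le_one hH₁ (by linarith))) (by positivity) (le_one hH₂ (by linarith))
  have t₃ : W * M * (H₂ ^ (3 / 4 : ℝ) * (X ^ (-1 : ℝ) * Y ^ (-(3 / 4) : ℝ))) ≤
      K * (Tm * H₁ ^ (-b')) := by
    have e : W * M * (H₂ ^ (3 / 4 : ℝ) * (X ^ (-1 : ℝ) * Y ^ (-(3 / 4) : ℝ))) =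
        (X ^ (-(1 - a)) * Y ^ (-(3 / 4 - a)) * Z ^ (-a)) * H₁ ^ (-b') *
          (H₀ ^ (-θ) * H₂ ^ (-ε) * H₁ ^ (-θ)) := by
      rw [hW, hM, show -b' = -b + θ by rw [← hbθ]; ring, hb]
      obtain ⟨x, -, rfl⟩ := exists_exp hX
      obtain ⟨y, -, rfl⟩ := exists_exp hY
      obtain ⟨z, -, rfl⟩ := exists_exp hZ
      obtain ⟨h₀, -, rfl⟩ := exists_exp hH₀
      obtain ⟨h₁, -, rfl⟩ := exists_exp hH₁
      obtain ⟨h₂, -, rfl⟩ := exists_exp hH₂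
      simp only [← Real.exp_mul, ← Real.exp_add]
      congr 1; ring
    rw [e]
    refine (mul_le_of_le_one_right (by positivity) ?_).trans
      ((mul_le_mul_of_nonneg_right m₄ (by positivity)).trans_eq (mul_assoc _ _ _))
    exact mul_le_one₀ (mul_le_one₀ (le_one hH₀ (by linarith)) (by positivity)
      (le_one hH₂ (by linarith))) (by positivity) (le_one hH₁ (by linarith))
  have p₁ : 0 ≤ K * (Tm * H₂ ^ (-b')) := by positivity
  have p₂ : 0 ≤ K * (Tm * H₁ ^ (-b')) := by positivity
  have pσ : 0 ≤ r * ρ * S * (X ^ (-2 : ℝ) * Y ^ (-1 : ℝ)) + H₁ ^ (3 / 4 : ℝ) * X ^ (-(7 / 4) : ℝ) +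
        H₂ ^ (3 / 4 : ℝ) * (X ^ (-1 : ℝ) * Y ^ (-(3 / 4) : ℝ)) := by positivity
  refine (mul_le_mul_of_nonneg_left hσ (by positivity)).trans ?_
  refine (mul_le_mul_of_nonneg_right (mul_le_mul_of_nonneg_right
    (sobolev_weight_le hX hY hZ tZ has) pM.le) pσ).trans ?_
  calc 2 ^ (s - 1 + a) * W * M * (r * ρ * S * (X ^ (-2 : ℝ) * Y ^ (-1 : ℝ)) +
        H₁ ^ (3 / 4 : ℝ) * X ^ (-(7 / 4) : ℝ) +
        H₂ ^ (3 / 4 : ℝ) * (X ^ (-1 : ℝ) * Y ^ (-(3 / 4) : ℝ)))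
      = 2 ^ (s - 1 + a) * (W * M * (r * ρ * S * (X ^ (-2 : ℝ) * Y ^ (-1 : ℝ))) +
        W * M * (H₁ ^ (3 / 4 : ℝ) * X ^ (-(7 / 4) : ℝ)) +
        W * M * (H₂ ^ (3 / 4 : ℝ) * (X ^ (-1 : ℝ) * Y ^ (-(3 / 4) : ℝ)))) := by ring
    _ ≤ 2 ^ (s - 1 + a) * (432 * K * (Tp * (S ^ ((1 : ℝ) / 2) * (H₁ ^ (-b') * H₂ ^ (-b')))) +
        432 * (K * (Tm * H₂ ^ (-b'))) + 432 * (K * (Tm * H₁ ^ (-b')))) := by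
        refine mul_le_mul_of_nonneg_left ?_ (by positivity)
        linarith
    _ = 2 ^ (s - 1 + a) * (432 * K) * (Tp * (S ^ ((1 : ℝ) / 2) * (H₁ ^ (-b') * H₂ ^ (-b'))) +
          Tm * (H₁ ^ (-b') + H₂ ^ (-b'))) := by ring

/-- The sign of a real number, with the convention that zero is positive. -/
def sg (t : ℝ) : ℝ := if 0 ≤ t then 1 else -1

lemma sg_eq (t : ℝ) : sg t = 1 ∨ sg t = -1 := by
  unfold sg; split_ifs <;> simp

lemma sg_mul_self (t : ℝ) : sg t * sg t = 1 := by
  rcases sg_eq t with h | h <;> rw [h] <;> norm_num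

lemma abs_sg (t : ℝ) : |sg t| = 1 := by
  rcases sg_eq t with h | h <;> rw [h] <;> norm_num

lemma abs_sub_sg_mul (t r : ℝ) : |t - sg t * r| = |(|t| - r)| := by
  unfold sg; split_ifs with h
  · rw [abs_of_nonneg h, one_mul]
  · rw [abs_of_neg (not_le.1 h), ← abs_neg]; congr 1; ring

lemma one_le_jap (x : ℝ) : 1 ≤ jap x := by
  unfold jap; rw [Real.one_le_sqrt]; nlinarith [sq_nonneg x]

lemma jap_pos (x : ℝ) : 0 < jap x := one_pos.trans_le (one_le_jap x)

lemma abs_le_jap (x : ℝ) : |x| ≤ jap x := by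
  unfold jap; apply Real.abs_le_sqrt; linarith

lemma le_jap (x : ℝ) : x ≤ jap x := (le_abs_self x).trans (abs_le_jap x)

lemma jap_le_jap {x y : ℝ} (h : |x| ≤ |y|) : jap x ≤ jap y := by
  unfold jap; apply Real.sqrt_le_sqrt; have := sq_le_sq.2 h; linarith

lemma jap_add_le (x y : ℝ) : jap (x + y) ≤ jap x + jap y := by
  have h₁ : jap x ^ 2 = 1 + x ^ 2 := Real.sq_sqrt (by positivity)
  have h₂ : jap y ^ 2 = 1 + y ^ 2 := Real.sq_sqrt (by positivity)
  have h₃ : x * y ≤ jap x * jap y := by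
    refine (le_abs_self _).trans ?_
    rw [abs_mul]
    exact mul_le_mul (abs_le_jap x) (abs_le_jap y) (abs_nonneg _) (jap_pos x).le
  have := jap_pos x
  have := jap_pos y
  change Real.sqrt (1 + (x + y) ^ 2) ≤ _
  apply Real.sqrt_le_iff.2 ⟨by positivity, by nlinarith⟩

/-- The `j`-th component of the difference of the signed spatial directions of two frequencies. -/
def dirComp (j : Fin 3) (η θ : SpaceTime) : ℝ :=
  sg (η 0) * (η j.succ / ‖spt η‖) - sg (θ 0) * (θ j.succ / ‖spt θ‖)

/-- The `ℓ¹` distance of the signed spatial directions of two frequencies. -/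
def dirSum (η θ : SpaceTime) : ℝ := ∑ j, |dirComp j η θ|

lemma spt_apply (ζ : SpaceTime) (j : Fin 3) : spt ζ j = ζ j.succ := rfl

lemma spt_add (η θ : SpaceTime) : spt (η + θ) = spt η + spt θ := rfl

lemma norm_spt_sq (ζ : SpaceTime) : ‖spt ζ‖ ^ 2 = ζ 1 ^ 2 + ζ 2 ^ 2 + ζ 3 ^ 2 := by
  rw [EuclideanSpace.real_norm_sq_eq, Fin.sum_univ_three]; rfl

lemma abs_le_norm_spt (ζ : SpaceTime) (j : Fin 3) : |ζ j.succ| ≤ ‖spt ζ‖ := by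
  simpa [spt_apply] using PiLp.norm_apply_le (spt ζ) j

lemma norm_mul_div (ζ : SpaceTime) (j : Fin 3) : ‖spt ζ‖ * (ζ j.succ / ‖spt ζ‖) = ζ j.succ := by
  rcases eq_or_ne ‖spt ζ‖ 0 with h | h
  · have := abs_le_norm_spt ζ j
    rw [h] at this
    rw [h, zero_mul, abs_eq_zero.1 (le_antisymm this (abs_nonneg _))]
  · field_simp

lemma abs_dirComp_le (j : Fin 3) (η θ : SpaceTime) : |dirComp j η θ| ≤ 2 := by
  have key : ∀ ζ : SpaceTime, |sg (ζ 0) * (ζ j.succ / ‖spt ζ‖)| ≤ 1 := fun ζ => by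
    rw [abs_mul, abs_sg, one_mul, abs_div, abs_norm]
    exact div_le_one_of_le₀ (abs_le_norm_spt ζ j) (norm_nonneg _)
  have := abs_sub (sg (η 0) * (η j.succ / ‖spt η‖)) (sg (θ 0) * (θ j.succ / ‖spt θ‖))
  unfold dirComp
  linarith [key η, key θ]

lemma dirSum_nonneg (η θ : SpaceTime) : 0 ≤ dirSum η θ := Finset.sum_nonneg fun _ _ => abs_nonneg _

lemma dirSum_le (η θ : SpaceTime) : dirSum η θ ≤ 6 := by
  have := Finset.sum_le_sum fun j (_ : j ∈ Finset.univ) => abs_dirComp_le j η θ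
  simp at this
  unfold dirSum; linarith

lemma abs_dirComp_le_dirSum (j : Fin 3) (η θ : SpaceTime) : |dirComp j η θ| ≤ dirSum η θ :=
  Finset.single_le_sum (f := fun j => |dirComp j η θ|) (fun _ _ => abs_nonneg _)
    (Finset.mem_univ j)

lemma abs_dirComp_add_le (i j : Fin 3) (h : i ≠ j) (η θ : SpaceTime) :
    |dirComp i η θ| + |dirComp j η θ| ≤ dirSum η θ :=
  Finset.add_le_sum (f := fun j => |dirComp j η θ|) (fun _ _ => abs_nonneg _)
    (Finset.mem_univ i) (Finset.mem_univ j) h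

lemma dirSum_sq_le (η θ : SpaceTime) : ‖spt η‖ * ‖spt θ‖ * dirSum η θ ^ 2 ≤
    3 * |2 * (‖spt η‖ * ‖spt θ‖) -
      2 * (sg (η 0) * sg (θ 0)) * (η 1 * θ 1 + η 2 * θ 2 + η 3 * θ 3)| := by
  have c : dirSum η θ ^ 2 ≤
      3 * (dirComp 0 η θ ^ 2 + dirComp 1 η θ ^ 2 + dirComp 2 η θ ^ 2) := by
    rw [dirSum, Fin.sum_univ_three, ← sq_abs (dirComp 0 η θ), ← sq_abs (dirComp 1 η θ),
      ← sq_abs (dirComp 2 η θ)]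
    nlinarith [sq_nonneg (|dirComp 0 η θ| - |dirComp 1 η θ|),
      sq_nonneg (|dirComp 0 η θ| - |dirComp 2 η θ|), sq_nonneg (|dirComp 1 η θ| - |dirComp 2 η θ|)]
  have e : ‖spt η‖ * ‖spt θ‖ * (dirComp 0 η θ ^ 2 + dirComp 1 η θ ^ 2 + dirComp 2 η θ ^ 2) =
      2 * (‖spt η‖ * ‖spt θ‖) -
      2 * (sg (η 0) * sg (θ 0)) * (η 1 * θ 1 + η 2 * θ 2 + η 3 * θ 3) := by
    rcases eq_or_ne ‖spt η‖ 0 with h | h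
    · have hz : ∀ j : Fin 3, η j.succ = 0 := fun j => by rw [← norm_mul_div η j, h, zero_mul]
      have h1 := hz 0; have h2 := hz 1; have h3 := hz 2
      simp at h1 h2 h3
      simp [h, h1, h2, h3]
    rcases eq_or_ne ‖spt θ‖ 0 with h' | h'
    · have hz : ∀ j : Fin 3, θ j.succ = 0 := fun j => by rw [← norm_mul_div θ j, h', zero_mul]
      have h1 := hz 0; have h2 := hz 1; have h3 := hz 2
      simp at h1 h2 h3
      simp [h', h1, h2, h3]
    have n₁ := norm_spt_sq η
    have n₂ := norm_spt_sq θ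
    have s₁ := sg_mul_self (η 0)
    have s₂ := sg_mul_self (θ 0)
    simp only [dirComp, Fin.succ_zero_eq_one, Fin.succ_one_eq_two]
    rw [show (2 : Fin 3).succ = 3 from rfl]
    field_simp
    generalize ‖spt η‖ = r at *
    generalize ‖spt θ‖ = ρ at *
    generalize sg (η 0) = e at *
    generalize sg (θ 0) = e' at *
    generalize η 1 = a at *
    generalize η 2 = a2 at *
    generalize η 3 = a3 at *
    generalize θ 1 = b at *
    generalize θ 2 = b2 at *
    generalize θ 3 = b3 at *
    have s₁' : e ^ 2 = 1 := by rw [sq]; exact s₁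
    have s₂' : e' ^ 2 = 1 := by rw [sq]; exact s₂
    linear_combination (ρ^2*(a^2+a2^2+a3^2)) * s₁' + (r^2*(b^2+b2^2+b3^2)) * s₂' -
      ρ^2 * n₁ - r^2 * n₂
  calc _ ≤ ‖spt η‖ * ‖spt θ‖ *
        (3 * (dirComp 0 η θ ^ 2 + dirComp 1 η θ ^ 2 + dirComp 2 η θ ^ 2)) := by gcongr
    _ = 3 * (‖spt η‖ * ‖spt θ‖ *
        (dirComp 0 η θ ^ 2 + dirComp 1 η θ ^ 2 + dirComp 2 η θ ^ 2)) := by ring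
    _ ≤ _ := by rw [e]; gcongr; exact le_abs_self _

lemma abs_sub_le_modulations (t₁ t₂ r₁ r₂ r₀ : ℝ) :
    |(|sg t₁ * r₁ + sg t₂ * r₂| - r₀)| ≤
      |(|t₁ + t₂| - r₀)| + |(|t₁| - r₁)| + |(|t₂| - r₂)| := by
  rw [← abs_sub_sg_mul t₁, ← abs_sub_sg_mul t₂]
  have h₁ := abs_abs_sub_abs_le (sg t₁ * r₁ + sg t₂ * r₂) (t₁ + t₂)
  have h₂ : |(sg t₁ * r₁ + sg t₂ * r₂) - (t₁ + t₂)| ≤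
      |t₁ - sg t₁ * r₁| + |t₂ - sg t₂ * r₂| := by
    rw [abs_sub_comm]
    refine le_trans (le_of_eq ?_) (abs_add_le _ _)
    congr 1; ring
  have h₃ := abs_add_le (|sg t₁ * r₁ + sg t₂ * r₂| - |t₁ + t₂|) (|t₁ + t₂| - r₀)
  rw [sub_add_sub_cancel] at h₃
  linarith

lemma dirSum_null_le (η θ : SpaceTime) : ‖spt η‖ * ‖spt θ‖ * dirSum η θ ^ 2 ≤
    18 * (jap ‖spt η‖ + jap ‖spt θ‖) * (jap (|(η + θ) 0| - ‖spt (η + θ)‖) *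
      jap (|η 0| - ‖spt η‖) * jap (|θ 0| - ‖spt θ‖)) := by
  refine (dirSum_sq_le η θ).trans ?_
  have n₀ := norm_spt_sq (η + θ)
  have n₁ := norm_spt_sq η
  have n₂ := norm_spt_sq θ
  simp only [PiLp.add_apply] at n₀
  have m := abs_sub_le_modulations (η 0) (θ 0) ‖spt η‖ ‖spt θ‖ ‖spt (η + θ)‖
  have tri : ‖spt (η + θ)‖ ≤ ‖spt η‖ + ‖spt θ‖ := by rw [spt_add]; exact norm_add_le _ _
  have hsg := abs_add_le (sg (η 0) * ‖spt η‖) (sg (θ 0) * ‖spt θ‖)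
  rw [abs_mul, abs_mul, abs_sg, abs_sg, one_mul, one_mul, abs_norm, abs_norm] at hsg
  set q := sg (η 0) * ‖spt η‖ + sg (θ 0) * ‖spt θ‖ with hq
  have e : |2 * (‖spt η‖ * ‖spt θ‖) -
      2 * (sg (η 0) * sg (θ 0)) * (η 1 * θ 1 + η 2 * θ 2 + η 3 * θ 3)| =
      |(|q| - ‖spt (η + θ)‖)| * (|q| + ‖spt (η + θ)‖) := by
    rw [← abs_of_nonneg (by positivity : 0 ≤ |q| + ‖spt (η + θ)‖), ← abs_mul,
      show (|q| - ‖spt (η + θ)‖) * (|q| + ‖spt (η + θ)‖) = |q| ^ 2 - ‖spt (η + θ)‖ ^ 2 by ring,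
      sq_abs]
    have s₁ := sg_mul_self (η 0)
    have s₂ := sg_mul_self (θ 0)
    have : q ^ 2 - ‖spt (η + θ)‖ ^ 2 = (sg (η 0) * sg (θ 0)) * (2 * (‖spt η‖ * ‖spt θ‖) -
      2 * (sg (η 0) * sg (θ 0)) * (η 1 * θ 1 + η 2 * θ 2 + η 3 * θ 3)) := by
      rw [hq, n₀]
      generalize sg (η 0) = e₁ at *
      generalize sg (θ 0) = e₂ at *
      linear_combination (‖spt η‖ ^ 2 + 2 * e₂*e₂* (η 1 * θ 1 + η 2 * θ 2 + η 3 * θ 3)) * s₁ +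
        (‖spt θ‖ ^ 2 + 2 * (η 1 * θ 1 + η 2 * θ 2 + η 3 * θ 3)) * s₂ + n₁ + n₂
    rw [this, abs_mul, abs_mul, abs_sg, abs_sg, one_mul, one_mul]
  rw [e]
  have j₀ := one_le_jap (|(η + θ) 0| - ‖spt (η + θ)‖)
  have j₁ := one_le_jap (|η 0| - ‖spt η‖)
  have j₂ := one_le_jap (|θ 0| - ‖spt θ‖)
  have k₀ := abs_le_jap (|(η + θ) 0| - ‖spt (η + θ)‖)
  have k₁ := abs_le_jap (|η 0| - ‖spt η‖)
  have k₂ := abs_le_jap (|θ 0| - ‖spt θ‖)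
  rw [← PiLp.add_apply] at m
  generalize jap (|(η + θ) 0| - ‖spt (η + θ)‖) = H₀ at *
  generalize jap (|η 0| - ‖spt η‖) = H₁ at *
  generalize jap (|θ 0| - ‖spt θ‖) = H₂ at *
  have hH : H₀ + H₁ + H₂ ≤ 3 * (H₀ * H₁ * H₂) := by
    have a₀ : H₀ ≤ H₀ * H₁ * H₂ := by
      rw [mul_assoc]
      exact le_mul_of_one_le_right (by linarith) (one_le_mul_of_one_le_of_one_le j₁ j₂)
    have a₁ : H₁ ≤ H₀ * H₁ * H₂ := by
      rw [show H₀ * H₁ * H₂ = H₁ * (H₀ * H₂) by ring]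
      exact le_mul_of_one_le_right (by linarith) (one_le_mul_of_one_le_of_one_le j₀ j₂)
    have a₂ : H₂ ≤ H₀ * H₁ * H₂ := by
      rw [mul_comm]
      exact le_mul_of_one_le_right (by linarith) (one_le_mul_of_one_le_of_one_le j₀ j₁)
    linarith
  calc 3 * (|(|q| - ‖spt (η + θ)‖)| * (|q| + ‖spt (η + θ)‖))
      ≤ 3 * ((3 * (H₀ * H₁ * H₂)) * (2 * (jap ‖spt η‖ + jap ‖spt θ‖))) := by
        gcongr
        · linarith
        · linarith [le_jap ‖spt η‖, le_jap ‖spt θ‖]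
    _ = _ := by ring

lemma abs_spatial_null_le (η θ : SpaceTime) (i j : Fin 3) :
    |η i.succ * θ j.succ - η j.succ * θ i.succ| ≤ ‖spt η‖ * ‖spt θ‖ * dirSum η θ := by
  rcases eq_or_ne i j with rfl | hij
  · rw [mul_comm, sub_self, abs_zero]
    have := dirSum_nonneg η θ
    positivity
  have key : η i.succ * θ j.succ - η j.succ * θ i.succ = (sg (η 0) * sg (θ 0)) *
      (‖spt η‖ * ‖spt θ‖) * ((sg (η 0) * (η j.succ / ‖spt η‖)) * dirComp i η θ -
        (sg (η 0) * (η i.succ / ‖spt η‖)) * dirComp j η θ) := by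
    have a := norm_mul_div η i
    have b := norm_mul_div η j
    have c := norm_mul_div θ i
    have d := norm_mul_div θ j
    have s₁ := sg_mul_self (η 0)
    have s₂ := sg_mul_self (θ 0)
    unfold dirComp
    generalize η i.succ / ‖spt η‖ = a₁ at *
    generalize η j.succ / ‖spt η‖ = a₂ at *
    generalize θ i.succ / ‖spt θ‖ = b₁ at *
    generalize θ j.succ / ‖spt θ‖ = b₂ at *
    rw [← a, ← b, ← c, ← d]
    generalize ‖spt η‖ = r
    generalize ‖spt θ‖ = ρ
    generalize sg (η 0) = e₁ at *
    generalize sg (θ 0) = e₂ at *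
    linear_combination (-(r * ρ * (a₁ * b₂ - a₂ * b₁) * e₂ * e₂)) * s₁ -
      (r * ρ * (a₁ * b₂ - a₂ * b₁)) * s₂
  have bd : ∀ k : Fin 3, |sg (η 0) * (η k.succ / ‖spt η‖)| ≤ 1 := fun k => by
    rw [abs_mul, abs_sg, one_mul, abs_div, abs_norm]
    exact div_le_one_of_le₀ (abs_le_norm_spt η k) (norm_nonneg _)
  rw [key, abs_mul, abs_mul, abs_mul, abs_sg, abs_sg, one_mul, one_mul,
    abs_of_nonneg (by positivity : 0 ≤ ‖spt η‖ * ‖spt θ‖)]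
  gcongr
  refine (abs_sub _ _).trans (le_trans ?_ (abs_dirComp_add_le i j hij η θ))
  rw [abs_mul _ (dirComp i η θ), abs_mul _ (dirComp j η θ)]
  exact add_le_add (mul_le_of_le_one_left (abs_nonneg _) (bd j))
    (mul_le_of_le_one_left (abs_nonneg _) (bd i))

lemma abs_mixed_null_le (η θ : SpaceTime) (j : Fin 3) :
    |η 0 * θ j.succ - η j.succ * θ 0| ≤ ‖spt η‖ * ‖spt θ‖ * dirSum η θ +
      |(|η 0| - ‖spt η‖)| * ‖spt θ‖ + |(|θ 0| - ‖spt θ‖)| * ‖spt η‖ := by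
  have key : η 0 * θ j.succ - η j.succ * θ 0 = -((sg (η 0) * sg (θ 0)) *
      (‖spt η‖ * ‖spt θ‖) * dirComp j η θ) + (η 0 - sg (η 0) * ‖spt η‖) * θ j.succ -
        (θ 0 - sg (θ 0) * ‖spt θ‖) * η j.succ := by
    have b := norm_mul_div η j
    have d := norm_mul_div θ j
    have s₁ := sg_mul_self (η 0)
    have s₂ := sg_mul_self (θ 0)
    unfold dirComp
    generalize η j.succ / ‖spt η‖ = a₂ at *
    generalize θ j.succ / ‖spt θ‖ = b₂ at *
    rw [← b, ← d]
    generalize ‖spt η‖ = r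
    generalize ‖spt θ‖ = ρ
    generalize sg (η 0) = e₁ at *
    generalize sg (θ 0) = e₂ at *
    linear_combination (r * ρ * e₂ * a₂) * s₁ - (r * ρ * e₁ * b₂) * s₂
  rw [key, ← abs_sub_sg_mul (η 0), ← abs_sub_sg_mul (θ 0)]
  refine (abs_sub _ _).trans (add_le_add ((abs_add_le _ _).trans (add_le_add ?_ ?_)) ?_)
  · rw [abs_neg, abs_mul, abs_mul, abs_mul, abs_sg, abs_sg, one_mul, one_mul,
      abs_of_nonneg (by positivity : 0 ≤ ‖spt η‖ * ‖spt θ‖)]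
    gcongr
    exact abs_dirComp_le_dirSum j η θ
  · rw [abs_mul]; gcongr; exact abs_le_norm_spt θ j
  · rw [abs_mul]; gcongr; exact abs_le_norm_spt η j

lemma abs_null_le (η θ : SpaceTime) (α β : Fin 4) :
    |η α * θ β - η β * θ α| ≤ ‖spt η‖ * ‖spt θ‖ * dirSum η θ +
      |(|η 0| - ‖spt η‖)| * ‖spt θ‖ + |(|θ 0| - ‖spt θ‖)| * ‖spt η‖ := by
  have h₁ : 0 ≤ |(|η 0| - ‖spt η‖)| * ‖spt θ‖ := by positivity
  have h₂ : 0 ≤ |(|θ 0| - ‖spt θ‖)| * ‖spt η‖ := by positivity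
  have h₃ : 0 ≤ ‖spt η‖ * ‖spt θ‖ * dirSum η θ := by
    have := dirSum_nonneg η θ; positivity
  refine Fin.cases ?_ (fun i => ?_) α <;> refine Fin.cases ?_ (fun j => ?_) β
  · rw [mul_comm, sub_self, abs_zero]; linarith
  · exact abs_mixed_null_le η θ j
  · rw [abs_sub_comm]; exact abs_mixed_null_le η θ i
  · linarith [abs_spatial_null_le η θ i j]

/-- `K` is the kernel of a trilinear form bounded on `L² × L² × L²` with constant `C`. -/
def TriBound {Y : Type*} [Add Y] [MeasureSpace Y] (K : Y → Y → ℝ≥0∞) (C : ℝ≥0∞) : Prop :=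
  ∀ F₀ F₁ F₂ : Y → ℝ≥0∞, Measurable F₀ → Measurable F₁ → Measurable F₂ →
    ∫⁻ p, ∫⁻ q, F₀ (p + q) * F₁ p * F₂ q * K p q ≤ C * (nl2 F₀ * nl2 F₁ * nl2 F₂)

namespace TriBound

variable {Y : Type*} [Add Y] [MeasureSpace Y] {K K' : Y → Y → ℝ≥0∞} {C C' : ℝ≥0∞}

lemma mono (h : TriBound K' C) (hK : ∀ p q, K p q ≤ K' p q) : TriBound K C :=
  fun F₀ F₁ F₂ h₀ h₁ h₂ => (lintegral_mono fun p => lintegral_mono fun q => by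
    gcongr; exact hK p q).trans (h F₀ F₁ F₂ h₀ h₁ h₂)

lemma add [MeasurableAdd₂ Y] [SFinite (volume : Measure Y)] (h : TriBound K C)
    (h' : TriBound K' C') (hK : Measurable (Function.uncurry K)) :
    TriBound (fun p q => K p q + K' p q) (C + C') := by
  intro F₀ F₁ F₂ h₀ h₁ h₂
  have hm : Measurable fun x : Y × Y => F₀ (x.1 + x.2) * F₁ x.1 * F₂ x.2 * K x.1 x.2 :=
    (by fun_prop : Measurable fun x : Y × Y => F₀ (x.1 + x.2) * F₁ x.1 * F₂ x.2).mul hK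
  have e : ∀ p, ∫⁻ q, F₀ (p + q) * F₁ p * F₂ q * (K p q + K' p q) =
      (∫⁻ q, F₀ (p + q) * F₁ p * F₂ q * K p q) + ∫⁻ q, F₀ (p + q) * F₁ p * F₂ q * K' p q := by
    intro p
    rw [← lintegral_add_left (f := fun q => F₀ (p + q) * F₁ p * F₂ q * K p q)
      (hm.comp (measurable_prodMk_left (x := p)))]
    simp only [mul_add]
  simp_rw [e]
  rw [lintegral_add_left hm.lintegral_prod_right', add_mul]
  exact add_le_add (h _ _ _ h₀ h₁ h₂) (h' _ _ _ h₀ h₁ h₂)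

lemma zero : TriBound (fun _ _ : Y => 0) 0 := by
  intro F₀ F₁ F₂ _ _ _; simp

lemma sum [MeasurableAdd₂ Y] [SFinite (volume : Measure Y)] {ι : Type*} (t : Finset ι)
    {k : ι → Y → Y → ℝ≥0∞} {c : ι → ℝ≥0∞} (h : ∀ i ∈ t, TriBound (k i) (c i))
    (hk : ∀ i ∈ t, Measurable (Function.uncurry (k i))) :
    TriBound (fun p q => ∑ i ∈ t, k i p q) (∑ i ∈ t, c i) := by
  classical
  induction t using Finset.induction_on with
  | empty => simpa using zero
  | insert a t ha ih =>
    simp_rw [Finset.sum_insert ha]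
    exact (h a (by simp)).add (ih (fun i hi => h i (by simp [hi])) fun i hi => hk i (by simp [hi]))
      (hk a (by simp))

lemma const_mul [MeasurableAdd₂ Y] [SFinite (volume : Measure Y)] (h : TriBound K C) (c : ℝ≥0∞)
    (hK : Measurable (Function.uncurry K)) :
    TriBound (fun p q => c * K p q) (c * C) := by
  intro F₀ F₁ F₂ h₀ h₁ h₂
  have hm : Measurable fun x : Y × Y => F₀ (x.1 + x.2) * F₁ x.1 * F₂ x.2 * K x.1 x.2 :=
    (by fun_prop : Measurable fun x : Y × Y => F₀ (x.1 + x.2) * F₁ x.1 * F₂ x.2).mul hK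
  simp_rw [mul_left_comm _ c]
  have e : ∀ p, ∫⁻ q, c * (F₀ (p + q) * F₁ p * F₂ q * K p q) =
      c * ∫⁻ q, F₀ (p + q) * F₁ p * F₂ q * K p q := fun p =>
    lintegral_const_mul c (hm.comp measurable_prodMk_left)
  simp_rw [e]
  rw [lintegral_const_mul c hm.lintegral_prod_right', mul_assoc]
  gcongr
  exact h _ _ _ h₀ h₁ h₂

lemma comp_measurableEquiv {X : Type*} [Add X] [MeasureSpace X] (T : X ≃ᵐ Y)
    (hT : MeasurePreserving T) (hadd : ∀ x y, T (x + y) = T x + T y) (h : TriBound K C) :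
    TriBound (fun x y => K (T x) (T y)) C := by
  intro F₀ F₁ F₂ h₀ h₁ h₂
  have e : ∀ F : X → ℝ≥0∞, nl2 F = nl2 fun y => F (T.symm y) := fun F => by
    unfold nl2
    rw [← hT.lintegral_comp_emb T.measurableEmbedding]
    simp
  rw [e F₀, e F₁, e F₂]
  refine le_trans (le_of_eq ?_) (h _ _ _ (h₀.comp T.symm.measurable) (h₁.comp T.symm.measurable)
    (h₂.comp T.symm.measurable))
  rw [← hT.lintegral_comp_emb T.measurableEmbedding]
  refine lintegral_congr fun x => ?_
  rw [← hT.lintegral_comp_emb T.measurableEmbedding]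
  refine lintegral_congr fun y => ?_
  simp [← hadd]

end TriBound

/-- The distance to the origin in the plane. -/
def rad (y : Plane) : ℝ := hyp (y 1) (y 0)

/-- Coordinates on space-time singling out time and the `j`-th spatial coordinate. -/
def chart (j : Fin 3) : SpaceTime ≃ᵐ ℝ × ℝ × Plane :=
  (MeasurableEquiv.toLp 2 (Fin 4 → ℝ)).symm.trans
    ((MeasurableEquiv.piFinSuccAbove (fun _ : Fin 4 => ℝ) 0).trans
      (MeasurableEquiv.prodCongr (MeasurableEquiv.refl ℝ)
        (MeasurableEquiv.piFinSuccAbove (fun _ : Fin 3 => ℝ) j)))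

lemma chart_apply (j : Fin 3) (ζ : SpaceTime) :
    chart j ζ = (ζ 0, ζ j.succ, fun k => ζ (j.succAbove k).succ) := rfl

lemma measurePreserving_chart (j : Fin 3) : MeasurePreserving (chart j) := by
  refine (PiLp.volume_preserving_ofLp (Fin 4)).trans (MeasurePreserving.trans
    (volume_preserving_piFinSuccAbove (fun _ : Fin 4 => ℝ) 0) ?_)
  exact (MeasurePreserving.id volume).prod (volume_preserving_piFinSuccAbove (fun _ : Fin 3 => ℝ) j)

lemma chart_add (j : Fin 3) (x y : SpaceTime) : chart j (x + y) = chart j x + chart j y := rfl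

lemma chart_pick (j i : Fin 3) (x y : SpaceTime) :
    chart j (pick i x y) = pick i (chart j x) (chart j y) := by
  fin_cases i <;> simp [pick, chart_add]

lemma hyp_chart (j : Fin 3) (ζ : SpaceTime) :
    hyp (rad (chart j ζ).2.2) (chart j ζ).2.1 = ‖spt ζ‖ := by
  rw [← Real.sqrt_sq (norm_nonneg (spt ζ)), norm_spt_sq, chart_apply]
  unfold hyp rad hyp
  rw [Real.sq_sqrt (by positivity)]
  congr 1
  fin_cases j <;> simp [Fin.succAbove] <;> ring_nf

lemma measurable_rad : Measurable rad := by unfold rad; fun_prop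

lemma abs_le_rad (y : Plane) : ‖y‖ ≤ |rad y| := by
  rw [pi_norm_le_iff_of_nonneg (abs_nonneg _)]
  intro i
  rw [rad, hyp, abs_of_nonneg (Real.sqrt_nonneg _), Real.norm_eq_abs]
  apply Real.abs_le_sqrt
  fin_cases i <;> simp <;> positivity

lemma ae_rad_pos : ∀ᵐ y : Plane, 0 < rad y := by
  have : ∀ᵐ y : Plane, y ≠ 0 := by
    rw [ae_iff]; simp
  filter_upwards [this] with y hy
  have h := abs_le_rad y
  rw [abs_of_nonneg (by unfold rad hyp; positivity)] at h
  exact (norm_pos_iff.2 hy).trans_le h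

lemma measurable_jap : Measurable jap := by unfold jap; fun_prop

/-- The weight `⟨n(x)⟩^{-p}` as an extended nonnegative function. -/
def wt {E : Type*} (n : E → ℝ) (p : ℝ) (x : E) : ℝ≥0∞ := ENNReal.ofReal (jap (n x) ^ (-p))

lemma measurable_wt {E : Type*} [MeasurableSpace E] {n : E → ℝ} (hn : Measurable n) (p : ℝ) :
    Measurable (wt n p) :=
  ((measurable_jap.comp hn).pow_const _).ennreal_ofReal

lemma nl2_wt_ne_top {E : Type*} [NormedAddCommGroup E] [NormedSpace ℝ E] [FiniteDimensional ℝ E]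
    [MeasureSpace E] [BorelSpace E] [(volume : Measure E).IsAddHaarMeasure] {n : E → ℝ} {p : ℝ}
    (hn : ∀ x, ‖x‖ ≤ |n x|) (hp : (Module.finrank ℝ E : ℝ) < 2 * p) :
    nl2 (wt n p) ≠ ⊤ := by
  unfold nl2
  refine ENNReal.rpow_ne_top_of_nonneg (by norm_num) (ne_top_of_le_ne_top
    (integrable_rpow_neg_one_add_norm_sq (μ := (volume : Measure E)) hp).2.ne
    (lintegral_mono fun x => ?_))
  have p0 : 0 ≤ p := by
    have : (0 : ℝ) ≤ Module.finrank ℝ E := by positivity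
    linarith
  rw [wt, ← ENNReal.ofReal_pow (Real.rpow_nonneg (jap_pos _).le _), Real.enorm_eq_ofReal
    (by positivity)]
  apply ENNReal.ofReal_le_ofReal
  rw [jap, Real.sqrt_eq_rpow, ← Real.rpow_mul (by positivity),
    ← Real.rpow_mul_natCast (by positivity)]
  rw [show (1 / 2 * -p * (2 : ℕ) : ℝ) = -(2 * p) / 2 by push_cast; ring]
  apply Real.rpow_le_rpow_of_nonpos (by positivity) _ (by linarith)
  have := sq_le_sq.2 (by simpa using hn x : |‖x‖| ≤ |n x|)
  linarith

/-- Frequency size `|ξ|` of a space-time frequency. -/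
def freq (ζ : SpaceTime) : ℝ := ‖spt ζ‖

/-- Modulation `|τ| - |ξ|` of a space-time frequency. -/
def modul (ζ : SpaceTime) : ℝ := |ζ 0| - ‖spt ζ‖

/-- The trilinear weight attached to the null form estimates. -/
def kern (s ε : ℝ) (η θ : SpaceTime) : ℝ :=
  jap (freq (η + θ)) ^ (s - 1) * (jap (freq η) ^ (s - 1) * jap (freq θ) ^ (s - 1))⁻¹ *
    (jap (modul (η + θ)) ^ (-(1 / 4 - 2 * ε)) * jap (modul η) ^ (-(3 / 4 + ε)) *
      jap (modul θ) ^ (-(3 / 4 + ε)))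

/-- The size of the normalised null symbols. -/
def NullSymbol (σ : SpaceTime → SpaceTime → ℝ) : Prop :=
  ∀ η θ, σ η θ ≤ ‖spt η‖ * ‖spt θ‖ * dirSum η θ *
      (jap (freq η) ^ (-2 : ℝ) * jap (freq θ) ^ (-1 : ℝ)) +
    jap (modul η) ^ (3 / 4 : ℝ) * jap (freq η) ^ (-(7 / 4) : ℝ) +
    jap (modul θ) ^ (3 / 4 : ℝ) * (jap (freq η) ^ (-1 : ℝ) * jap (freq θ) ^ (-(3 / 4) : ℝ))

lemma measurable_coord (μ : Fin 4) : Measurable fun ζ : SpaceTime => ζ μ := by fun_prop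

lemma measurable_spt : Measurable spt := by
  exact (PiLp.continuous_toLp 2 _).measurable.comp (measurable_pi_lambda _ fun i => by fun_prop)

lemma measurable_freq : Measurable freq := measurable_spt.norm

lemma measurable_modul : Measurable modul :=
  ((measurable_coord 0).abs).sub measurable_spt.norm

lemma measurable_sg : Measurable sg := by
  unfold sg
  exact Measurable.ite measurableSet_Ici measurable_const measurable_const

lemma measurable_dirComp (j : Fin 3) : Measurable (Function.uncurry (dirComp j)) := by
  have := measurable_sg
  have := measurable_spt
  unfold dirComp Function.uncurry
  fun_prop

lemma sg_eq_sgnv (t : ℝ) : ∃ c, sg t = sgnv c := by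
  unfold sg sgnv; split_ifs <;> [exact ⟨true, by simp⟩; exact ⟨false, by simp⟩]

lemma sgnv_eq (c : Bool) : sgnv c = 1 ∨ sgnv c = -1 := by cases c <;> simp [sgnv]

lemma wt_modul {p : ℝ} (ζ : SpaceTime) (j : Fin 3) {c : Bool} (hc : sg (ζ 0) = sgnv c) :
    wt modul p ζ =
      wt id p ((chart j ζ).1 - sgnv c * hyp (rad (chart j ζ).2.2) (chart j ζ).2.1) := by
  have h : jap (modul ζ) = jap (ζ 0 - sg (ζ 0) * ‖spt ζ‖) := by
    unfold jap modul
    rw [← sq_abs (ζ 0 - _), abs_sub_sg_mul, sq_abs]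
  rw [hyp_chart, ← hc, wt, wt, h]; rfl

lemma wt_freq_le {p : ℝ} (hp : 0 ≤ p) (ζ : SpaceTime) (j : Fin 3) :
    wt freq p ζ ≤ wt rad p (chart j ζ).2.2 := by
  unfold wt
  apply ENNReal.ofReal_le_ofReal
  apply Real.rpow_le_rpow_of_nonpos (jap_pos _) _ (by linarith)
  apply jap_le_jap
  rw [freq, ← hyp_chart j, hyp]
  refine (Real.abs_le_sqrt ?_).trans (le_abs_self _)
  nlinarith [sq_nonneg (chart j ζ).2.1]

lemma dirComp_chart (j : Fin 3) (η θ : SpaceTime) {c c' : Bool} (hc : sg (η 0) = sgnv c)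
    (hc' : sg (θ 0) = sgnv c') :
    dirComp j η θ = dirDiff (sgnv c) (sgnv c') (rad (chart j η).2.2) (rad (chart j θ).2.2)
      (chart j η).2.1 (chart j θ).2.1 := by
  unfold dirComp dirDiff
  rw [hyp_chart, hyp_chart, hc, hc']; rfl

lemma triBound_main {p b : ℝ} (hp : 1 < p) (hb : 1 / 2 < b) (i j : Fin 3) :
    ∃ C : ℝ≥0∞, C ≠ ⊤ ∧ TriBound (fun η θ => ENNReal.ofReal |dirComp j η θ| ^ ((1 : ℝ) / 2) *
      wt freq p (pick i η θ) * wt modul b η * wt modul b θ) C := by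
  have nw : nl2 (wt rad p) ≠ ⊤ := nl2_wt_ne_top abs_le_rad (by simpa using by linarith)
  have nb : nl2 (wt (id : ℝ → ℝ) b) ≠ ⊤ := nl2_wt_ne_top (by simp) (by simpa using by linarith)
  have mw : Measurable (wt rad p) := measurable_wt measurable_rad p
  have mb : Measurable (wt (id : ℝ → ℝ) b) := measurable_wt measurable_id b
  have mr := measurable_rad
  obtain ⟨k, hk⟩ : ∃ k : Bool × Bool → ℝ × ℝ × Plane → ℝ × ℝ × Plane → ℝ≥0∞, k = fun c p' q =>
      ENNReal.ofReal |dirDiff (sgnv c.1) (sgnv c.2) (rad p'.2.2) (rad q.2.2) p'.2.1 q.2.1|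
        ^ ((1 : ℝ) / 2) * wt rad p (pick i p'.2.2 q.2.2) *
        wt id b (p'.1 - sgnv c.1 * hyp (rad p'.2.2) p'.2.1) *
        wt id b (q.1 - sgnv c.2 * hyp (rad q.2.2) q.2.1) := ⟨_, rfl⟩
  have hT : ∀ c, TriBound (k c) (2 * (nl2 (wt rad p) * nl2 (wt (id : ℝ → ℝ) b) ^ 2)) := by
    intro c F₀ F₁ F₂ h₀ h₁ h₂
    rw [hk]
    refine (trilinear_null_le (sgnv_eq c.1) (sgnv_eq c.2) mr ae_rad_pos h₀ h₁ h₂ mw mb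
      i).trans_eq ?_
    ring
  have hm : ∀ c, Measurable (Function.uncurry (k c)) := by
    intro c
    rw [hk]
    have m₁ : Measurable fun x : (ℝ × ℝ × Plane) × (ℝ × ℝ × Plane) =>
        dirDiff (sgnv c.1) (sgnv c.2) (rad x.1.2.2) (rad x.2.2.2) x.1.2.1 x.2.2.1 :=
      measurable_dirDiff _ _ (by fun_prop) (by fun_prop) (by fun_prop) (by fun_prop)
    have m₂ : Measurable fun x : (ℝ × ℝ × Plane) × (ℝ × ℝ × Plane) =>
        wt rad p (pick i x.1.2.2 x.2.2.2) :=
      mw.comp ((measurable_pick (α := Plane) i).comp (by fun_prop :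
        Measurable fun x : (ℝ × ℝ × Plane) × (ℝ × ℝ × Plane) => (x.1.2.2, x.2.2.2)))
    have m₃ : ∀ e : ℝ, Measurable fun x : ℝ × ℝ × Plane =>
        wt id b (x.1 - e * hyp (rad x.2.2) x.2.1) := fun e => mb.comp (by fun_prop)
    exact ((((m₁.abs.ennreal_ofReal).pow_const _).mul m₂).mul ((m₃ _).comp measurable_fst)).mul
      ((m₃ _).comp measurable_snd)
  refine ⟨_, ?_, ((TriBound.sum Finset.univ (fun c _ => hT c) fun c _ => hm c).comp_measurableEquiv
    (chart j) (measurePreserving_chart j) (chart_add j)).mono fun η θ => ?_⟩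
  · exact ENNReal.sum_ne_top.2 fun _ _ => ENNReal.mul_ne_top (by simp)
      (ENNReal.mul_ne_top nw (ENNReal.pow_ne_top nb))
  · obtain ⟨c, hc⟩ := sg_eq_sgnv (η 0)
    obtain ⟨c', hc'⟩ := sg_eq_sgnv (θ 0)
    refine le_trans ?_ (Finset.single_le_sum (f := fun c => k c (chart j η) (chart j θ))
      (fun _ _ => zero_le) (Finset.mem_univ (c, c')))
    rw [hk, dirComp_chart j η θ hc hc', wt_modul η j hc, wt_modul θ j hc']
    beta_reduce
    gcongr
    refine (wt_freq_le (by linarith) _ j).trans_eq ?_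
    rw [chart_pick]
    congr 1
    fin_cases i <;> rfl

instance : (volume : Measure (ℝ × Plane)).IsAddHaarMeasure :=
  inferInstanceAs ((volume : Measure ℝ).prod (volume : Measure Plane)).IsAddHaarMeasure

lemma triBound_error {p b : ℝ} (hp : 3 / 2 < p) (hb : 1 / 2 < b) (i : Fin 3) {l : Fin 3}
    (hl : l ≠ 0) :
    ∃ C : ℝ≥0∞, C ≠ ⊤ ∧
      TriBound (fun η θ => wt freq p (pick i η θ) * wt modul b (pick l η θ)) C := by
  have mr := measurable_rad
  obtain ⟨n, hn⟩ : ∃ n : ℝ × Plane → ℝ, n = fun v => hyp (rad v.2) v.1 := ⟨_, rfl⟩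
  have mn : Measurable n := by rw [hn]; fun_prop
  have le_n : ∀ v, ‖v‖ ≤ |n v| := by
    intro v
    rw [hn, Prod.norm_def, sup_le_iff]
    refine ⟨(Real.abs_le_sqrt (by nlinarith [sq_nonneg (rad v.2)])).trans_eq
      (abs_of_nonneg (Real.sqrt_nonneg _)).symm,
      (abs_le_rad v.2).trans ((Real.abs_le_sqrt (y := v.1 ^ 2 + rad v.2 ^ 2)
        (by nlinarith [sq_nonneg v.1])).trans_eq (abs_of_nonneg (Real.sqrt_nonneg _)).symm)⟩
  have nw : nl2 (wt n p) ≠ ⊤ := nl2_wt_ne_top le_n (by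
    simp; linarith)
  have nb : nl2 (wt (id : ℝ → ℝ) b) ≠ ⊤ := nl2_wt_ne_top (by simp) (by simpa using by linarith)
  have mw : Measurable (wt n p) := measurable_wt mn p
  have mb : Measurable (wt (id : ℝ → ℝ) b) := measurable_wt measurable_id b
  obtain ⟨h, hh⟩ : ∃ h : Bool → (ℝ × Plane) × (ℝ × Plane) → ℝ,
      h = fun c v => sgnv c * n (pick l v.1 v.2) := ⟨_, rfl⟩
  have mh : ∀ c, Measurable (h c) := fun c => by
    rw [hh]; exact (mn.comp (measurable_pick l)).const_mul _
  obtain ⟨k, hk⟩ : ∃ k : Bool → ℝ × ℝ × Plane → ℝ × ℝ × Plane → ℝ≥0∞, k = fun c p' q =>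
      wt id b (pick l p'.1 q.1 - h c (p'.2, q.2)) * wt n p (pick i p'.2 q.2) := ⟨_, rfl⟩
  have hT : ∀ c, TriBound (k c) (nl2 (wt n p) * nl2 (wt (id : ℝ → ℝ) b)) := by
    intro c F₀ F₁ F₂ h₀ h₁ h₂
    rw [hk]
    simp_rw [← mul_assoc]
    exact trilinear_split_weight_le h₀ h₁ h₂ mw mb (mh c) i l
  have hm : ∀ c, Measurable (Function.uncurry (k c)) := by
    intro c
    rw [hk]
    have m₂ : Measurable fun x : (ℝ × ℝ × Plane) × (ℝ × ℝ × Plane) =>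
        wt n p (pick i x.1.2 x.2.2) :=
      mw.comp ((measurable_pick i).comp (by fun_prop :
        Measurable fun x : (ℝ × ℝ × Plane) × (ℝ × ℝ × Plane) => (x.1.2, x.2.2)))
    have m₃ : Measurable fun x : (ℝ × ℝ × Plane) × (ℝ × ℝ × Plane) => pick l x.1.1 x.2.1 :=
      (measurable_pick l).comp (by fun_prop :
        Measurable fun x : (ℝ × ℝ × Plane) × (ℝ × ℝ × Plane) => (x.1.1, x.2.1))
    have m₄ : Measurable fun x : (ℝ × ℝ × Plane) × (ℝ × ℝ × Plane) => h c (x.1.2, x.2.2) :=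
      (mh c).comp (by fun_prop)
    exact (mb.comp (m₃.sub m₄)).mul m₂
  refine ⟨_, ?_, ((TriBound.sum Finset.univ (fun c _ => hT c) fun c _ => hm c).comp_measurableEquiv
    (chart 0) (measurePreserving_chart 0) (chart_add 0)).mono fun η θ => ?_⟩
  · exact ENNReal.sum_ne_top.2 fun _ _ => ENNReal.mul_ne_top nw nb
  · obtain ⟨c, hc⟩ := sg_eq_sgnv ((pick l η θ) 0)
    refine le_trans ?_ (Finset.single_le_sum (f := fun c => k c (chart 0 η) (chart 0 θ))
      (fun _ _ => zero_le) (Finset.mem_univ c))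
    have e : ∀ ζ, wt freq p ζ = wt n p (chart 0 ζ).2 := fun ζ => by
      rw [wt, wt, hn, freq, ← hyp_chart 0]
    rw [hk, e, wt_modul _ 0 hc, chart_pick, chart_pick, mul_comm, hh, hn]
    refine le_of_eq ?_
    fin_cases i <;> fin_cases l <;> rfl

/-- The trilinear estimate behind all the null form estimates. -/
theorem triBound_kern {s : ℝ} (hs : 3 / 4 < s) : ∃ ε₀ > (0 : ℝ), ∀ ε, 0 < ε → ε < ε₀ →
    ∃ C : ℝ≥0∞, C ≠ ⊤ ∧ ∀ σ, NullSymbol σ →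
      TriBound (fun η θ => ENNReal.ofReal (kern s ε η θ * σ η θ)) C := by
  obtain ⟨a, ha⟩ : ∃ a, a = max (1 - s) 0 := ⟨_, rfl⟩
  have a0 : 0 ≤ a := ha ▸ le_max_right _ _
  have as : 1 - s ≤ a := ha ▸ le_max_left _ _
  have a4 : a < 1 / 4 := by rw [ha]; exact max_lt (by linarith) (by norm_num)
  refine ⟨(1 / 4 - a) / 8, by linarith, fun ε hε hε₀ => ?_⟩
  obtain ⟨C₀, hC₀, hker⟩ := kernel_le (s := s) a0 as hε (by linarith) (by linarith)
  obtain ⟨p, hp⟩ : ∃ p, p = 5 / 4 - 2 * ε - a := ⟨_, rfl⟩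
  obtain ⟨m, hm⟩ : ∃ m, m = 7 / 4 - a := ⟨_, rfl⟩
  obtain ⟨b, hb⟩ : ∃ b, b = 1 / 2 + 3 * ε := ⟨_, rfl⟩
  rw [← hp, ← hm, ← hb] at hker
  choose c₁ hc₁ t₁ using fun ij : Fin 3 × Fin 3 => triBound_main (p := p) (b := b) (by linarith)
    (by linarith) ij.1 ij.2
  choose c₂ hc₂ t₂ using fun i : Fin 3 => triBound_error (p := m) (b := b) (by linarith)
    (by linarith) i (l := 1) (by decide)
  choose c₃ hc₃ t₃ using fun i : Fin 3 => triBound_error (p := m) (b := b) (by linarith)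
    (by linarith) i (l := 2) (by decide)
  have mf : ∀ (p : ℝ) (i : Fin 3), Measurable fun x : SpaceTime × SpaceTime =>
      wt freq p (pick i x.1 x.2) := fun p i =>
    (measurable_wt measurable_freq p).comp (measurable_pick i)
  have mm : ∀ (i : Fin 3), Measurable fun x : SpaceTime × SpaceTime =>
      wt modul b (pick i x.1 x.2) := fun i =>
    (measurable_wt measurable_modul b).comp (measurable_pick i)
  have md := measurable_dirComp
  have m₁ : ∀ ij : Fin 3 × Fin 3, Measurable (Function.uncurry fun η θ : SpaceTime =>
      ENNReal.ofReal |dirComp ij.2 η θ| ^ ((1 : ℝ) / 2) * wt freq p (pick ij.1 η θ) *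
        wt modul b η * wt modul b θ) := fun ij =>
    (((((md ij.2).abs.ennreal_ofReal).pow_const _).mul (mf p ij.1)).mul (mm 1)).mul (mm 2)
  have m₂ : ∀ i l : Fin 3, Measurable (Function.uncurry fun η θ : SpaceTime =>
      wt freq m (pick i η θ) * wt modul b (pick l η θ)) := fun i l => (mf m i).mul (mm l)
  have T₁ := TriBound.sum Finset.univ (fun ij _ => t₁ ij) fun ij _ => m₁ ij
  have T₂ := TriBound.sum Finset.univ (fun i _ => t₂ i) fun i _ => m₂ i 1
  have T₃ := TriBound.sum Finset.univ (fun i _ => t₃ i) fun i _ => m₂ i 2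
  have M₁ : Measurable (Function.uncurry fun η θ : SpaceTime => ∑ ij : Fin 3 × Fin 3,
      ENNReal.ofReal |dirComp ij.2 η θ| ^ ((1 : ℝ) / 2) * wt freq p (pick ij.1 η θ) *
        wt modul b η * wt modul b θ) := Finset.measurable_fun_sum _ fun ij _ => m₁ ij
  have M₂ : ∀ l, Measurable (Function.uncurry fun η θ : SpaceTime => ∑ i : Fin 3,
      wt freq m (pick i η θ) * wt modul b (pick l η θ)) := fun l =>
    Finset.measurable_fun_sum _ fun i _ => m₂ i l
  have T := ((T₁.add (T₂.add T₃ (M₂ 1)) M₁)).const_mul (ENNReal.ofReal C₀)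
    (M₁.add ((M₂ 1).add (M₂ 2)))
  refine ⟨_, ?_, fun σ hσ => T.mono fun η θ => ?_⟩
  · refine ENNReal.mul_ne_top ENNReal.ofReal_ne_top (ENNReal.add_ne_top.2
      ⟨ENNReal.sum_ne_top.2 fun i _ => hc₁ i, ENNReal.add_ne_top.2
        ⟨ENNReal.sum_ne_top.2 fun i _ => hc₂ i, ENNReal.sum_ne_top.2 fun i _ => hc₃ i⟩⟩)
  have tri : ∀ x y z : SpaceTime, ‖spt x‖ ≤ ‖spt y‖ + ‖spt z‖ → jap (freq x) ≤
      jap (freq y) + jap (freq z) := fun x y z h =>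
    (jap_le_jap (by
      rw [freq, freq, freq, abs_norm, abs_of_nonneg (add_nonneg (norm_nonneg _) (norm_nonneg _))]
      exact h)).trans (jap_add_le _ _)
  have q := hker (jap (freq η)) (jap (freq θ)) (jap (freq (η + θ))) (jap (modul (η + θ)))
    (jap (modul η)) (jap (modul θ)) ‖spt η‖ ‖spt θ‖ (dirSum η θ) (σ η θ) (one_le_jap _)
    (one_le_jap _) (one_le_jap _) (one_le_jap _) (one_le_jap _) (one_le_jap _)
    ((tri η (η + θ) θ (by
      have : spt η = spt (η + θ) - spt θ := by rw [spt_add, add_sub_cancel_right]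
      rw [this]; exact norm_sub_le _ _)).trans_eq (add_comm _ _))
    ((tri θ (η + θ) η (by
      have : spt θ = spt (η + θ) - spt η := by rw [spt_add, add_sub_cancel_left]
      rw [this]; exact norm_sub_le _ _)).trans_eq (add_comm _ _))
    (tri (η + θ) η θ (by rw [spt_add]; exact norm_add_le _ _))
    (norm_nonneg _) (le_jap _) (norm_nonneg _) (le_jap _) (dirSum_nonneg _ _) (dirSum_le _ _)
    (dirSum_null_le η θ) (hσ η θ)
  refine (ENNReal.ofReal_le_ofReal q).trans ?_
  have J : ∀ x t : ℝ, 0 ≤ jap x ^ t := fun x t => Real.rpow_nonneg (jap_pos x).le t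
  have J' : ∀ f : ℝ, 0 ≤ jap (freq η) ^ f + jap (freq θ) ^ f + jap (freq (η + θ)) ^ f := fun f =>
    add_nonneg (add_nonneg (J _ _) (J _ _)) (J _ _)
  have hD : 0 ≤ dirSum η θ ^ ((1 : ℝ) / 2) := Real.rpow_nonneg (dirSum_nonneg _ _) _
  rw [ENNReal.ofReal_mul hC₀.le, ENNReal.ofReal_add (mul_nonneg (J' _) (mul_nonneg hD
    (mul_nonneg (J _ _) (J _ _)))) (mul_nonneg (J' _) (add_nonneg (J _ _) (J _ _))),
    ENNReal.ofReal_mul (J' _), ENNReal.ofReal_mul hD, ENNReal.ofReal_mul (J _ _),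
    ENNReal.ofReal_mul (J' _), ENNReal.ofReal_add (J _ _) (J _ _),
    ENNReal.ofReal_add (add_nonneg (J _ _) (J _ _)) (J _ _), ENNReal.ofReal_add (J _ _) (J _ _),
    ENNReal.ofReal_add (add_nonneg (J _ _) (J _ _)) (J _ _), ENNReal.ofReal_add (J _ _) (J _ _)]
  refine mul_le_mul_right ?_ _
  have hS : ENNReal.ofReal (dirSum η θ ^ ((1 : ℝ) / 2)) ≤
      ∑ j, ENNReal.ofReal |dirComp j η θ| ^ ((1 : ℝ) / 2) := by
    rw [← ENNReal.ofReal_rpow_of_nonneg (dirSum_nonneg _ _) (by norm_num), dirSum,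
      ENNReal.ofReal_sum_of_nonneg (fun _ _ => abs_nonneg _), Fin.sum_univ_three,
      Fin.sum_univ_three]
    refine (ENNReal.rpow_add_le_add_rpow _ _ (by norm_num) (by norm_num)).trans ?_
    gcongr
    exact ENNReal.rpow_add_le_add_rpow _ _ (by norm_num) (by norm_num)
  refine add_le_add ?_ (le_of_eq ?_)
  · refine (mul_le_mul_right (mul_le_mul_left hS _) _).trans_eq ?_
    simp only [Fintype.sum_prod_type, Fin.sum_univ_three, pick, Matrix.cons_val_zero,
      Matrix.cons_val_one, Matrix.cons_val, wt]
    ring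
  · simp only [Fin.sum_univ_three, pick, Matrix.cons_val_zero, Matrix.cons_val_one,
      Matrix.cons_val, wt]
    ring

/-- The symbol `⟨|τ| + |ξ|⟩`. -/
def japPlus (ζ : SpaceTime) : ℝ := jap (|ζ 0| + ‖spt ζ‖)

lemma japPlus_pos (ζ : SpaceTime) : 0 < japPlus ζ := jap_pos _

lemma norm_spt_le_japPlus (ζ : SpaceTime) : ‖spt ζ‖ ≤ japPlus ζ :=
  (le_add_of_nonneg_left (abs_nonneg _)).trans (le_jap _)

lemma abs_coord_le_japPlus (ζ : SpaceTime) (μ : Fin 4) : |ζ μ| ≤ japPlus ζ := by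
  refine μ.cases ?_ fun j => (abs_le_norm_spt ζ j).trans (norm_spt_le_japPlus ζ)
  exact (le_add_of_nonneg_right (norm_nonneg _)).trans (le_jap _)

lemma jap_freq_le_japPlus (ζ : SpaceTime) : jap (freq ζ) ≤ japPlus ζ := by
  refine jap_le_jap ?_
  rw [freq, abs_norm, abs_of_nonneg (by positivity)]
  exact le_add_of_nonneg_left (abs_nonneg _)

lemma jap_modul_le_japPlus (ζ : SpaceTime) : jap (modul ζ) ≤ japPlus ζ := by
  refine jap_le_jap ?_
  rw [modul, abs_of_nonneg (by positivity : 0 ≤ |ζ 0| + ‖spt ζ‖), abs_le]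
  constructor <;> linarith [abs_nonneg (ζ 0), norm_nonneg (spt ζ)]

lemma div_le_rpow_mul_rpow {J X P : ℝ} (hJ : 0 < J) (hX : 0 < X) (hJP : J ≤ P) (hXP : X ≤ P) :
    J / P ≤ J ^ (3 / 4 : ℝ) * X ^ (-(3 / 4) : ℝ) := by
  have hP : 0 < P := hJ.trans_le hJP
  rw [Real.rpow_neg hX.le, ← div_eq_mul_inv, div_le_div_iff₀ hP (by positivity)]
  calc J * X ^ (3 / 4 : ℝ) = J ^ (3 / 4 : ℝ) * (J ^ (1 / 4 : ℝ) * X ^ (3 / 4 : ℝ)) := by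
        rw [← mul_assoc, ← Real.rpow_add hJ]; norm_num
    _ ≤ J ^ (3 / 4 : ℝ) * (P ^ (1 / 4 : ℝ) * P ^ (3 / 4 : ℝ)) := by gcongr
    _ = J ^ (3 / 4 : ℝ) * P := by rw [← Real.rpow_add hP]; norm_num

/-- The symbol of the null form `Q_{αβ}`, relative to the weights of its arguments. -/
def nullSym (α β : Fin 4) (η θ : SpaceTime) : ℝ :=
  |η α * θ β - η β * θ α| / (jap (freq η) * japPlus η * japPlus θ)

/-- The symbol of `Q_{ij}(Λ⁻¹ ·, Λ⁻¹ ·)`, relative to the weight of its first argument. -/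
def spatialNullSym (i j : Fin 3) (η θ : SpaceTime) : ℝ :=
  |η i.succ * θ j.succ - η j.succ * θ i.succ| / (jap (freq η) * jap (freq θ) * japPlus η)

lemma nullSymbol_nullSym (α β : Fin 4) : NullSymbol (nullSym α β) := by
  intro η θ
  have hN := abs_null_le η θ α β
  have hX := jap_pos (freq η)
  have hY := jap_pos (freq θ)
  have hJ := jap_pos (modul η)
  have hK := jap_pos (modul θ)
  have hP := japPlus_pos η
  have hR := japPlus_pos θ
  have hXP := jap_freq_le_japPlus η
  have hYR := jap_freq_le_japPlus θ
  have hS := dirSum_nonneg η θ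
  have h1 := div_le_rpow_mul_rpow hJ hX (jap_modul_le_japPlus η) hXP
  have h2 := div_le_rpow_mul_rpow hK hY (jap_modul_le_japPlus θ) hYR
  have e1 : jap (freq η) ^ (-(7 / 4) : ℝ) = jap (freq η) ^ (-(3 / 4) : ℝ) * (jap (freq η))⁻¹ := by
    rw [← Real.rpow_neg_one, ← Real.rpow_add hX]; norm_num
  have e2 : jap (freq η) ^ (-2 : ℝ) = (jap (freq η) * jap (freq η))⁻¹ := by
    rw [Real.rpow_neg hX.le]; congr 1; rw [← sq]; exact_mod_cast Real.rpow_natCast _ 2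
  have b1 : |(|η 0| - ‖spt η‖)| ≤ jap (modul η) := abs_le_jap _
  have b2 : |(|θ 0| - ‖spt θ‖)| ≤ jap (modul θ) := abs_le_jap _
  have b3 := norm_spt_le_japPlus η
  have b4 := norm_spt_le_japPlus θ
  rw [e1, e2, Real.rpow_neg_one, Real.rpow_neg_one, nullSym]
  generalize jap (freq η) = X at *
  generalize jap (freq θ) = Y at *
  generalize jap (modul η) = J at *
  generalize jap (modul θ) = K at *
  generalize japPlus η = P at *
  generalize japPlus θ = R at *
  calc |η α * θ β - η β * θ α| / (X * P * R)
      ≤ (‖spt η‖ * ‖spt θ‖ * dirSum η θ + J * R + K * P) / (X * P * R) := by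
        gcongr
        refine hN.trans ?_
        gcongr
    _ = ‖spt η‖ * ‖spt θ‖ * dirSum η θ * ((X * P)⁻¹ * R⁻¹) + J / P * X⁻¹ + K / R * X⁻¹ := by
        field_simp
    _ ≤ ‖spt η‖ * ‖spt θ‖ * dirSum η θ * ((X * X)⁻¹ * Y⁻¹) +
          J ^ (3 / 4 : ℝ) * X ^ (-(3 / 4) : ℝ) * X⁻¹ +
          K ^ (3 / 4 : ℝ) * Y ^ (-(3 / 4) : ℝ) * X⁻¹ := by gcongr
    _ = _ := by ring

lemma nullSymbol_spatialNullSym (i j : Fin 3) : NullSymbol (spatialNullSym i j) := by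
  intro η θ
  have hN := abs_spatial_null_le η θ i j
  have hX := jap_pos (freq η)
  have hY := jap_pos (freq θ)
  have hJ := jap_pos (modul η)
  have hK := jap_pos (modul θ)
  have hP := japPlus_pos η
  have hXP := jap_freq_le_japPlus η
  have hS := dirSum_nonneg η θ
  have e2 : jap (freq η) ^ (-2 : ℝ) = (jap (freq η) * jap (freq η))⁻¹ := by
    rw [Real.rpow_neg hX.le]; congr 1; rw [← sq]; exact_mod_cast Real.rpow_natCast _ 2
  rw [add_assoc]
  refine le_add_of_le_of_nonneg ?_ (by positivity)
  rw [e2, Real.rpow_neg_one, spatialNullSym]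
  calc _ ≤ ‖spt η‖ * ‖spt θ‖ * dirSum η θ / (jap (freq η) * jap (freq θ) * japPlus η) := by gcongr
    _ = ‖spt η‖ * ‖spt θ‖ * dirSum η θ *
        ((jap (freq η) * japPlus η)⁻¹ * (jap (freq θ))⁻¹) := by field_simp
    _ ≤ _ := by gcongr

lemma nullSym_nonneg (α β : Fin 4) (η θ : SpaceTime) : 0 ≤ nullSym α β η θ :=
  div_nonneg (abs_nonneg _)
    (mul_pos (mul_pos (jap_pos _) (japPlus_pos _)) (japPlus_pos _)).le

lemma spatialNullSym_nonneg (i j : Fin 3) (η θ : SpaceTime) : 0 ≤ spatialNullSym i j η θ :=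
  div_nonneg (abs_nonneg _)
    (mul_pos (mul_pos (jap_pos _) (jap_pos _)) (japPlus_pos _)).le

section Wiener

variable {V E F : Type*} [NormedAddCommGroup V] [InnerProductSpace ℝ V] [FiniteDimensional ℝ V]
  [MeasurableSpace V] [BorelSpace V] [NormedAddCommGroup E] [NormedSpace ℂ E]
  [NormedAddCommGroup F] [InnerProductSpace ℝ F] [FiniteDimensional ℝ F]
  [MeasurableSpace F] [BorelSpace F]

/-- Continuous integrable functions with integrable inverse Fourier transform. -/
structure Wiener (h : V → E) : Prop where
  continuous : Continuous h
  integrable : Integrable h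
  integrable_inv : Integrable (𝓕⁻ h)

lemma fourierInv_add' {f g : V → E} (hf : Integrable f) (hg : Integrable g) :
    𝓕⁻ (f + g) = 𝓕⁻ f + 𝓕⁻ g := by
  ext x
  simp only [Real.fourierInv_eq, Pi.add_apply, smul_add]
  rw [integral_add]
  · simpa using (Real.fourierIntegral_convergent_iff (-x)).2 hf
  · simpa using (Real.fourierIntegral_convergent_iff (-x)).2 hg

lemma Wiener.add {f g : V → E} (hf : Wiener f) (hg : Wiener g) : Wiener (f + g) :=
  ⟨hf.1.add hg.1, hf.2.add hg.2, by
    rw [fourierInv_add' hf.2 hg.2]; exact hf.3.add hg.3⟩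

lemma Wiener.neg {f : V → E} (hf : Wiener f) : Wiener (-f) :=
  ⟨hf.1.neg, hf.2.neg, by
    have : 𝓕⁻ (-f) = -𝓕⁻ f := by
      ext x
      simp only [Real.fourierInv_eq, Pi.neg_apply, smul_neg, integral_neg]
    rw [this]; exact hf.3.neg⟩

lemma Wiener.sub {f g : V → E} (hf : Wiener f) (hg : Wiener g) : Wiener (f - g) := by
  rw [sub_eq_add_neg]; exact hf.add hg.neg

lemma wiener_schwartz [CompleteSpace E] (f : SchwartzMap V E) : Wiener f :=
  ⟨f.continuous, f.integrable, by
    rw [← SchwartzMap.fourierInv_coe]; exact (𝓕⁻ f).integrable⟩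

/-- Multiplication by the characteristic function of a finite measure preserves `Wiener`. -/
lemma Wiener.charFun_smul [CompleteSpace E] {Ω : Type*} [MeasurableSpace Ω] {μ : Measure Ω}
    [IsFiniteMeasure μ] {Y : Ω → V} (hY : Measurable Y) {h : V → E} (hh : Wiener h) {φ : V → ℂ} (hφc : Continuous φ)
    (hφ : ∀ ζ, φ ζ = ∫ ω, exp (⟪Y ω, ζ⟫ * I) ∂μ) : Wiener fun ζ => φ ζ • h ζ := by
  have hb : ∀ ζ, ‖φ ζ‖ ≤ μ.real Set.univ := fun ζ => by
    rw [hφ]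
    refine (norm_integral_le_of_norm_le_const (C := 1) (.of_forall fun ω => ?_)).trans_eq
      (one_mul _)
    rw [norm_exp_ofReal_mul_I]
  have hi : Integrable fun ζ => φ ζ • h ζ :=
    hh.2.bdd_smul (μ.real Set.univ) hφc.aestronglyMeasurable (.of_forall hb)
  refine ⟨hφc.smul hh.1, hi, ?_⟩
  have hHc : Continuous (𝓕⁻ h) := by
    have : 𝓕⁻ h = fun x => 𝓕 h (-x) := by ext x; exact Real.fourierInv_eq_fourier_neg _ _
    rw [this]
    exact (VectorFourier.fourierIntegral_continuous Real.continuous_fourierChar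
      (by exact continuous_inner) hh.2).comp continuous_neg
  have key : 𝓕⁻ (fun ζ => φ ζ • h ζ) = fun x => ∫ ω, 𝓕⁻ h (x + (2 * Real.pi)⁻¹ • Y ω) ∂μ := by
    ext x
    simp only [Real.fourierInv_eq, hφ]
    rw [integral_integral_swap]
    · refine integral_congr_ae (.of_forall fun ζ => ?_)
      simp only [Circle.smul_def, Real.fourierChar_apply]
      rw [← integral_smul_const, ← integral_smul]
      refine integral_congr_ae (.of_forall fun ω => ?_)
      simp only [smul_smul, ← Complex.exp_add]
      congr 2
      rw [inner_add_right, real_inner_smul_right, real_inner_comm (Y ω)]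
      have : (Real.pi : ℂ) ≠ 0 := by exact_mod_cast Real.pi_ne_zero
      push_cast
      field_simp
    · have hm : Measurable fun p : Ω × V => ⟪p.2, x + (2 * Real.pi)⁻¹ • Y p.1⟫ := by fun_prop
      refine Integrable.bdd_smul ?_ 1 ?_ ?_
      · exact hh.2.comp_snd μ
      · exact (continuous_subtype_val.comp Real.continuous_fourierChar).comp_aestronglyMeasurable
          hm.aestronglyMeasurable
      · exact .of_forall fun p => (Circle.norm_coe _).le
  rw [key]
  obtain ⟨H, hH⟩ : ∃ H, H = 𝓕⁻ h := ⟨_, rfl⟩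
  have hHi : Integrable H := hH ▸ hh.3
  rw [← hH] at hHc ⊢
  have : Integrable (fun p : V × Ω => H (p.1 + (2 * Real.pi)⁻¹ • Y p.2)) (volume.prod μ) := by
    have hm : AEStronglyMeasurable (fun p : V × Ω => H (p.1 + (2 * Real.pi)⁻¹ • Y p.2))
        (volume.prod μ) := hHc.comp_aestronglyMeasurable
      (measurable_fst.add ((hY.comp measurable_snd).const_smul _)).aestronglyMeasurable
    rw [integrable_prod_iff' hm]
    refine ⟨.of_forall fun ω => hHi.comp_add_right ((2 * Real.pi)⁻¹ • Y ω), ?_⟩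
    have : ∀ ω, ∫ x, ‖H (x + (2 * Real.pi)⁻¹ • Y ω)‖ = ∫ x, ‖H x‖ := fun ω =>
      integral_add_right_eq_self (fun x => ‖H x‖) _
    simp only [this]
    exact integrable_const _
  exact this.integral_prod_left

open ProbabilityTheory in
lemma charFun_mixture (t : F) :
    ∫ ω : ℝ × ℝ × F, exp (⟪(ω.2.1 / ω.1) • ω.2.2, t⟫ * I)
      ∂((volume.restrict (Set.Ioc 0 1)).prod ((gaussianReal 0 1).prod (stdGaussian F)))
      = ((√(1 + ‖t‖ ^ 2) - ‖t‖ : ℝ) : ℂ) := by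
  have h_int : ∀ (μ : Measure (ℝ × ℝ × F)) [IsFiniteMeasure μ], Integrable
      (fun ω : ℝ × ℝ × F => exp (⟪(ω.2.1 / ω.1) • ω.2.2, t⟫ * I)) μ := fun μ _ =>
    Integrable.of_bound (C := 1) (by fun_prop) (.of_forall fun ω => by
      rw [norm_exp_ofReal_mul_I])
  rw [integral_prod _ (h_int _)]
  have h1 : ∀ v : ℝ, ∫ y : ℝ × F, exp (⟪(y.1 / v) • y.2, t⟫ * I)
      ∂((gaussianReal 0 1).prod (stdGaussian F)) =
      (((1 + (‖t‖ / v) ^ 2) ^ (-(1 / 2) : ℝ) : ℝ) : ℂ) := by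
    intro v
    rw [integral_prod _ (Integrable.of_bound (C := 1) (by fun_prop) (.of_forall fun ω => by
      rw [norm_exp_ofReal_mul_I]))]
    have : ∀ q : ℝ, ∫ z : F, exp (⟪(q / v) • z, t⟫ * I) ∂(stdGaussian F) =
        ((Real.exp (-(q * (‖t‖ / v)) ^ 2 / 2) : ℝ) : ℂ) := fun q => by
      have := charFun_stdGaussian (E := F) ((q / v) • t)
      rw [charFun_apply] at this
      simp only [real_inner_smul_left]
      simp only [real_inner_smul_right] at this
      rw [this, norm_smul]
      push_cast
      congr 1
      have : ((‖q / v‖ : ℝ) : ℂ) ^ 2 = ((q / v : ℝ) : ℂ) ^ 2 := by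
        norm_cast; rw [Real.norm_eq_abs, sq_abs]
      rw [mul_pow, this]; push_cast; ring
    simp only [this]
    rw [integral_complex_ofReal]
    congr 1
    rw [integral_gaussianReal_eq_integral_smul (by norm_num)]
    have : ∀ q : ℝ, gaussianPDFReal 0 1 q • Real.exp (-(q * (‖t‖ / v)) ^ 2 / 2) =
        (√(2 * Real.pi))⁻¹ * Real.exp (-((1 + (‖t‖ / v) ^ 2) / 2) * q ^ 2) := fun q => by
      simp only [gaussianPDFReal, smul_eq_mul, NNReal.coe_one, mul_one, sub_zero]
      rw [mul_assoc, ← Real.exp_add]; congr 2; ring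
    simp only [this]
    rw [integral_const_mul, integral_gaussian, Real.rpow_neg (by positivity), ← Real.sqrt_eq_rpow,
      ← Real.sqrt_inv, ← Real.sqrt_inv, ← Real.sqrt_mul (by positivity)]
    congr 1
    have := Real.pi_pos
    have : 0 < 1 + (‖t‖ / v) ^ 2 := by positivity
    field_simp
  simp only [h1]
  rw [integral_complex_ofReal]
  congr 1
  rw [← intervalIntegral.integral_of_le zero_le_one]
  have hc : ContinuousOn (fun v : ℝ => √(v ^ 2 + ‖t‖ ^ 2)) (Set.Icc 0 1) := by fun_prop
  have hd : ∀ v ∈ Set.Ioo (0 : ℝ) 1, HasDerivAt (fun v : ℝ => √(v ^ 2 + ‖t‖ ^ 2))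
      ((1 + (‖t‖ / v) ^ 2) ^ (-(1 / 2) : ℝ)) v := by
    intro v hv
    have hv0 : 0 < v := hv.1
    have := (((hasDerivAt_pow 2 v).add_const (‖t‖ ^ 2)).sqrt (by positivity))
    convert this using 1
    rw [Real.rpow_neg (by positivity), ← Real.sqrt_eq_rpow]
    have e : v ^ 2 + ‖t‖ ^ 2 = (1 + (‖t‖ / v) ^ 2) * v ^ 2 := by field_simp
    rw [e, Real.sqrt_mul (by positivity), Real.sqrt_sq hv0.le]
    have : 0 < √(1 + (‖t‖ / v) ^ 2) := by positivity
    field_simp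
    norm_num [mul_comm]
  rw [intervalIntegral.integral_eq_sub_of_hasDerivAt_of_le zero_le_one hc hd]
  · simp [Real.sqrt_sq]
  · rw [intervalIntegrable_iff_integrableOn_Ioc_of_le zero_le_one]
    exact intervalIntegral.integrableOn_deriv_of_nonneg hc hd fun v hv => by positivity

end Wiener

section Wiener

variable {V E F : Type*} [NormedAddCommGroup V] [InnerProductSpace ℝ V] [FiniteDimensional ℝ V]
  [MeasurableSpace V] [BorelSpace V] [NormedAddCommGroup E] [NormedSpace ℂ E] [CompleteSpace E]
  [NormedAddCommGroup F] [InnerProductSpace ℝ F] [FiniteDimensional ℝ F]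

open ProbabilityTheory in
lemma Wiener.sqrt_sub_norm_smul {h : V → E} (hh : Wiener h) (L : V →L[ℝ] F) :
    Wiener fun ζ => ((√(1 + ‖L ζ‖ ^ 2) - ‖L ζ‖ : ℝ) : ℂ) • h ζ := by
  borelize F
  refine hh.charFun_smul (μ := (volume.restrict (Set.Ioc (0 : ℝ) 1)).prod
    ((gaussianReal 0 1).prod (stdGaussian F)))
    (Y := fun ω => L.adjoint ((ω.2.1 / ω.1) • ω.2.2)) ?_ ?_ ?_
  · exact L.adjoint.continuous.measurable.comp (by fun_prop)
  · fun_prop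
  · intro ζ
    rw [← charFun_mixture]
    simp only [ContinuousLinearMap.adjoint_inner_left]

end Wiener

section Symbols

variable {V E : Type*} [NormedAddCommGroup V] [InnerProductSpace ℝ V]
  [NormedAddCommGroup E] [NormedSpace ℂ E]

lemma temperate_ofReal {f : V → ℝ} (hf : f.HasTemperateGrowth) :
    Function.HasTemperateGrowth fun ζ => (f ζ : ℂ) :=
  Function.Complex.hasTemperateGrowth_ofReal.comp hf

lemma temperate_sum_sq_rpow {ι : Type*} [Fintype ι] {f : ι → V → ℝ}
    (hf : ∀ i, (f i).HasTemperateGrowth) (r : ℝ) :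
    Function.HasTemperateGrowth fun ζ => (1 + ∑ i, f i ζ ^ 2) ^ r := by
  classical
  have h : Function.HasTemperateGrowth
      fun ζ => ∑ i, f i ζ • (EuclideanSpace.single i (1 : ℝ) : EuclideanSpace ℝ ι) :=
    .sum fun i _ => (hf i).smul (.const _)
  have := (Function.hasTemperateGrowth_one_add_norm_sq_rpow (EuclideanSpace ℝ ι) r).comp h
  have e : ∀ ζ, ∑ i, f i ζ ^ 2 =
      ‖∑ i, f i ζ • (EuclideanSpace.single i (1 : ℝ) : EuclideanSpace ℝ ι)‖ ^ 2 := fun ζ => by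
    rw [EuclideanSpace.real_norm_sq_eq]
    refine Finset.sum_congr rfl fun i _ => ?_
    simp [Pi.single_apply]
  simp only [e]
  exact this

lemma temperate_norm_rpow {F : Type*} [NormedAddCommGroup F] [InnerProductSpace ℝ F]
    (L : V →L[ℝ] F) (r : ℝ) : Function.HasTemperateGrowth fun ζ => (1 + ‖L ζ‖ ^ 2) ^ r :=
  (Function.hasTemperateGrowth_one_add_norm_sq_rpow F r).comp L.hasTemperateGrowth

/-- Multiplication of a Schwartz function by a real symbol of temperate growth. -/
lemma exists_schwartz_smul {f : V → ℝ} (hf : f.HasTemperateGrowth) (u : SchwartzMap V E) :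
    ∃ v : SchwartzMap V E, ∀ ζ, v ζ = (f ζ : ℂ) • u ζ :=
  ⟨SchwartzMap.smulLeftCLM E (fun ζ => (f ζ : ℂ)) u, fun ζ =>
    SchwartzMap.smulLeftCLM_apply_apply (temperate_ofReal hf) u ζ⟩

end Symbols

section Wiener

variable {V E F F' : Type*} [NormedAddCommGroup V] [InnerProductSpace ℝ V] [FiniteDimensional ℝ V]
  [MeasurableSpace V] [BorelSpace V] [NormedAddCommGroup E] [NormedSpace ℂ E] [CompleteSpace E]
  [NormedAddCommGroup F] [InnerProductSpace ℝ F] [FiniteDimensional ℝ F]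
  [NormedAddCommGroup F'] [InnerProductSpace ℝ F'] [FiniteDimensional ℝ F']

lemma wiener_norm_mul_norm_smul (f : SchwartzMap V E) (L : V →L[ℝ] F) (M : V →L[ℝ] F') :
    Wiener fun ζ => ((‖L ζ‖ * ‖M ζ‖ : ℝ) : ℂ) • f ζ := by
  obtain ⟨g, hg⟩ := exists_schwartz_smul (temperate_norm_rpow L (1 / 2)) f
  obtain ⟨h, hh⟩ := exists_schwartz_smul (temperate_norm_rpow M (1 / 2)) f
  obtain ⟨k, hk⟩ := exists_schwartz_smul (temperate_norm_rpow M (1 / 2)) g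
  have := (((wiener_schwartz k).sub ((wiener_schwartz h).sqrt_sub_norm_smul L)).sub
    ((wiener_schwartz g).sqrt_sub_norm_smul M)).add
    (((wiener_schwartz f).sqrt_sub_norm_smul L).sqrt_sub_norm_smul M)
  convert this using 1
  ext ζ
  simp only [Pi.add_apply, Pi.sub_apply, hk, hg, hh, ← Real.sqrt_eq_rpow, smul_smul, ← sub_smul,
    ← add_smul]
  congr 1
  push_cast
  ring

end Wiener

section LamPlus

variable {E : Type*} [NormedAddCommGroup E] [NormedSpace ℂ E] [CompleteSpace E]

/-- The spatial projection as a continuous linear map. -/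
def sptL : SpaceTime →L[ℝ] Space :=
  LinearMap.toContinuousLinearMap
    { toFun := spt, map_add' := fun _ _ => rfl, map_smul' := fun _ _ => rfl }

@[simp] lemma sptL_apply (ζ : SpaceTime) : sptL ζ = spt ζ := rfl

lemma temperate_coord (μ : Fin 4) : Function.HasTemperateGrowth fun ζ : SpaceTime => ζ μ :=
  (EuclideanSpace.proj (𝕜 := ℝ) μ).hasTemperateGrowth

/-- Components of an auxiliary map used to split `⟨|τ|+|ξ|⟩` into smooth and singular parts. -/
def auxComp : Option (Fin 4) → SpaceTime → ℝ
  | none => fun ζ => ζ 0 ^ 2 - ‖spt ζ‖ ^ 2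
  | some μ => fun ζ => √2 * ζ μ

/-- Components of an auxiliary map used to split `⟨|τ|+|ξ|⟩` into smooth and singular parts. -/
def auxComp' : Option (Option (Fin 4)) → SpaceTime → ℝ
  | none => fun _ => 1
  | some none => fun ζ => √2 * (1 + ∑ i, auxComp i ζ ^ 2) ^ (1 / 4 : ℝ)
  | some (some μ) => fun ζ => √2 * ζ μ

lemma temperate_auxComp' (r : ℝ) :
    Function.HasTemperateGrowth fun ζ => (1 + ∑ i, auxComp' i ζ ^ 2) ^ r := by
  have h2 : ∀ μ, Function.HasTemperateGrowth fun ζ : SpaceTime => √2 * ζ μ := fun μ =>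
    (Function.HasTemperateGrowth.const _).mul (temperate_coord μ)
  refine temperate_sum_sq_rpow (fun i => ?_) r
  match i with
  | none => exact .const _
  | some (some μ) => exact h2 μ
  | some none =>
    refine (Function.HasTemperateGrowth.const _).mul (temperate_sum_sq_rpow (fun i => ?_) _)
    match i with
    | some μ => exact h2 μ
    | none =>
      exact ((temperate_coord 0).pow 2).sub
        ((Function.hasTemperateGrowth_norm_sq Space).comp sptL.hasTemperateGrowth)

lemma jap_plus_eq (ζ : SpaceTime) : jap (|ζ 0| + ‖spt ζ‖) =
    1 / 2 * (1 + ∑ i, auxComp' i ζ ^ 2) ^ (1 / 2 : ℝ) +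
      |ζ 0| * ‖spt ζ‖ * (2 * (1 + ∑ i, auxComp' i ζ ^ 2) ^ (-(1 / 2) : ℝ)) := by
  obtain ⟨x, hx⟩ : ∃ x, x = |ζ 0| := ⟨_, rfl⟩
  obtain ⟨y, hy⟩ : ∃ y, y = ‖spt ζ‖ := ⟨_, rfl⟩
  have hx2 : ζ 0 ^ 2 = x ^ 2 := by rw [hx, sq_abs]
  have hy2 : ζ 1 ^ 2 + ζ 2 ^ 2 + ζ 3 ^ 2 = y ^ 2 := by
    rw [hy, EuclideanSpace.real_norm_sq_eq, Fin.sum_univ_three]; rfl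
  have s2 : √2 ^ 2 = (2 : ℝ) := Real.sq_sqrt (by norm_num)
  have e1 : 1 + ∑ i, auxComp i ζ ^ 2 = (1 + (x + y) ^ 2) * (1 + (x - y) ^ 2) := by
    simp only [Fintype.sum_option, auxComp, Fin.sum_univ_four, mul_pow, s2, ← hy, hx2]
    linear_combination 2 * hy2
  obtain ⟨P, hP⟩ : ∃ P, P = √(1 + (x + y) ^ 2) := ⟨_, rfl⟩
  obtain ⟨R, hR⟩ : ∃ R, R = √(1 + (x - y) ^ 2) := ⟨_, rfl⟩
  have hP0 : 0 < P := by rw [hP]; positivity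
  have hR0 : 0 < R := by rw [hR]; positivity
  have hP2 : P ^ 2 = 1 + (x + y) ^ 2 := by rw [hP, Real.sq_sqrt (by positivity)]
  have hR2 : R ^ 2 = 1 + (x - y) ^ 2 := by rw [hR, Real.sq_sqrt (by positivity)]
  have e2 : ((1 + ∑ i, auxComp i ζ ^ 2) ^ (1 / 4 : ℝ)) ^ 2 = P * R := by
    rw [e1, ← hP2, ← hR2, ← mul_pow, ← Real.rpow_natCast, ← Real.rpow_natCast, ← Real.rpow_mul
      (by positivity), ← Real.rpow_mul (by positivity)]
    norm_num
  have e3 : 1 + ∑ i, auxComp' i ζ ^ 2 = (P + R) ^ 2 := by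
    rw [Fintype.sum_option, Fintype.sum_option]
    simp only [auxComp', mul_pow, e2, s2, Fin.sum_univ_four, hx2]
    linear_combination 2 * hy2 - hP2 - hR2
  rw [e3, Real.rpow_neg (by positivity), ← Real.sqrt_eq_rpow, Real.sqrt_sq (by positivity), jap,
    ← hx, ← hy, ← hP]
  field_simp
  linear_combination hP2 - hR2

lemma wiener_jap_plus_smul (f : SchwartzMap SpaceTime E) :
    Wiener fun ζ => ((jap (|ζ 0| + ‖spt ζ‖) : ℝ) : ℂ) • f ζ := by
  obtain ⟨g, hg⟩ := exists_schwartz_smul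
    ((Function.HasTemperateGrowth.const (1 / 2 : ℝ)).mul (temperate_auxComp' (1 / 2))) f
  obtain ⟨k, hk⟩ := exists_schwartz_smul
    ((Function.HasTemperateGrowth.const (2 : ℝ)).mul (temperate_auxComp' (-(1 / 2)))) f
  have := (wiener_schwartz g).add
    (wiener_norm_mul_norm_smul k (EuclideanSpace.proj (𝕜 := ℝ) (0 : Fin 4)) sptL)
  convert this using 1
  ext ζ
  rw [Pi.add_apply, hg, hk, jap_plus_eq, smul_smul, ← add_smul]
  congr 1
  push_cast
  simp

lemma Wiener.fourier_fourierInv {h : SpaceTime → E} (hh : Wiener h) : 𝓕 (𝓕⁻ h) = h := by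
  refine hh.1.fourier_fourierInv_eq hh.2 ?_
  have : 𝓕 h = fun x => 𝓕⁻ h (-x) := by
    ext x
    rw [Real.fourierInv_eq_fourier_neg, neg_neg]
  rw [this]
  exact hh.3.comp_neg

lemma FT_LamPlus_one (u : SchwartzMap SpaceTime E) (ζ : SpaceTime) :
    FT (LamPlus 1 u) ζ = ((jap (|ζ 0| + ‖spt ζ‖) : ℝ) : ℂ) • FT u ζ := by
  have h := wiener_jap_plus_smul (𝓕 u)
  have := congrFun h.fourier_fourierInv ζ
  simp only [LamPlus, rmult, mult, FT, Real.rpow_one]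
  exact this

end LamPlus

section Decay

variable {E : Type*} [NormedAddCommGroup E] [NormedSpace ℂ E]

/-- Continuous weights of at most polynomial growth. -/
structure Slow (m : SpaceTime → ℝ) : Prop where
  continuous : Continuous m
  growth : ∃ (k : ℕ) (C : ℝ), ∀ ζ, |m ζ| ≤ C * (1 + ‖ζ‖) ^ k

/-- Continuous functions decaying faster than every power. -/
structure Rapid (f : SpaceTime → E) : Prop where
  continuous : Continuous f
  decay : ∀ k : ℕ, ∃ C : ℝ, ∀ ζ, (1 + ‖ζ‖) ^ k * ‖f ζ‖ ≤ C

lemma Slow.mul {m m' : SpaceTime → ℝ} (h : Slow m) (h' : Slow m') : Slow fun ζ => m ζ * m' ζ := by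
  obtain ⟨k, C, hC⟩ := h.2
  obtain ⟨l, D, hD⟩ := h'.2
  refine ⟨h.1.mul h'.1, k + l, C * D, fun ζ => ?_⟩
  rw [abs_mul]
  calc |m ζ| * |m' ζ| ≤ (C * (1 + ‖ζ‖) ^ k) * (D * (1 + ‖ζ‖) ^ l) :=
        mul_le_mul (hC ζ) (hD ζ) (abs_nonneg _) ((abs_nonneg _).trans (hC ζ))
    _ = _ := by ring

lemma Slow.rapid_smul {m : SpaceTime → ℝ} (hm : Slow m) {f : SpaceTime → E} (hf : Rapid f) :
    Rapid fun ζ => (m ζ : ℂ) • f ζ := by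
  obtain ⟨k, C, hC⟩ := hm.2
  refine ⟨(continuous_ofReal.comp hm.1).smul hf.1, fun l => ?_⟩
  obtain ⟨D, hD⟩ := hf.2 (k + l)
  have hC0 : 0 ≤ C := by
    have := (abs_nonneg _).trans (hC 0)
    simpa using this
  refine ⟨C * D, fun ζ => ?_⟩
  rw [norm_smul, norm_real, Real.norm_eq_abs]
  calc (1 + ‖ζ‖) ^ l * (|m ζ| * ‖f ζ‖) ≤ (1 + ‖ζ‖) ^ l * ((C * (1 + ‖ζ‖) ^ k) * ‖f ζ‖) := by
        gcongr; exact hC ζ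
    _ = C * ((1 + ‖ζ‖) ^ (k + l) * ‖f ζ‖) := by ring
    _ ≤ C * D := by gcongr; exact hD ζ

omit [NormedSpace ℂ E] in
lemma Rapid.of_le {f : SpaceTime → E} {g : SpaceTime → E} (hf : Rapid f) (hg : Continuous g)
    (h : ∀ ζ, ‖g ζ‖ ≤ ‖f ζ‖) : Rapid g :=
  ⟨hg, fun k => (hf.2 k).imp fun _ hC ζ => le_trans (by gcongr; exact h ζ) (hC ζ)⟩

omit [NormedSpace ℂ E] in
lemma Rapid.exists_norm_le {f : SpaceTime → E} (hf : Rapid f) :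
    ∃ C : ℝ, ∀ ζ, ‖f ζ‖ ≤ C * (1 + ‖ζ‖ ^ 2) ^ (-(6 : ℝ) / 2) := by
  obtain ⟨C, hC⟩ := hf.2 6
  refine ⟨C, fun ζ => ?_⟩
  have e : (1 + ‖ζ‖ ^ 2) ^ (-(6 : ℝ) / 2) = ((1 + ‖ζ‖ ^ 2) ^ 3)⁻¹ := by
    rw [neg_div, Real.rpow_neg (by positivity)]
    congr 1
    norm_num
  rw [e, ← div_eq_mul_inv, le_div_iff₀ (by positivity)]
  refine le_trans ?_ (hC ζ)
  rw [mul_comm]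
  have : (1 + ‖ζ‖) ^ 6 = ((1 + ‖ζ‖) ^ 2) ^ 3 := by ring
  rw [this]
  gcongr
  nlinarith [norm_nonneg ζ]

omit [NormedSpace ℂ E] in
lemma Rapid.integrable {f : SpaceTime → E} (hf : Rapid f) : Integrable f := by
  obtain ⟨C, hC⟩ := hf.exists_norm_le
  refine ((integrable_rpow_neg_one_add_norm_sq (E := SpaceTime) (r := 6) ?_).const_mul C).mono'
    hf.1.aestronglyMeasurable (.of_forall hC)
  rw [finrank_euclideanSpace_fin]; norm_num

lemma Rapid.nl2_ne_top {f : SpaceTime → E} (hf : Rapid f) : nl2 (fun ζ => ‖f ζ‖ₑ) ≠ ⊤ := by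
  obtain ⟨C, hC⟩ := hf.2 0
  have : Rapid fun ζ => ((‖f ζ‖ : ℝ) : ℂ) • f ζ :=
    Slow.rapid_smul ⟨hf.1.norm, 0, C, fun ζ => by simpa using hC ζ⟩ hf
  have := this.integrable.2
  rw [hasFiniteIntegral_iff_enorm] at this
  unfold nl2
  refine (ENNReal.rpow_lt_top_of_nonneg (by norm_num) (ne_of_lt (lt_of_eq_of_lt ?_ this))).ne
  refine lintegral_congr fun ζ => ?_
  rw [enorm_smul, sq]
  congr 1
  change ‖f ζ‖ₑ = _
  rw [← ofReal_norm, ← ofReal_norm, norm_real, norm_norm]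

lemma schwartz_rapid (f : SchwartzMap SpaceTime E) : Rapid f := by
  refine ⟨f.continuous, fun k => ?_⟩
  have h := f.decay
  choose D hD using fun j => f.decay j 0
  simp only [norm_iteratedFDeriv_zero] at hD
  refine ⟨∑ j ∈ Finset.range (k + 1), D j * (k.choose j : ℝ), fun ζ => ?_⟩
  rw [add_comm, add_pow, Finset.sum_mul]
  refine Finset.sum_le_sum fun j _ => ?_
  have := (hD j).2 ζ
  calc ‖ζ‖ ^ j * 1 ^ (k - j) * (k.choose j : ℝ) * ‖f ζ‖ = ‖ζ‖ ^ j * ‖f ζ‖ * (k.choose j : ℝ) := by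
        ring
    _ ≤ _ := by gcongr

lemma slow_jap_rpow {g : SpaceTime → ℝ} (hg : Continuous g) (h : ∀ ζ, |g ζ| ≤ 2 * ‖ζ‖) (r : ℝ) :
    Slow fun ζ => jap (g ζ) ^ r := by
  have hc : Continuous fun ζ => jap (g ζ) := by unfold jap; fun_prop
  refine ⟨hc.rpow_const fun ζ => .inl (jap_pos _).ne', ?_⟩
  obtain ⟨k, hk⟩ := exists_nat_ge r
  refine ⟨k, 2 ^ k, fun ζ => ?_⟩
  rw [abs_of_nonneg (Real.rpow_nonneg (jap_pos _).le _), ← mul_pow]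
  calc jap (g ζ) ^ r ≤ jap (g ζ) ^ (k : ℝ) := Real.rpow_le_rpow_of_exponent_le (one_le_jap _) hk
    _ = jap (g ζ) ^ k := Real.rpow_natCast _ _
    _ ≤ _ := by
      gcongr
      · exact (jap_pos _).le
      · rw [jap, Real.sqrt_le_left (by positivity)]
        have := h ζ
        have h2 : g ζ ^ 2 ≤ (2 * ‖ζ‖) ^ 2 := by rw [← sq_abs]; gcongr
        nlinarith [norm_nonneg ζ]

lemma norm_spt_le (ζ : SpaceTime) : ‖spt ζ‖ ≤ ‖ζ‖ := by
  refine le_of_sq_le_sq ?_ (norm_nonneg _)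
  rw [norm_spt_sq, EuclideanSpace.real_norm_sq_eq, Fin.sum_univ_four]
  nlinarith [sq_nonneg (ζ 0)]

lemma continuous_spt : Continuous spt := sptL.continuous

lemma slow_freq (r : ℝ) : Slow fun ζ => jap (freq ζ) ^ r := by
  refine slow_jap_rpow continuous_spt.norm (fun ζ => ?_) r
  rw [abs_norm]; linarith [norm_spt_le ζ, norm_nonneg ζ]

lemma slow_modul (r : ℝ) : Slow fun ζ => jap (modul ζ) ^ r := by
  refine slow_jap_rpow ?_ (fun ζ => ?_) r
  · unfold modul; have := continuous_spt; fun_prop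
  · have h0 : |ζ 0| ≤ ‖ζ‖ := PiLp.norm_apply_le ζ 0
    rw [modul, abs_le]
    constructor <;> linarith [norm_spt_le ζ, norm_nonneg ζ, norm_nonneg (spt ζ), abs_nonneg (ζ 0)]

lemma slow_japPlus (r : ℝ) : Slow fun ζ => japPlus ζ ^ r := by
  refine slow_jap_rpow ?_ (fun ζ => ?_) r
  · have := continuous_spt; fun_prop
  · have h0 : |ζ 0| ≤ ‖ζ‖ := PiLp.norm_apply_le ζ 0
    rw [abs_of_nonneg (by positivity)]
    linarith [norm_spt_le ζ]

lemma slow_hWt (s b : ℝ) : Slow (hWt s b) := (slow_freq s).mul (slow_modul b)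

lemma continuous_FT (w : SpaceTime → E) : Continuous (FT w) := by
  by_cases h : Integrable w
  · exact VectorFourier.fourierIntegral_continuous Real.continuous_fourierChar
      (by exact continuous_inner) h
  · have : FT w = 0 := by
      ext ζ
      exact integral_undef fun h' => h ((Real.fourierIntegral_convergent_iff ζ).1 h')
    rw [this]; exact continuous_zero

lemma norm_FT_rmult_le [CompleteSpace E] {m : SpaceTime → ℝ} (hm : Slow m) {w : SpaceTime → E}
    (hw : Rapid (FT w)) (ζ : SpaceTime) : ‖FT (rmult m w) ζ‖ ≤ ‖(m ζ : ℂ) • FT w ζ‖ := by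
  have hr := hm.rapid_smul hw
  by_cases h : Integrable (𝓕⁻ fun ζ => (m ζ : ℂ) • FT w ζ)
  · have : Wiener fun ζ => (m ζ : ℂ) • FT w ζ := ⟨hr.1, hr.integrable, h⟩
    exact (congrArg norm (congrFun this.fourier_fourierInv ζ)).le
  · have : FT (rmult m w) ζ = 0 :=
      integral_undef fun h' => h ((Real.fourierIntegral_convergent_iff ζ).1 h')
    rw [this, norm_zero]; exact norm_nonneg _

lemma rapid_FT_rmult [CompleteSpace E] {m : SpaceTime → ℝ} (hm : Slow m) {w : SpaceTime → E}
    (hw : Rapid (FT w)) : Rapid (FT (rmult m w)) :=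
  (hm.rapid_smul hw).of_le (continuous_FT _) (norm_FT_rmult_le hm hw)

omit [NormedSpace ℂ E] in
lemma wnorm_eq_toReal_nl2 {W : SpaceTime → ℝ} (hW : Continuous W) (hW0 : ∀ ζ, 0 ≤ W ζ)
    {f : SpaceTime → E} (hf : Continuous f) :
    wnorm W f = (nl2 fun ζ => ENNReal.ofReal (W ζ) * ‖f ζ‖ₑ).toReal := by
  unfold wnorm nl2
  rw [integral_eq_lintegral_of_nonneg_ae (.of_forall fun ζ => sq_nonneg _)
    (by fun_prop : Continuous fun ζ => (W ζ * ‖f ζ‖) ^ 2).aestronglyMeasurable,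
    ENNReal.toReal_rpow]
  congr 2
  refine lintegral_congr fun ζ => ?_
  rw [ENNReal.ofReal_pow (mul_nonneg (hW0 ζ) (norm_nonneg _)), ENNReal.ofReal_mul (hW0 ζ),
    ofReal_norm]

lemma Slow.nl2_ne_top {W : SpaceTime → ℝ} (hW : Slow W) (hW0 : ∀ ζ, 0 ≤ W ζ)
    {f : SpaceTime → E} (hf : Rapid f) : nl2 (fun ζ => ENNReal.ofReal (W ζ) * ‖f ζ‖ₑ) ≠ ⊤ := by
  convert (hW.rapid_smul hf).nl2_ne_top using 3 with ζ
  rw [enorm_smul, ← ofReal_norm (W ζ : ℂ), norm_real, Real.norm_of_nonneg (hW0 ζ)]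

end Decay

section Products

variable {V E : Type*} [NormedAddCommGroup V] [InnerProductSpace ℝ V] [FiniteDimensional ℝ V]
  [MeasurableSpace V] [BorelSpace V] [NormedAddCommGroup E] [NormedSpace ℂ E] [CompleteSpace E]

omit [CompleteSpace E] in
open LineDeriv in
lemma exists_schwartz_pd (α : Fin 4) (u : SchwartzMap SpaceTime E) :
    ∃ w : SchwartzMap SpaceTime E, ⇑w = pd α u ∧
      ∀ ζ, FT w ζ = (2 * Real.pi * I * ζ α : ℂ) • FT u ζ := by
  refine ⟨∂_{(EuclideanSpace.single α 1 : SpaceTime)} u, ?_, fun ζ => ?_⟩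
  · ext x; exact SchwartzMap.lineDerivOp_apply_eq_fderiv _ _ _
  · have h : Function.HasTemperateGrowth fun ζ : SpaceTime =>
        ⟪ζ, (EuclideanSpace.single α 1 : SpaceTime)⟫ := by fun_prop
    change (𝓕 (∂_{(EuclideanSpace.single α 1 : SpaceTime)} u)) ζ = _
    rw [SchwartzMap.fourier_lineDerivOp_eq, smul_apply, SchwartzMap.smulLeftCLM_apply_apply h,
      mul_smul _ (ζ α : ℂ), EuclideanSpace.inner_single_right]
    simp [FT, SchwartzMap.fourier_coe]

lemma exists_schwartz_Lam (r : ℝ) (u : SchwartzMap SpaceTime E) :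
    ∃ w : SchwartzMap SpaceTime E, ⇑w = Lam r u ∧
      ∀ ζ, FT w ζ = ((jap (freq ζ) ^ r : ℝ) : ℂ) • FT u ζ := by
  obtain ⟨g, hg⟩ := exists_schwartz_smul (temperate_norm_rpow sptL (r / 2)) (𝓕 u)
  have e : ⇑g = fun ζ => ((jap (freq ζ) ^ r : ℝ) : ℂ) • FT u ζ := by
    ext ζ
    rw [hg, jap, Real.sqrt_eq_rpow, ← Real.rpow_mul (by positivity)]
    congr 3
    rw [one_div_mul_eq_div]
  refine ⟨𝓕⁻ g, ?_, fun ζ => ?_⟩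
  · rw [SchwartzMap.fourierInv_coe, e]; rfl
  · have : 𝓕 (𝓕⁻ g) ζ = g ζ := by rw [FourierTransform.fourier_fourierInv_eq]
    rw [← congrFun e ζ, ← this]; rfl

lemma fourier_pairing_apply (B : E →L[ℂ] E →L[ℂ] E) (f g : SchwartzMap V E) (ζ : V) :
    𝓕 (SchwartzMap.pairing B f g) ζ = ∫ η, B (𝓕 f η) (𝓕 g (ζ - η)) := by
  obtain ⟨c, hc⟩ : ∃ c, c = SchwartzMap.convolution B (𝓕 f) (𝓕 g) := ⟨_, rfl⟩
  have neg : ∀ (h : SchwartzMap V E) x, 𝓕 (𝓕 h) (-x) = h x := fun h x => by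
    have : 𝓕⁻ (𝓕 h) x = h x := by rw [FourierTransform.fourierInv_fourier_eq]
    rw [← this, SchwartzMap.fourierInv_apply_eq]; rfl
  have e : 𝓕⁻ c = SchwartzMap.pairing B f g := by
    ext x
    have : 𝓕⁻ c x = 𝓕 c (-x) := by rw [SchwartzMap.fourierInv_apply_eq]; rfl
    rw [this, hc, SchwartzMap.fourier_convolution, SchwartzMap.pairing_apply_apply, neg, neg,
      SchwartzMap.pairing_apply_apply]
  rw [← e, FourierTransform.fourier_fourierInv_eq, hc, SchwartzMap.convolution_apply]
  rfl

omit [CompleteSpace E] in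
lemma integrable_bilin_sub (B : E →L[ℂ] E →L[ℂ] E) (f g : SchwartzMap V E) (ζ : V) :
    Integrable fun η => B (f η) (g (ζ - η)) := by
  obtain ⟨C, hC⟩ := g.decay 0 0
  simp only [pow_zero, one_mul, norm_iteratedFDeriv_zero] at hC
  refine (f.integrable.norm.const_mul (‖B‖ * C)).mono' ?_ (.of_forall fun η => ?_)
  · have := f.continuous
    have := g.continuous
    exact (by fun_prop : Continuous fun η => B (f η) (g (ζ - η))).aestronglyMeasurable
  · calc ‖B (f η) (g (ζ - η))‖ ≤ ‖B‖ * ‖f η‖ * ‖g (ζ - η)‖ := B.le_opNorm₂ _ _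
      _ ≤ ‖B‖ * ‖f η‖ * C := by gcongr; exact hC.2 _
      _ = _ := by ring

/-- The null form `Q_{αβ}` built from a bilinear map. -/
def bilinNull (B : E →L[ℂ] E →L[ℂ] E) (α β : Fin 4) (u v : SpaceTime → E) : SpaceTime → E :=
  fun x => B (pd α u x) (pd β v x) - B (pd β u x) (pd α v x)

lemma FT_bilinNull (B : E →L[ℂ] E →L[ℂ] E) (α β : Fin 4) (u v : SchwartzMap SpaceTime E) :
    Rapid (FT (bilinNull B α β u v)) ∧ ∀ ζ, ‖FT (bilinNull B α β u v) ζ‖ₑ ≤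
      ENNReal.ofReal (4 * Real.pi ^ 2 * ‖B‖) * ∫⁻ η,
        ENNReal.ofReal |η α * (ζ - η) β - η β * (ζ - η) α| * (‖FT u η‖ₑ * ‖FT v (ζ - η)‖ₑ) := by
  obtain ⟨ua, hua, hua'⟩ := exists_schwartz_pd α u
  obtain ⟨ub, hub, hub'⟩ := exists_schwartz_pd β u
  obtain ⟨va, hva, hva'⟩ := exists_schwartz_pd α v
  obtain ⟨vb, hvb, hvb'⟩ := exists_schwartz_pd β v
  have e : bilinNull B α β u v =
      ⇑(SchwartzMap.pairing B ua vb - SchwartzMap.pairing B ub va) := by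
    ext x
    rw [sub_apply, SchwartzMap.pairing_apply_apply, SchwartzMap.pairing_apply_apply,
      hua, hub, hva, hvb]
    rfl
  rw [e]
  refine ⟨schwartz_rapid (𝓕 (SchwartzMap.pairing B ua vb - SchwartzMap.pairing B ub va)),
    fun ζ => ?_⟩
  have e2 : FT ⇑(SchwartzMap.pairing B ua vb - SchwartzMap.pairing B ub va) ζ =
      ∫ η, (B (FT ua η) (FT vb (ζ - η)) - B (FT ub η) (FT va (ζ - η))) := by
    refine Eq.trans ?_ (integral_sub (integrable_bilin_sub B (𝓕 ua) (𝓕 vb) ζ)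
      (integrable_bilin_sub B (𝓕 ub) (𝓕 va) ζ)).symm
    change 𝓕 (SchwartzMap.pairing B ua vb - SchwartzMap.pairing B ub va) ζ = _
    rw [← FourierTransform.fourierCLM_apply (R := ℂ), map_sub, FourierTransform.fourierCLM_apply,
      FourierTransform.fourierCLM_apply, sub_apply, fourier_pairing_apply,
      fourier_pairing_apply]
  rw [e2, ← lintegral_const_mul' _ _ ENNReal.ofReal_ne_top]
  refine (enorm_integral_le_lintegral_enorm _).trans (lintegral_mono fun η => ?_)
  rw [hua', hub', hva', hvb']
  simp only [map_smul, smul_apply, smul_smul, ← sub_smul]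
  rw [← ofReal_norm, ← ofReal_norm, ← ofReal_norm, ← ENNReal.ofReal_mul (norm_nonneg _),
    ← ENNReal.ofReal_mul (abs_nonneg _), ← ENNReal.ofReal_mul (by positivity)]
  refine ENNReal.ofReal_le_ofReal ?_
  rw [norm_smul]
  have e3 : ‖(2 * Real.pi * I * (ζ - η) β * (2 * Real.pi * I * η α) -
      2 * Real.pi * I * (ζ - η) α * (2 * Real.pi * I * η β) : ℂ)‖ =
      4 * Real.pi ^ 2 * |η α * (ζ - η) β - η β * (ζ - η) α| := by
    have : (2 * Real.pi * I * (ζ - η) β * (2 * Real.pi * I * η α) -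
      2 * Real.pi * I * (ζ - η) α * (2 * Real.pi * I * η β) : ℂ) =
      ((-(4 * Real.pi ^ 2 * (η α * (ζ - η) β - η β * (ζ - η) α)) : ℝ) : ℂ) := by
      push_cast
      linear_combination (4 * Real.pi ^ 2 * (η α * (ζ - η) β - η β * (ζ - η) α) : ℂ) * I_sq
    rw [this, norm_real, norm_neg, norm_mul, Real.norm_eq_abs, Real.norm_eq_abs,
      abs_of_nonneg (by positivity)]
  rw [e3]
  calc _ ≤ 4 * Real.pi ^ 2 * |η α * (ζ - η) β - η β * (ζ - η) α| *
        (‖B‖ * ‖FT u η‖ * ‖FT v (ζ - η)‖) := by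
        gcongr; exact B.le_opNorm₂ _ _
    _ = _ := by ring

end Products

/-- A trilinear bound yields a bilinear weighted `L²` bound by duality. -/
lemma TriBound.nl2_le {κ : SpaceTime → SpaceTime → ℝ≥0∞} {C : ℝ≥0∞} (h : TriBound κ C)
    (hκ : Measurable (Function.uncurry κ)) {K : SpaceTime → SpaceTime → ℝ≥0∞}
    {w₀ w₁ w₂ g f₁ f₂ : SpaceTime → ℝ≥0∞} {c : ℝ≥0∞}
    (hw₀ : Measurable w₀) (hw₁ : Measurable w₁) (hw₂ : Measurable w₂) (hg : Measurable g)
    (hf₁ : Measurable f₁) (hf₂ : Measurable f₂) (hc : c ≠ ⊤) (hw₀t : ∀ ζ, w₀ ζ ≠ ⊤)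
    (hK : ∀ η θ, w₀ (η + θ) * K η θ ≤ κ η θ * (w₁ η * w₂ θ))
    (hgK : ∀ ζ, g ζ ≤ c * ∫⁻ η, K η (ζ - η) * (f₁ η * f₂ (ζ - η)))
    (hfin : nl2 (fun ζ => w₀ ζ * g ζ) ≠ ⊤) :
    nl2 (fun ζ => w₀ ζ * g ζ) ≤
      c * C * nl2 (fun ζ => w₁ ζ * f₁ ζ) * nl2 (fun ζ => w₂ ζ * f₂ ζ) := by
  obtain ⟨G, hG⟩ : ∃ G, G = fun ζ => w₀ ζ * g ζ := ⟨_, rfl⟩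
  have hGm : Measurable G := hG ▸ hw₀.mul hg
  rw [← hG] at hfin ⊢
  obtain ⟨F₁, hF₁⟩ : ∃ F, F = fun ζ => w₁ ζ * f₁ ζ := ⟨_, rfl⟩
  obtain ⟨F₂, hF₂⟩ : ∃ F, F = fun ζ => w₂ ζ * f₂ ζ := ⟨_, rfl⟩
  have hF₁m : Measurable F₁ := hF₁ ▸ hw₁.mul hf₁
  have hF₂m : Measurable F₂ := hF₂ ▸ hw₂.mul hf₂
  rw [← hF₁, ← hF₂]
  have key : nl2 G * nl2 G ≤ nl2 G * (c * C * nl2 F₁ * nl2 F₂) := by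
    calc nl2 G * nl2 G = ∫⁻ ζ, G ζ ^ 2 := by rw [← sq, nl2_sq]
      _ ≤ ∫⁻ ζ, c * ∫⁻ η, G ζ * F₁ η * F₂ (ζ - η) * κ η (ζ - η) := by
        refine lintegral_mono fun ζ => ?_
        calc G ζ ^ 2 = G ζ * w₀ ζ * g ζ := by rw [hG]; ring
          _ ≤ G ζ * w₀ ζ * (c * ∫⁻ η, K η (ζ - η) * (f₁ η * f₂ (ζ - η))) := by
            gcongr; exact hgK ζ
          _ = c * (G ζ * (w₀ ζ * ∫⁻ η, K η (ζ - η) * (f₁ η * f₂ (ζ - η)))) := by ring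
          _ ≤ c * (G ζ * ∫⁻ η, F₁ η * F₂ (ζ - η) * κ η (ζ - η)) := by
            rw [← lintegral_const_mul' _ _ (hw₀t ζ)]
            refine mul_le_mul_right (mul_le_mul_right (lintegral_mono fun η => ?_) _) _
            have := hK η (ζ - η)
            rw [add_sub_cancel] at this
            rw [hF₁, hF₂]
            calc w₀ ζ * (K η (ζ - η) * (f₁ η * f₂ (ζ - η)))
                = (w₀ ζ * K η (ζ - η)) * (f₁ η * f₂ (ζ - η)) := by ring
              _ ≤ κ η (ζ - η) * (w₁ η * w₂ (ζ - η)) * (f₁ η * f₂ (ζ - η)) := by gcongr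
              _ = _ := by ring
          _ ≤ c * ∫⁻ η, G ζ * (F₁ η * F₂ (ζ - η) * κ η (ζ - η)) := by
            gcongr; exact lintegral_const_mul_le _ _
          _ = _ := by simp only [mul_assoc]
      _ = c * ∫⁻ ζ, ∫⁻ η, G ζ * F₁ η * F₂ (ζ - η) * κ η (ζ - η) := lintegral_const_mul' _ _ hc
      _ = c * ∫⁻ η, ∫⁻ ζ, G ζ * F₁ η * F₂ (ζ - η) * κ η (ζ - η) := by
        rw [lintegral_lintegral_swap]
        have hsub : Measurable fun p : SpaceTime × SpaceTime => p.1 - p.2 :=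
          measurable_fst.sub measurable_snd
        have : Measurable fun p : SpaceTime × SpaceTime => κ p.2 (p.1 - p.2) :=
          hκ.comp (measurable_snd.prodMk hsub)
        exact (((hGm.comp measurable_fst).mul (hF₁m.comp measurable_snd)).mul
          (hF₂m.comp hsub) |>.mul this).aemeasurable
      _ = c * ∫⁻ η, ∫⁻ θ, G (η + θ) * F₁ η * F₂ θ * κ η θ := by
        congr 1
        refine lintegral_congr fun η => ?_
        rw [← lintegral_add_left_eq_self _ η]
        simp only [add_sub_cancel_left]
      _ ≤ c * (C * (nl2 G * nl2 F₁ * nl2 F₂)) := by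
        gcongr; exact h G F₁ F₂ hGm hF₁m hF₂m
      _ = _ := by ring
  rcases eq_or_ne (nl2 G) 0 with h0 | h0
  · rw [h0]; exact zero_le
  · exact (ENNReal.mul_le_mul_iff_right h0 hfin).1 key

lemma measurable_kern (s ε : ℝ) : Measurable (Function.uncurry (kern s ε)) := by
  have h : Measurable fun p : SpaceTime × SpaceTime => p.1 + p.2 :=
    measurable_fst.add measurable_snd
  have hf := measurable_jap.comp measurable_freq
  have hm := measurable_jap.comp measurable_modul
  have h1 := hf.comp h
  have h2 := hm.comp h
  have f1 : Measurable fun p : SpaceTime × SpaceTime => p.1 := measurable_fst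
  have f2 : Measurable fun p : SpaceTime × SpaceTime => p.2 := measurable_snd
  have h3 := hf.comp f1
  have h4 := hf.comp f2
  have h5 := hm.comp f1
  have h6 := hm.comp f2
  exact ((h1.pow_const _).mul ((h3.pow_const _).mul (h4.pow_const _)).inv).mul
    (((h2.pow_const _).mul (h5.pow_const _)).mul (h6.pow_const _))

lemma measurable_abs_minor (α β : Fin 4) :
    Measurable fun p : SpaceTime × SpaceTime => |p.1 α * p.2 β - p.1 β * p.2 α| := by fun_prop

lemma measurable_japPlus : Measurable japPlus := by
  have := (slow_japPlus 1).continuous.measurable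
  simpa using this

lemma measurable_nullSym (α β : Fin 4) : Measurable (Function.uncurry (nullSym α β)) := by
  have hf := measurable_jap.comp measurable_freq
  exact (measurable_abs_minor α β).div
    (((hf.comp measurable_fst).mul (measurable_japPlus.comp measurable_fst)).mul
      (measurable_japPlus.comp measurable_snd))

lemma measurable_spatialNullSym (i j : Fin 3) :
    Measurable (Function.uncurry (spatialNullSym i j)) := by
  have hf := measurable_jap.comp measurable_freq
  exact (measurable_abs_minor i.succ j.succ).div
    (((hf.comp measurable_fst).mul (hf.comp measurable_snd)).mul
      (measurable_japPlus.comp measurable_fst))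

/-- The weight of the output of the null form estimates. -/
def outWt (s ε : ℝ) (ζ : SpaceTime) : ℝ :=
  jap (freq ζ) ^ (s - 1) * jap (modul ζ) ^ (-(1 / 4 - 2 * ε))

/-- The weight of `Λ₊ u` in `H^{s,b}`. -/
def inWt (s b : ℝ) (ζ : SpaceTime) : ℝ := hWt s b ζ * japPlus ζ

lemma slow_outWt (s ε : ℝ) : Slow (outWt s ε) := (slow_freq _).mul (slow_modul _)

lemma slow_inWt (s b : ℝ) : Slow (inWt s b) :=
  (slow_hWt s b).mul (by simpa using slow_japPlus 1)

lemma hWt_pos (s b : ℝ) (ζ : SpaceTime) : 0 < hWt s b ζ :=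
  mul_pos (Real.rpow_pos_of_pos (jap_pos _) _) (Real.rpow_pos_of_pos (jap_pos _) _)

lemma outWt_pos (s ε : ℝ) (ζ : SpaceTime) : 0 < outWt s ε ζ :=
  mul_pos (Real.rpow_pos_of_pos (jap_pos _) _) (Real.rpow_pos_of_pos (jap_pos _) _)

lemma inWt_pos (s b : ℝ) (ζ : SpaceTime) : 0 < inWt s b ζ := mul_pos (hWt_pos _ _ _) (japPlus_pos _)

lemma hWt_mul_modul (s ε : ℝ) (ζ : SpaceTime) :
    hWt (s - 1) (3 / 4 + ε) ζ * jap (modul ζ) ^ (ε - 1) = outWt s ε ζ := by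
  rw [outWt, hWt, mul_assoc, ← modul, ← Real.rpow_add (jap_pos _), ← freq]
  congr 2
  ring

lemma hWt_sub_one (s b : ℝ) (ζ : SpaceTime) : jap (freq ζ) * hWt (s - 1) b ζ = hWt s b ζ := by
  rw [hWt, hWt, ← mul_assoc, freq, Real.rpow_sub_one (jap_pos _).ne',
    mul_div_cancel₀ _ (jap_pos _).ne']

lemma kern_mul (s ε : ℝ) (η θ : SpaceTime) :
    kern s ε η θ * (inWt (s - 1) (3 / 4 + ε) η * inWt (s - 1) (3 / 4 + ε) θ) =
      outWt s ε (η + θ) * (japPlus η * japPlus θ) := by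
  have e : ∀ a b ζ, hWt a b ζ = jap (freq ζ) ^ a * jap (modul ζ) ^ b := fun _ _ _ => rfl
  unfold kern inWt outWt
  rw [e, e]
  have h1 := jap_pos (freq η)
  have h2 := jap_pos (freq θ)
  have h3 := jap_pos (modul η)
  have h4 := jap_pos (modul θ)
  rw [Real.rpow_neg h3.le, Real.rpow_neg h4.le]
  field_simp

section

variable {E : Type*} [NormedAddCommGroup E] [NormedSpace ℂ E] [CompleteSpace E]

omit [CompleteSpace E] in
lemma wnorm_le_toReal_nl2 {W m : SpaceTime → ℝ} (hW : Slow W) (hW0 : ∀ ζ, 0 ≤ W ζ) (hm : Slow m)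
    (hm0 : ∀ ζ, 0 ≤ m ζ) {f g : SpaceTime → E} (hf : Continuous f) (hg : Rapid g)
    (hfg : ∀ ζ, ‖f ζ‖ ≤ m ζ * ‖g ζ‖) :
    wnorm W f ≤ (nl2 fun ζ => ENNReal.ofReal (W ζ * m ζ) * ‖g ζ‖ₑ).toReal := by
  rw [wnorm_eq_toReal_nl2 hW.1 hW0 hf]
  refine ENNReal.toReal_mono
    ((hW.mul hm).nl2_ne_top (fun ζ => mul_nonneg (hW0 ζ) (hm0 ζ)) hg)
    (nl2_mul_le_of_le fun ζ => ?_)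
  rw [ENNReal.ofReal_mul (hW0 ζ), mul_assoc]
  gcongr
  rw [← ofReal_norm, ← ofReal_norm, ← ENNReal.ofReal_mul (hm0 ζ)]
  exact ENNReal.ofReal_le_ofReal (hfg ζ)

lemma HsbNorm_LamPlus_one (s b : ℝ) (u : SchwartzMap SpaceTime E) :
    HsbNorm s b (LamPlus 1 u) =
      (nl2 fun ζ => ENNReal.ofReal (inWt s b ζ) * ‖FT u ζ‖ₑ).toReal := by
  rw [HsbNorm, wnorm_eq_toReal_nl2 (slow_hWt s b).1 (fun ζ => (hWt_pos s b ζ).le)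
    (continuous_FT _)]
  congr 3 with ζ
  rw [FT_LamPlus_one, enorm_smul, inWt, ENNReal.ofReal_mul (hWt_pos s b ζ).le, mul_assoc]
  congr 2
  rw [← ofReal_norm, norm_real, Real.norm_of_nonneg (jap_pos _).le]; rfl

lemma norm_FT_LamPlus_LamMinus_le (ε : ℝ) {w : SpaceTime → E} (hw : Rapid (FT w)) :
    Rapid (FT (LamPlus (-1) (LamMinus (ε - 1) w))) ∧
      ∀ ζ, ‖FT (LamPlus (-1) (LamMinus (ε - 1) w)) ζ‖ ≤
        (japPlus ζ)⁻¹ * jap (modul ζ) ^ (ε - 1) * ‖FT w ζ‖ := by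
  have h1 := rapid_FT_rmult (slow_modul (ε - 1)) hw
  refine ⟨rapid_FT_rmult (slow_japPlus (-1)) h1, fun ζ => ?_⟩
  refine (norm_FT_rmult_le (slow_japPlus (-1)) h1 ζ).trans ?_
  rw [norm_smul, norm_real, Real.norm_of_nonneg (Real.rpow_nonneg (japPlus_pos ζ).le _),
    Real.rpow_neg_one, mul_assoc]
  have := (japPlus_pos ζ).le
  gcongr
  refine (norm_FT_rmult_le (slow_modul (ε - 1)) hw ζ).trans_eq ?_
  rw [norm_smul, norm_real, Real.norm_of_nonneg (Real.rpow_nonneg (jap_pos _).le _)]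

lemma FsNorm_LamPlus_LamMinus_le (s ε : ℝ) {w : SpaceTime → E} (hw : Rapid (FT w)) :
    FsNorm ε s (LamPlus (-1) (LamMinus (ε - 1) w)) ≤
      (nl2 fun ζ => ENNReal.ofReal (outWt s ε ζ) * ‖FT w ζ‖ₑ).toReal := by
  obtain ⟨h1, h2⟩ := norm_FT_LamPlus_LamMinus_le ε hw
  have := wnorm_le_toReal_nl2 (f := FT (LamPlus 1 (LamPlus (-1) (LamMinus (ε - 1) w))))
    (slow_hWt (s - 1) (3 / 4 + ε)) (fun ζ => (hWt_pos _ _ ζ).le)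
    (slow_modul (ε - 1)) (fun ζ => Real.rpow_nonneg (jap_pos _).le _) (continuous_FT _) hw
    (fun ζ => by
      refine (norm_FT_rmult_le (slow_japPlus 1) h1 ζ).trans ?_
      rw [norm_smul, norm_real, Real.norm_of_nonneg (Real.rpow_nonneg (japPlus_pos ζ).le _),
        Real.rpow_one]
      have hp := japPlus_pos ζ
      calc _ ≤ japPlus ζ * ((japPlus ζ)⁻¹ * jap (modul ζ) ^ (ε - 1) * ‖FT w ζ‖) := by
            gcongr; exact h2 ζ
        _ = _ := by field_simp)
  simp only [hWt_mul_modul] at this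
  exact this

lemma HsbNorm_LamPlus_LamMinus_le (s ε : ℝ) {w : SpaceTime → E} (hw : Rapid (FT w)) :
    HsbNorm s (3 / 4 + ε) (LamPlus (-1) (LamMinus (ε - 1) w)) ≤
      (nl2 fun ζ => ENNReal.ofReal (outWt s ε ζ) * ‖FT w ζ‖ₑ).toReal := by
  obtain ⟨h1, h2⟩ := norm_FT_LamPlus_LamMinus_le ε hw
  refine (wnorm_le_toReal_nl2
    (slow_hWt s (3 / 4 + ε)) (fun ζ => (hWt_pos _ _ ζ).le)
    (by simpa only [Real.rpow_neg_one] using (slow_japPlus (-1)).mul (slow_modul (ε - 1)))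
    (fun ζ => mul_nonneg (inv_nonneg.2 (japPlus_pos ζ).le)
      (Real.rpow_nonneg (jap_pos _).le _)) (continuous_FT _) hw h2).trans ?_
  refine ENNReal.toReal_mono ((slow_outWt s ε).nl2_ne_top (fun ζ => (outWt_pos s ε ζ).le) hw)
    (nl2_mul_le_of_le fun ζ => ?_)
  gcongr
  have hp := japPlus_pos ζ
  rw [← hWt_mul_modul, ← hWt_sub_one]
  calc jap (freq ζ) * hWt (s - 1) (3 / 4 + ε) ζ * ((japPlus ζ)⁻¹ * jap (modul ζ) ^ (ε - 1))
      = jap (freq ζ) / japPlus ζ * (hWt (s - 1) (3 / 4 + ε) ζ * jap (modul ζ) ^ (ε - 1)) := by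
        field_simp
    _ ≤ 1 * (hWt (s - 1) (3 / 4 + ε) ζ * jap (modul ζ) ^ (ε - 1)) := by
        have := (hWt_pos (s - 1) (3 / 4 + ε) ζ).le
        have := Real.rpow_nonneg (jap_pos (modul ζ)).le (ε - 1)
        gcongr
        exact (div_le_one hp).2 (jap_freq_le_japPlus ζ)
    _ = _ := one_mul _

/-- Transfer of the trilinear bounds to Fourier transforms of products. -/
lemma toReal_nl2_le {s ε : ℝ} {σ : SpaceTime → SpaceTime → ℝ} {C : ℝ≥0∞}
    (h : TriBound (fun η θ => ENNReal.ofReal (kern s ε η θ * σ η θ)) C) (hC : C ≠ ⊤)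
    (hσ : Measurable (Function.uncurry σ)) {k : SpaceTime → SpaceTime → ℝ}
    {s' b c : ℝ} (hc : 0 ≤ c)
    (hk : ∀ η θ, outWt s ε (η + θ) * k η θ ≤ kern s ε η θ * σ η θ * (inWt s' b η * inWt s' b θ))
    (hkσ : ∀ η θ, 0 ≤ kern s ε η θ * σ η θ)
    {w : SpaceTime → E} (hw : Rapid (FT w)) (u v : SchwartzMap SpaceTime E)
    (hwk : ∀ ζ, ‖FT w ζ‖ₑ ≤ ENNReal.ofReal c *
      ∫⁻ η, ENNReal.ofReal (k η (ζ - η)) * (‖FT u η‖ₑ * ‖FT v (ζ - η)‖ₑ)) :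
    (nl2 fun ζ => ENNReal.ofReal (outWt s ε ζ) * ‖FT w ζ‖ₑ).toReal ≤
      (c * C.toReal + 1) * HsbNorm s' b (LamPlus 1 u) * HsbNorm s' b (LamPlus 1 v) := by
  have hm : ∀ {W : SpaceTime → ℝ}, Slow W → Measurable fun ζ => ENNReal.ofReal (W ζ) :=
    fun hW => hW.1.measurable.ennreal_ofReal
  have key := h.nl2_le ((measurable_kern s ε).mul hσ).ennreal_ofReal
    (K := fun η θ => ENNReal.ofReal (k η θ)) (hm (slow_outWt s ε)) (hm (slow_inWt s' b))
    (hm (slow_inWt s' b)) (continuous_FT w).enorm.measurable (continuous_FT u).enorm.measurable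
    (continuous_FT v).enorm.measurable ENNReal.ofReal_ne_top (fun _ => ENNReal.ofReal_ne_top)
    (fun η θ => by
      rw [← ENNReal.ofReal_mul (outWt_pos _ _ _).le, ← ENNReal.ofReal_mul (inWt_pos _ _ _).le,
        ← ENNReal.ofReal_mul (hkσ η θ)]
      exact ENNReal.ofReal_le_ofReal (hk η θ)) hwk
    ((slow_outWt s ε).nl2_ne_top (fun ζ => (outWt_pos s ε ζ).le) hw)
  have fin : ∀ u : SchwartzMap SpaceTime E,
      nl2 (fun ζ => ENNReal.ofReal (inWt s' b ζ) * ‖FT u ζ‖ₑ) ≠ ⊤ := fun u =>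
    (slow_inWt s' b).nl2_ne_top (fun ζ => (inWt_pos s' b ζ).le) (schwartz_rapid (𝓕 u))
  have := ENNReal.toReal_mono (ENNReal.mul_ne_top (ENNReal.mul_ne_top
    (ENNReal.mul_ne_top ENNReal.ofReal_ne_top hC) (fin u)) (fin v)) key
  rw [ENNReal.toReal_mul, ENNReal.toReal_mul, ENNReal.toReal_mul, ENNReal.toReal_ofReal hc] at this
  rw [HsbNorm_LamPlus_one, HsbNorm_LamPlus_one]
  refine this.trans ?_
  gcongr
  linarith

end

section

variable {E : Type*} [NormedAddCommGroup E] [NormedSpace ℂ E] [CompleteSpace E]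

lemma kern_pos (s ε : ℝ) (η θ : SpaceTime) : 0 < kern s ε η θ := by
  have h : ∀ x r : ℝ, 0 < jap x ^ r := fun x r => Real.rpow_pos_of_pos (jap_pos x) r
  exact mul_pos (mul_pos (h _ _) (inv_pos.2 (mul_pos (h _ _) (h _ _))))
    (mul_pos (mul_pos (h _ _) (h _ _)) (h _ _))

/-- The null form estimate in `H^{s,b}`. -/
lemma HsbNorm_bilinNull_le {s ε : ℝ} {C : ℝ≥0∞} (hC : C ≠ ⊤) {α β : Fin 4}
    (h : TriBound (fun η θ => ENNReal.ofReal (kern s ε η θ * nullSym α β η θ)) C)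
    (B : E →L[ℂ] E →L[ℂ] E) :
    ∃ K > 0, ∀ u v : SchwartzMap SpaceTime E,
    HsbNorm s (3 / 4 + ε) (LamPlus (-1) (LamMinus (ε - 1) (bilinNull B α β u v))) ≤
      K * HsbNorm s (3 / 4 + ε) (LamPlus 1 u) * HsbNorm s (3 / 4 + ε) (LamPlus 1 v) := by
  refine ⟨4 * Real.pi ^ 2 * ‖B‖ * C.toReal + 1, by positivity, fun u v => ?_⟩
  obtain ⟨hw, hwk⟩ := FT_bilinNull B α β u v
  refine (HsbNorm_LamPlus_LamMinus_le s ε hw).trans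
    (toReal_nl2_le h hC (measurable_nullSym α β)
      (k := fun η θ => |η α * θ β - η β * θ α|) (by positivity) (fun η θ => ?_)
      (fun η θ => mul_nonneg (kern_pos s ε η θ).le (nullSym_nonneg α β η θ)) hw u v hwk)
  have hX := jap_pos (freq η)
  have hP := japPlus_pos η
  have hR := japPlus_pos θ
  have e : ∀ ζ, inWt s (3 / 4 + ε) ζ = jap (freq ζ) * inWt (s - 1) (3 / 4 + ε) ζ := fun ζ => by
    rw [inWt, inWt, ← hWt_sub_one, mul_assoc]
  calc outWt s ε (η + θ) * |η α * θ β - η β * θ α|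
      ≤ outWt s ε (η + θ) * |η α * θ β - η β * θ α| * jap (freq θ) :=
        le_mul_of_one_le_right (mul_nonneg (outWt_pos s ε _).le (abs_nonneg _)) (one_le_jap _)
    _ = outWt s ε (η + θ) * (japPlus η * japPlus θ) *
          (nullSym α β η θ * (jap (freq η) * jap (freq θ))) := by
        rw [nullSym]; field_simp
    _ = _ := by rw [← kern_mul, e, e]; ring

/-- The estimate in `F^s` for `Q(Λ⁻¹ u, v)`. -/
lemma FsNorm_bilinNull_Lam_le {s ε : ℝ} {C : ℝ≥0∞} (hC : C ≠ ⊤) {α β : Fin 4}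
    (h : TriBound (fun η θ => ENNReal.ofReal (kern s ε η θ * nullSym α β η θ)) C)
    (B : E →L[ℂ] E →L[ℂ] E) :
    ∃ K > 0, ∀ u v : SchwartzMap SpaceTime E,
    FsNorm ε s (LamPlus (-1) (LamMinus (ε - 1) (bilinNull B α β (Lam (-1) u) v))) ≤
      K * FsNorm ε s u * FsNorm ε s v := by
  refine ⟨4 * Real.pi ^ 2 * ‖B‖ * C.toReal + 1, by positivity, fun u v => ?_⟩
  obtain ⟨u', hu', hFu'⟩ := exists_schwartz_Lam (-1) u
  rw [← hu']
  obtain ⟨hw, hwk⟩ := FT_bilinNull B α β u' v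
  refine (FsNorm_LamPlus_LamMinus_le s ε hw).trans
    (toReal_nl2_le h hC (measurable_nullSym α β)
      (k := fun η θ => |η α * θ β - η β * θ α| * jap (freq η) ^ (-1 : ℝ))
      (by positivity) (fun η θ => ?_)
      (fun η θ => mul_nonneg (kern_pos s ε η θ).le (nullSym_nonneg α β η θ)) hw u v
      fun ζ => (hwk ζ).trans_eq ?_)
  · have hX := jap_pos (freq η)
    have hP := japPlus_pos η
    have hR := japPlus_pos θ
    rw [mul_right_comm, kern_mul, nullSym, Real.rpow_neg_one]
    apply le_of_eq
    field_simp
  · congr 2 with η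
    have hX := Real.rpow_nonneg (jap_pos (freq η)).le (-1)
    rw [hFu', enorm_smul, ← ofReal_norm (_ : ℂ), norm_real, Real.norm_of_nonneg hX,
      ENNReal.ofReal_mul (abs_nonneg _)]
    ring

/-- The estimate in `F^s` for `Q_{ij}(Λ⁻¹ u, Λ⁻¹ ∂_γ v)`. -/
lemma FsNorm_bilinNull_Lam_Lam_pd_le {s ε : ℝ} {C : ℝ≥0∞} (hC : C ≠ ⊤) {i j : Fin 3}
    (h : TriBound (fun η θ => ENNReal.ofReal (kern s ε η θ * spatialNullSym i j η θ)) C)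
    (B : E →L[ℂ] E →L[ℂ] E) (γ : Fin 4) :
    ∃ K > 0, ∀ u v : SchwartzMap SpaceTime E,
    FsNorm ε s (LamPlus (-1) (LamMinus (ε - 1)
        (bilinNull B i.succ j.succ (Lam (-1) u) (Lam (-1) (pd γ v))))) ≤
      K * FsNorm ε s u * FsNorm ε s v := by
  refine ⟨4 * Real.pi ^ 2 * ‖B‖ * (2 * Real.pi) * C.toReal + 1, by positivity, fun u v => ?_⟩
  obtain ⟨u', hu', hFu'⟩ := exists_schwartz_Lam (-1) u
  obtain ⟨z, hz, hFz⟩ := exists_schwartz_pd γ v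
  obtain ⟨v', hv', hFv'⟩ := exists_schwartz_Lam (-1) z
  rw [← hu', ← hz, ← hv']
  obtain ⟨hw, hwk⟩ := FT_bilinNull B i.succ j.succ u' v'
  refine (FsNorm_LamPlus_LamMinus_le s ε hw).trans
    (toReal_nl2_le h hC (measurable_spatialNullSym i j)
      (k := fun η θ => |η i.succ * θ j.succ - η j.succ * θ i.succ| * jap (freq η) ^ (-1 : ℝ) *
        jap (freq θ) ^ (-1 : ℝ) * |θ γ|)
      (by positivity) (fun η θ => ?_)
      (fun η θ => mul_nonneg (kern_pos s ε η θ).le (spatialNullSym_nonneg i j η θ)) hw u v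
      fun ζ => (hwk ζ).trans_eq ?_)
  · have hX := jap_pos (freq η)
    have hY := jap_pos (freq θ)
    have hP := japPlus_pos η
    have hO := (outWt_pos s ε (η + θ)).le
    calc _ ≤ outWt s ε (η + θ) * (|η i.succ * θ j.succ - η j.succ * θ i.succ| *
          jap (freq η) ^ (-1 : ℝ) * jap (freq θ) ^ (-1 : ℝ) * japPlus θ) := by
          gcongr
          exact abs_coord_le_japPlus θ γ
      _ = _ := by
          rw [mul_right_comm (kern s ε η θ), kern_mul, spatialNullSym, Real.rpow_neg_one,
            Real.rpow_neg_one]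
          field_simp
  · rw [ENNReal.ofReal_mul (p := 4 * Real.pi ^ 2 * ‖B‖) (q := 2 * Real.pi) (by positivity),
      mul_assoc (ENNReal.ofReal (4 * Real.pi ^ 2 * ‖B‖)),
      ← lintegral_const_mul' (ENNReal.ofReal (2 * Real.pi)) _ ENNReal.ofReal_ne_top]
    congr 2 with η
    have hX := Real.rpow_nonneg (jap_pos (freq η)).le (-1)
    have hY := Real.rpow_nonneg (jap_pos (freq (ζ - η))).le (-1)
    have hn : ‖(2 * Real.pi * I * ((ζ - η) γ : ℝ) : ℂ)‖ = 2 * Real.pi * |(ζ - η) γ| := by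
      rw [norm_mul, norm_real, Real.norm_eq_abs]
      simp [abs_of_pos Real.pi_pos]
    have e : ‖FT v' (ζ - η)‖ₑ = ENNReal.ofReal (2 * Real.pi) *
        (ENNReal.ofReal (jap (freq (ζ - η)) ^ (-1 : ℝ)) * ENNReal.ofReal |(ζ - η) γ|) *
          ‖FT v (ζ - η)‖ₑ := by
      rw [hFv', enorm_smul, hFz, enorm_smul, ← ofReal_norm (_ : ℂ), norm_real,
        Real.norm_of_nonneg hY, ← ofReal_norm (_ : ℂ), hn, ENNReal.ofReal_mul (by positivity)]
      ring
    rw [e, hFu', enorm_smul, ← ofReal_norm (_ : ℂ), norm_real, Real.norm_of_nonneg hX,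
      ENNReal.ofReal_mul (q := |(ζ - η) γ|) (by positivity),
      ENNReal.ofReal_mul (q := jap (freq (ζ - η)) ^ (-1 : ℝ)) (by positivity),
      ENNReal.ofReal_mul (abs_nonneg _)]
    ring

/-- The matrix commutator as a continuous bilinear map. -/
def commB (n : ℕ) : G n →L[ℂ] G n →L[ℂ] G n :=
  LinearMap.mkContinuous₂ (LinearMap.mk₂ ℂ mcomm
    (fun X Y Z => by simp only [mcomm]; noncomm_ring)
    (fun c X Y => by simp only [mcomm, Matrix.smul_mul, Matrix.mul_smul, smul_sub])
    (fun X Y Z => by simp only [mcomm]; noncomm_ring)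
    (fun c X Y => by simp only [mcomm, Matrix.smul_mul, Matrix.mul_smul, smul_sub])) 2
    fun X Y => by
      refine (norm_sub_le (X * Y) (Y * X)).trans ?_
      linarith [Matrix.frobenius_norm_mul X Y, Matrix.frobenius_norm_mul Y X]

end

end NullForm

/-- for `s > 3/4` and sufficiently small `ε > 0`, the null form estimate
`‖Λ₊^{-1}Λ₋^{ε-1}Q(u,v)‖_{H^{s,3/4+ε}} ≲ ‖Λ₊u‖_{H^{s,3/4+ε}} ‖Λ₊v‖_{H^{s,3/4+ε}}` holds for
`Q ∈ {Q_{0i}, Q_{ij}}`, and in particular the commutator versions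
`‖Λ₊^{-1}Λ₋^{ε-1}Q[Λ^{-1}A,A']‖_{F^s} ≲ ‖A‖_{F^s}‖A'‖_{F^s}` and
`‖Λ₊^{-1}Λ₋^{ε-1}Q_{ij}[Λ^{-1}A,Λ^{-1}∂A']‖_{F^s} ≲ ‖A‖_{F^s}‖A'‖_{F^s}` hold. -/
theorem null_form_Fs_estimates (s : ℝ) (hs : s > 3/4) :
    ∃ ε₀ > (0:ℝ), ∀ ε : ℝ, 0 < ε → ε < ε₀ →
      (∀ α β : Fin 4, β ≠ 0 → ∃ C > 0, ∀ u v : SchwartzMap SpaceTime ℂ,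
        HsbNorm s (3/4+ε) (LamPlus (-1) (LamMinus (ε-1) (Qf α β ⇑u ⇑v)))
          ≤ C * HsbNorm s (3/4+ε) (LamPlus 1 ⇑u) * HsbNorm s (3/4+ε) (LamPlus 1 ⇑v)) ∧
      (∀ n : ℕ, ∀ α β : Fin 4, β ≠ 0 → ∃ C > 0, ∀ A A' : SchwartzMap SpaceTime (G n),
        FsNorm ε s (LamPlus (-1) (LamMinus (ε-1) (Qc α β (Lam (-1) ⇑A) ⇑A')))
          ≤ C * FsNorm ε s ⇑A * FsNorm ε s ⇑A') ∧
      (∀ n : ℕ, ∀ i j : Fin 3, ∀ γ : Fin 4, ∃ C > 0, ∀ A A' : SchwartzMap SpaceTime (G n),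
        FsNorm ε s (LamPlus (-1) (LamMinus (ε-1)
            (Qc i.succ j.succ (Lam (-1) ⇑A) (Lam (-1) (pd γ ⇑A')))))
          ≤ C * FsNorm ε s ⇑A * FsNorm ε s ⇑A') := by
  obtain ⟨ε₀, hε₀, h⟩ := NullForm.triBound_kern hs
  refine ⟨ε₀, hε₀, fun ε h0 h1 => ?_⟩
  obtain ⟨C, hC, h⟩ := h ε h0 h1
  exact ⟨fun α β _ => NullForm.HsbNorm_bilinNull_le hC (h _ (NullForm.nullSymbol_nullSym α β))
      (ContinuousLinearMap.mul ℂ ℂ),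
    fun n α β _ => NullForm.FsNorm_bilinNull_Lam_le hC (h _ (NullForm.nullSymbol_nullSym α β))
      (NullForm.commB n),
    fun n i j γ => NullForm.FsNorm_bilinNull_Lam_Lam_pd_le hC
      (h _ (NullForm.nullSymbol_spatialNullSym i j)) (NullForm.commB n) γ⟩
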